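/- For every constant C₀ > 0 there exist ε > 0 and C > 0, depending only on Ω and C₀, such that the following holds: for every λ > 0 and every Neumann eigenfunction φ of Ω with eigenvalue λ² which satisfies the asymptotic Schiffer condition ∫₀^ℓ (d/ds φ(q(s)))² ds ≥ e^{−2C₀λ} · ∫₀^ℓ φ(q(s))² ds, there is a function F : ℂ → ℂ, holomorphic on the strip S_ε = {t ∈ ℂ : |Im t| < ε}, with F(t + ℓ) = F(t) for all t ∈ S_ε and F(s) = φ(q(s)) for all real s, and the set of complex boundary critical points {t ∈ ℂ : 0 ≤ Re t < ℓ, |Im t| ≤ ε/2, F'(t) = 0} is finite and has cardinality at most C·λ. -/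

import Mathlib

open MeasureTheory Real
open scoped RealInnerProductSpace

noncomputable section

abbrev E2 : Type := EuclideanSpace ℝ (Fin 2)

/-- The Euclidean Laplacian `∂²/∂x₁² + ∂²/∂x₂²` on `ℝ²`. -/
def lap (φ : E2 → ℝ) (x : E2) : ℝ :=
  ∑ i : Fin 2,
    fderiv ℝ (fun y => fderiv ℝ φ y (EuclideanSpace.single i 1)) x (EuclideanSpace.single i 1)

/-- A bounded open connected planar domain. -/
structure IsPlaneDomain (Ω : Set E2) : Prop where
  isOpen : IsOpen Ω
  isBounded : Bornology.IsBounded Ω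
  isConnected : IsConnected Ω

/-- An arc-length parametrization `q` of the boundary of `Ω` (periodic with period `len`,
injective on `[0, len)`, unit speed, image equal to the frontier of `Ω`), together with the
unit normal `ν` along the boundary, pointing into `Ω`. -/
structure BoundaryParam (Ω : Set E2) where
  len : ℝ
  len_pos : 0 < len
  q : ℝ → E2
  qd : ℝ → E2
  hasDerivAt : ∀ s, HasDerivAt q (qd s) s
  periodic : Function.Periodic q len
  injOn : Set.InjOn q (Set.Ico 0 len)
  unitSpeed : ∀ s, ‖qd s‖ = 1
  range_eq : Set.range q = frontier Ω
  ν : ℝ → E2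
  ν_unit : ∀ s, ‖ν s‖ = 1
  ν_orth : ∀ s, ⟪ν s, qd s⟫ = 0
  ν_inward : ∀ s, ∃ δ > 0, ∀ t ∈ Set.Ioo (0 : ℝ) δ, q s + t • ν s ∈ Ω

/-- The boundary parametrization is real-analytic. -/
def BoundaryParam.IsAnalytic {Ω : Set E2} (B : BoundaryParam Ω) : Prop :=
  AnalyticOnNhd ℝ B.q Set.univ

/-- `φ` is a Neumann eigenfunction of `Ω` with eigenvalue `lam²`: it is real-analytic on an
open neighborhood of the closure of `Ω`, not identically zero on `Ω`, satisfies
`Δφ = -lam² φ` on `Ω` and has vanishing normal derivative along the boundary. -/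
structure IsNeumannEigenfunction {Ω : Set E2} (B : BoundaryParam Ω) (lam : ℝ)
    (φ : E2 → ℝ) : Prop where
  analytic : ∃ U : Set E2, IsOpen U ∧ closure Ω ⊆ U ∧ AnalyticOnNhd ℝ φ U
  nontrivial : ∃ x ∈ Ω, φ x ≠ 0
  eigen : ∀ x ∈ Ω, lap φ x = -lam ^ 2 * φ x
  neumann : ∀ s : ℝ, ⟪gradient φ (B.q s), B.ν s⟫ = 0

open Set Filter Topology in
/-- Two holomorphic functions on a connected open set which agree on a real interval coincide. -/
theorem eqOn_of_eventually_eq_real {f g : ℂ → ℂ} {U : Set ℂ} (hU : IsOpen U)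
    (hc : IsPreconnected U) (hf : DifferentiableOn ℂ f U) (hg : DifferentiableOn ℂ g U)
    {x₀ : ℝ} (hx : (x₀ : ℂ) ∈ U) (h : ∀ᶠ x : ℝ in 𝓝 x₀, f x = g x) : EqOn f g U := by
  refine (hf.analyticOnNhd hU).eqOn_of_preconnected_of_frequently_eq (hg.analyticOnNhd hU) hc hx ?_
  have h1 : ∃ᶠ x : ℝ in 𝓝[≠] x₀, f x = g x := (h.filter_mono nhdsWithin_le_nhds).frequently
  have h2 : Tendsto (fun x : ℝ => (x : ℂ)) (𝓝[≠] x₀) (𝓝[≠] (x₀ : ℂ)) := by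
    refine tendsto_nhdsWithin_iff.2 ⟨?_, ?_⟩
    · exact (Complex.continuous_ofReal.tendsto x₀).mono_left nhdsWithin_le_nhds
    · filter_upwards [self_mem_nhdsWithin] with x hx
      simpa using hx
  exact h2.frequently h1

/-- The horizontal strip of half-width `r` around the real axis. -/
def realStrip (r : ℝ) : Set ℂ := {t : ℂ | |t.im| < r}

theorem isOpen_realStrip (r : ℝ) : IsOpen (realStrip r) :=
  isOpen_lt (Complex.continuous_im.abs) continuous_const

theorem convex_realStrip (r : ℝ) : Convex ℝ (realStrip r) := by
  have : realStrip r = Complex.imLm ⁻¹' (Set.Ioo (-r) r) := by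
    ext t; simp [realStrip, abs_lt]
  rw [this]
  exact (convex_Ioo _ _).linear_preimage _

theorem ofReal_mem_realStrip {r : ℝ} (hr : 0 < r) (x : ℝ) : (x : ℂ) ∈ realStrip r := by
  simpa [realStrip] using hr

open Set Filter Topology in
/-- Holomorphic local extensions, of uniform size, of a function on the real line patch together
to a holomorphic function on a strip. -/
theorem differentiableOn_patch_realStrip {f : ℝ → ℂ} {r : ℝ} (g : ℝ → ℂ → ℂ)
    (hg : ∀ s : ℝ, DifferentiableOn ℂ (g s) (Metric.ball (s : ℂ) r))
    (hgf : ∀ s x : ℝ, |x - s| < r → g s x = f x) :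
    DifferentiableOn ℂ (fun t => g t.re t) (realStrip r) := by
  intro t₀ ht₀
  have hr : 0 < r := lt_of_le_of_lt (abs_nonneg _) ht₀
  have key : ∀ t : ℂ, ‖t - (t.re : ℂ)‖ = |t.im| := by
    intro t
    have : t - (t.re : ℂ) = t.im * Complex.I := by
      apply Complex.ext <;> simp
    rw [this]; simp
  have hev : (fun t : ℂ => g t.re t) =ᶠ[𝓝 t₀] g t₀.re := by
    have h1 : ∀ᶠ t : ℂ in 𝓝 t₀, ‖t - (t₀.re : ℂ)‖ < r := by
      apply (isOpen_lt (by fun_prop) continuous_const).mem_nhds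
      change ‖t₀ - (t₀.re : ℂ)‖ < r
      rw [key]; exact ht₀
    have h2 : ∀ᶠ t : ℂ in 𝓝 t₀, |t.re - t₀.re| < r := by
      apply (isOpen_lt (by fun_prop) continuous_const).mem_nhds
      simpa using hr
    filter_upwards [h1, h2, (isOpen_realStrip r).mem_nhds ht₀] with t h1 h2 h3
    have hmid : (((t.re + t₀.re) / 2 : ℝ) : ℂ) ∈ Metric.ball (t.re : ℂ) r ∩
        Metric.ball (t₀.re : ℂ) r := by
      rw [abs_lt] at h2
      constructor
      · rw [Metric.mem_ball, dist_eq_norm, ← Complex.ofReal_sub, Complex.norm_real,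
          Real.norm_eq_abs, abs_lt]
        constructor <;> linarith
      · rw [Metric.mem_ball, dist_eq_norm, ← Complex.ofReal_sub, Complex.norm_real,
          Real.norm_eq_abs, abs_lt]
        constructor <;> linarith
    have hop : IsOpen (Metric.ball (t.re : ℂ) r ∩ Metric.ball (t₀.re : ℂ) r) :=
      Metric.isOpen_ball.inter Metric.isOpen_ball
    refine eqOn_of_eventually_eq_real hop
      ((convex_ball _ _).inter (convex_ball _ _)).isPreconnected
      ((hg t.re).mono inter_subset_left) ((hg t₀.re).mono inter_subset_right) hmid ?_
      ⟨?_, ?_⟩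
    · have : ∀ᶠ x : ℝ in 𝓝 ((t.re + t₀.re) / 2), (x : ℂ) ∈ Metric.ball (t.re : ℂ) r ∩
          Metric.ball (t₀.re : ℂ) r :=
        Complex.continuous_ofReal.continuousAt.preimage_mem_nhds (hop.mem_nhds hmid)
      filter_upwards [this] with x hx
      have ha := hx.1
      have hb := hx.2
      rw [Metric.mem_ball, dist_eq_norm, ← Complex.ofReal_sub, Complex.norm_real,
          Real.norm_eq_abs] at ha hb
      rw [hgf _ _ ha, hgf _ _ hb]
    · rw [Metric.mem_ball, dist_eq_norm, key]; exact h3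
    · rw [Metric.mem_ball, dist_eq_norm]; exact h1
  have hd : DifferentiableAt ℂ (g t₀.re) t₀ := by
    refine (hg t₀.re).differentiableAt (Metric.isOpen_ball.mem_nhds ?_)
    rw [Metric.mem_ball, dist_eq_norm, key]; exact ht₀
  exact (hev.differentiableAt_iff.2 hd).differentiableWithinAt

/-- The holomorphic extension of a periodic function to a strip is periodic. -/
theorem periodic_of_periodic_real {F : ℂ → ℂ} {r ℓ : ℝ}
    (hF : DifferentiableOn ℂ F (realStrip r)) (hp : ∀ s : ℝ, F ((s : ℂ) + ℓ) = F s) :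
    ∀ t ∈ realStrip r, F (t + ℓ) = F t := by
  intro t ht
  have hr : 0 < r := lt_of_le_of_lt (abs_nonneg _) ht
  refine eqOn_of_eventually_eq_real (f := fun t => F (t + ℓ)) (isOpen_realStrip r)
    (convex_realStrip r).isPreconnected ?_ hF (x₀ := 0) (ofReal_mem_realStrip hr 0) ?_ ht
  · refine hF.comp (by fun_prop) ?_
    intro t ht
    simpa [realStrip] using ht
  · exact Filter.Eventually.of_forall hp

theorem differentiableOn_tsum_pow {c : ℕ → ℂ} {M B : ℝ} (hB : 0 < B)
    (hc : ∀ n, ‖c n‖ ≤ M * B ^ n) (s : ℂ) :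
    DifferentiableOn ℂ (fun t => ∑' n, c n * (t - s) ^ n) (Metric.ball s (1 / B)) := by
  set p := FormalMultilinearSeries.ofScalars ℂ c with hp
  obtain ⟨b, hb⟩ : ∃ b : NNReal, (b : ℝ) = 1 / B := ⟨⟨1 / B, by positivity⟩, rfl⟩
  have hrad : (b : ENNReal) ≤ p.radius := by
    refine p.le_radius_of_bound M fun n => ?_
    rw [hp, FormalMultilinearSeries.ofScalars_norm]
    rw [hb]
    calc ‖c n‖ * (1 / B) ^ n ≤ M * B ^ n * (1 / B) ^ n := by gcongr; exact hc n
      _ = M := by rw [mul_assoc, ← mul_pow, mul_one_div_cancel hB.ne', one_pow, mul_one]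
  have hpos : 0 < p.radius := lt_of_lt_of_le (by
    rw [ENNReal.coe_pos, ← NNReal.coe_pos, hb]; positivity) hrad
  have hd := (p.hasFPowerSeriesOnBall hpos).differentiableOn
  have heq : (fun t => ∑' n, c n * (t - s) ^ n) = fun t => p.sum (t - s) := by
    funext t
    simp [FormalMultilinearSeries.sum, hp, mul_comm]
  rw [heq]
  refine hd.comp (by fun_prop) ?_
  intro t ht
  rw [Metric.mem_eball, edist_eq_enorm_sub, sub_zero]
  refine lt_of_lt_of_le ?_ hrad
  rw [Metric.mem_ball, dist_eq_norm] at ht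
  rw [enorm_eq_nnnorm, ENNReal.coe_lt_coe, ← NNReal.coe_lt_coe, hb]
  exact ht

theorem norm_tsum_pow_le {c : ℕ → ℂ} {M B : ℝ} (hB : 0 < B) (hM : 0 ≤ M)
    (hc : ∀ n, ‖c n‖ ≤ M * B ^ n) {z : ℂ} (hz : ‖z‖ ≤ 1 / (2 * B)) :
    ‖∑' n, c n * z ^ n‖ ≤ 2 * M := by
  have hs : HasSum (fun n : ℕ => M * (1 / 2 : ℝ) ^ n) (2 * M) := by
    have := (hasSum_geometric_of_lt_one (r := (1 / 2 : ℝ)) (by norm_num) (by norm_num)).mul_left M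
    norm_num at this
    rwa [mul_comm] at this
  refine tsum_of_norm_bounded hs fun n => ?_
  rw [norm_mul, norm_pow]
  calc ‖c n‖ * ‖z‖ ^ n ≤ (M * B ^ n) * (1 / (2 * B)) ^ n := by gcongr; exact hc n
    _ = M * (1 / 2) ^ n := by
      rw [mul_assoc, ← mul_pow]; congr 2; field_simp

open Set Filter Topology in
/-- A function on the line with uniform analytic bounds for its derivatives has a holomorphic
extension to a strip, with a bound. -/
theorem exists_strip_extension_of_iteratedDeriv_le {f : ℝ → ℝ} (hf : AnalyticOnNhd ℝ f univ)
    {M B : ℝ} (hB : 0 < B) (hM : 0 ≤ M)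
    (hbd : ∀ k s, |iteratedDeriv k f s| ≤ M * B ^ k * k.factorial) :
    ∃ F : ℂ → ℂ, DifferentiableOn ℂ F (realStrip (1 / B)) ∧ (∀ s : ℝ, F s = f s) ∧
      ∀ t : ℂ, |t.im| ≤ 1 / (2 * B) → ‖F t‖ ≤ 2 * M := by
  set c : ℝ → ℕ → ℂ := fun s n => ((iteratedDeriv n f s / n.factorial : ℝ) : ℂ) with hcdef
  have hc : ∀ s n, ‖c s n‖ ≤ M * B ^ n := by
    intro s n
    rw [hcdef]
    simp only [Complex.norm_real, Real.norm_eq_abs, abs_div, Nat.abs_cast]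
    rw [div_le_iff₀ (by positivity)]
    exact hbd n s
  set g : ℝ → ℂ → ℂ := fun s t => ∑' n, c s n * (t - s) ^ n with hg
  have hgd : ∀ s : ℝ, DifferentiableOn ℂ (g s) (Metric.ball (s : ℂ) (1 / B)) := fun s =>
    differentiableOn_tsum_pow hB (hc s) s
  have hgf : ∀ s x : ℝ, |x - s| < 1 / B → g s x = f x := by
    intro s x hx
    have h1 : AnalyticOnNhd ℝ (fun x : ℝ => g s x) (Metric.ball s (1 / B)) := by
      intro y hy
      have h2 : AnalyticAt ℂ (g s) (y : ℂ) := by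
        refine (hgd s).analyticOnNhd Metric.isOpen_ball _ ?_
        rw [Metric.mem_ball, dist_eq_norm, ← Complex.ofReal_sub, Complex.norm_real]
        exact hy
      exact (h2.restrictScalars (𝕜 := ℝ)).comp_of_eq (Complex.ofRealCLM.analyticAt y) rfl
    have h2 : AnalyticOnNhd ℝ (fun x : ℝ => (f x : ℂ)) (Metric.ball s (1 / B)) := by
      intro y hy
      exact (Complex.ofRealCLM.analyticAt (f y)).comp (hf y trivial)
    refine h1.eqOn_of_preconnected_of_eventuallyEq h2 (convex_ball s _).isPreconnected
      (Metric.mem_ball_self (by positivity)) ?_ hx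
    have h3 := (hf s trivial).hasFPowerSeriesAt.eventually_hasSum
    have h4 : Tendsto (fun y : ℝ => y - s) (𝓝 s) (𝓝 0) := by
      have : ContinuousAt (fun y : ℝ => y - s) s := by fun_prop
      simpa [ContinuousAt] using this
    filter_upwards [h4.eventually h3] with y hy
    simp only [FormalMultilinearSeries.ofScalars_apply_eq, add_sub_cancel, smul_eq_mul] at hy
    have h5 := (Complex.hasSum_ofReal.2 hy).tsum_eq
    rw [← h5, hg]
    simp [hcdef]
  refine ⟨fun t => g t.re t, differentiableOn_patch_realStrip g hgd hgf, ?_, ?_⟩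
  · intro s
    simpa using hgf s s (by simpa using hB)
  · intro t ht
    refine norm_tsum_pow_le hB hM (hc _) ?_
    have : t - (t.re : ℂ) = t.im * Complex.I := by apply Complex.ext <;> simp
    rw [this]; simpa using ht

open Set Filter Topology in
/-- A real-analytic function is locally the restriction of a holomorphic one. -/
theorem exists_local_extension_of_analyticAt {f : ℝ → ℂ} {s : ℝ} (hf : AnalyticAt ℝ f s) :
    ∃ r > 0, ∃ g : ℂ → ℂ, DifferentiableOn ℂ g (Metric.ball (s : ℂ) r) ∧
      ∀ x : ℝ, |x - s| < r → g x = f x := by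
  obtain ⟨p, hp⟩ := hf
  obtain ⟨ρ, hρ⟩ := hp
  obtain ⟨r', hr'0, hr'⟩ : ∃ r' : NNReal, 0 < r' ∧ (r' : ENNReal) < ρ := by
    obtain ⟨r', h1, h2⟩ := ENNReal.lt_iff_exists_nnreal_btwn.1 hρ.r_pos
    exact ⟨r', by exact_mod_cast h1, h2⟩
  obtain ⟨M, hM0, hM⟩ := p.norm_mul_pow_le_of_lt_radius (hr'.trans_le hρ.r_le)
  have hr0 : (0 : ℝ) < r' := hr'0
  have hc : ∀ n, ‖p.coeff n‖ ≤ M * (1 / (r' : ℝ)) ^ n := by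
    intro n
    have := hM n
    rw [FormalMultilinearSeries.norm_apply_eq_norm_coef] at this
    rw [one_div, inv_pow, ← div_eq_mul_inv, le_div_iff₀ (by positivity)]
    exact this
  refine ⟨r', hr0, fun t => ∑' n, p.coeff n * (t - s) ^ n, ?_, ?_⟩
  · simpa using differentiableOn_tsum_pow (B := 1 / (r' : ℝ)) (by positivity) hc s
  · intro x hx
    have hmem : x - s ∈ Metric.eball (0 : ℝ) ρ := by
      rw [Metric.mem_eball, edist_eq_enorm_sub, sub_zero]
      refine lt_trans ?_ hr'
      rw [enorm_eq_nnnorm, ENNReal.coe_lt_coe]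
      exact hx
    have h1 := (hρ.hasSum hmem).tsum_eq
    rw [add_sub_cancel] at h1
    rw [← h1]
    refine tsum_congr fun n => ?_
    rw [FormalMultilinearSeries.apply_eq_pow_smul_coeff, Complex.real_smul]
    push_cast
    ring

open Set Filter Topology in
/-- A periodic real-analytic function on the line extends holomorphically to a strip. -/
theorem exists_strip_extension_of_periodic {f : ℝ → ℂ} (hf : AnalyticOnNhd ℝ f univ) {ℓ : ℝ}
    (hℓ : 0 < ℓ) (hp : Function.Periodic f ℓ) :
    ∃ r > 0, ∃ F : ℂ → ℂ, DifferentiableOn ℂ F (realStrip r) ∧ (∀ s : ℝ, F s = f s) := by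
  choose ρ hρ g hgd hgf using fun s => exists_local_extension_of_analyticAt (hf s trivial)
  obtain ⟨δ, hδ, hleb⟩ : ∃ δ > 0, ∀ x ∈ Icc 0 ℓ, ∃ i : ℝ, Metric.ball x δ ⊆ Metric.ball i (ρ i) :=
    lebesgue_number_lemma_of_metric isCompact_Icc (fun _ => Metric.isOpen_ball)
      (fun x _ => mem_iUnion.2 ⟨x, Metric.mem_ball_self (hρ x)⟩)
  -- local extensions of uniform size
  have hloc : ∀ s : ℝ, ∃ h : ℂ → ℂ, DifferentiableOn ℂ h (Metric.ball (s : ℂ) (δ / 2)) ∧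
      ∀ x : ℝ, |x - s| < δ / 2 → h x = f x := by
    intro s
    set n : ℤ := ⌊s / ℓ⌋
    have hy : s - n * ℓ ∈ Icc 0 ℓ := by
      have h1 : (n : ℝ) ≤ s / ℓ := Int.floor_le _
      have h2 : s / ℓ < n + 1 := Int.lt_floor_add_one _
      rw [le_div_iff₀ hℓ] at h1
      rw [div_lt_iff₀ hℓ] at h2
      constructor <;> linarith
    obtain ⟨i, hi⟩ := hleb _ hy
    have hreal : ∀ x : ℝ, |x - (s - n * ℓ)| < δ → |x - i| < ρ i := fun x hx => hi hx
    have hsub : ∀ t ∈ Metric.ball ((s - n * ℓ : ℝ) : ℂ) (δ / 2), t ∈ Metric.ball (i : ℂ) (ρ i) := by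
      intro t ht
      have hd1 : |s - n * ℓ - i| + δ / 2 ≤ ρ i := by
        rcases le_total 0 (s - n * ℓ - i) with h0 | h0
        · have := hreal (s - n * ℓ + δ / 2) (by
            rw [add_sub_cancel_left, abs_of_pos (by positivity)]; linarith)
          rw [abs_of_nonneg h0]
          have := le_abs_self (s - n * ℓ + δ / 2 - i)
          linarith
        · have := hreal (s - n * ℓ - δ / 2) (by
            rw [show s - n * ℓ - δ / 2 - (s - n * ℓ) = -(δ / 2) by ring, abs_neg,
              abs_of_pos (by positivity)]; linarith)
          rw [abs_of_nonpos h0]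
          have := neg_abs_le (s - n * ℓ - δ / 2 - i)
          linarith
      have hd2 : dist ((s - n * ℓ : ℝ) : ℂ) (i : ℂ) = |s - n * ℓ - i| := by
        rw [dist_eq_norm, ← Complex.ofReal_sub, Complex.norm_real, Real.norm_eq_abs]
      rw [Metric.mem_ball] at ht ⊢
      have := dist_triangle t ((s - n * ℓ : ℝ) : ℂ) (i : ℂ)
      linarith
    refine ⟨fun t => g i (t - n * ℓ), ?_, ?_⟩
    · refine (hgd i).comp (by fun_prop) ?_
      intro t ht
      refine hsub _ ?_
      rw [Metric.mem_ball, dist_eq_norm] at ht ⊢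
      push_cast
      convert ht using 2
      ring
    · intro x hx
      have h1 := hgf i (x - n * ℓ) (hreal _ (by
        rw [sub_sub_sub_cancel_right]; linarith))
      push_cast at h1
      refine h1.trans ?_
      exact hp.sub_int_mul_eq n
  choose h hhd hhf using hloc
  refine ⟨δ / 2, by positivity, fun t => h t.re t, differentiableOn_patch_realStrip h hhd hhf, ?_⟩
  intro s
  simpa using hhf s s (by simpa using hδ)

/-- The disc involution exchanging `0` and `z`. -/
def discInvolution (z w : ℂ) : ℂ := (z - w) / (1 - (starRingEnd ℂ) z * w)

theorem one_sub_conj_mul_ne_zero {z w : ℂ} (hz : ‖z‖ < 1) (hw : ‖w‖ < 1) :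
    1 - (starRingEnd ℂ) z * w ≠ 0 := by
  intro h
  have h1 : (starRingEnd ℂ) z * w = 1 := (sub_eq_zero.mp h).symm
  have h2 : ‖z‖ * ‖w‖ = 1 := by
    rw [← Complex.norm_conj z, ← norm_mul, h1, norm_one]
  nlinarith [norm_nonneg z, norm_nonneg w]

theorem norm_discInvolution_lt_one {z w : ℂ} (hz : ‖z‖ < 1) (hw : ‖w‖ < 1) :
    ‖discInvolution z w‖ < 1 := by
  have h0 := one_sub_conj_mul_ne_zero hz hw
  rw [discInvolution, norm_div, div_lt_one (norm_pos_iff.mpr h0)]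
  have key : ‖1 - (starRingEnd ℂ) z * w‖ ^ 2 - ‖z - w‖ ^ 2 = (1 - ‖z‖ ^ 2) * (1 - ‖w‖ ^ 2) := by
    simp only [← Complex.normSq_eq_norm_sq, Complex.normSq_apply]
    simp
    ring
  have h1 : 0 < (1 - ‖z‖ ^ 2) * (1 - ‖w‖ ^ 2) := by
    apply mul_pos <;> nlinarith [norm_nonneg z, norm_nonneg w]
  exact lt_of_pow_lt_pow_left₀ 2 (norm_nonneg _) (by linarith)

theorem discInvolution_involutive {z w : ℂ} (hz : ‖z‖ < 1) (hw : ‖w‖ < 1) :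
    discInvolution z (discInvolution z w) = w := by
  have h0 := one_sub_conj_mul_ne_zero hz hw
  have h1 := one_sub_conj_mul_ne_zero hz (norm_discInvolution_lt_one hz hw)
  have h2 : 1 - w * (starRingEnd ℂ) z ≠ 0 := by rwa [mul_comm]
  rw [discInvolution, div_eq_iff h1]
  unfold discInvolution
  generalize (starRingEnd ℂ) z = c at *
  have h3 : 1 - c * w ≠ 0 := h0
  field_simp
  ring

theorem differentiableOn_discInvolution {z : ℂ} (hz : ‖z‖ < 1) :
    DifferentiableOn ℂ (discInvolution z) (Metric.ball 0 1) := by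
  intro w hw
  have h0 := one_sub_conj_mul_ne_zero hz (mem_ball_zero_iff.mp hw)
  have : DifferentiableAt ℂ (discInvolution z) w := by
    unfold discInvolution
    fun_prop (disch := exact h0)
  exact this.differentiableWithinAt

theorem norm_apply_zero_le_of_zeros_ball {ρ M : ℝ} (hρ : ρ < 1) (Z : Finset ℂ) :
    ∀ f : ℂ → ℂ, DifferentiableOn ℂ f (Metric.ball 0 1) →
      (∀ w ∈ Metric.ball (0 : ℂ) 1, ‖f w‖ ≤ M) → (∀ z ∈ Z, ‖z‖ ≤ ρ ∧ f z = 0) →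
      ‖f 0‖ ≤ M * ρ ^ Z.card := by
  induction Z using Finset.induction_on with
  | empty => intro f _ hM _; simpa using hM 0 (by simp)
  | insert z Z hzZ ih =>
    intro f hf hM hZ
    obtain ⟨hzρ, hfz⟩ := hZ z (Finset.mem_insert_self _ _)
    have hz : ‖z‖ < 1 := lt_of_le_of_lt hzρ hρ
    have hmaps : Set.MapsTo (discInvolution z) (Metric.ball 0 1) (Metric.ball 0 1) :=
      fun w hw => mem_ball_zero_iff.mpr (norm_discInvolution_lt_one hz (mem_ball_zero_iff.mp hw))
    set f₁ : ℂ → ℂ := fun w => f (discInvolution z w) with hf₁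
    have hd₁ : DifferentiableOn ℂ f₁ (Metric.ball 0 1) :=
      hf.comp (differentiableOn_discInvolution hz) hmaps
    have hf₁0 : f₁ 0 = 0 := by simp [hf₁, discInvolution, hfz]
    have hmaps₁ : Set.MapsTo f₁ (Metric.ball 0 1) (Metric.closedBall (f₁ 0) M) := by
      intro w hw
      rw [hf₁0, mem_closedBall_zero_iff]
      exact hM _ (hmaps hw)
    have hbd : ∀ w ∈ Metric.ball (0 : ℂ) 1, ‖dslope f₁ 0 w‖ ≤ M := fun w hw => by
      simpa using Complex.norm_dslope_le_div_of_mapsTo_ball hd₁ hmaps₁ hw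
    have hds : DifferentiableOn ℂ (dslope f₁ 0) (Metric.ball 0 1) :=
      (Complex.differentiableOn_dslope (Metric.ball_mem_nhds _ one_pos)).mpr hd₁
    have hfac : ∀ w ∈ Metric.ball (0 : ℂ) 1,
        f w = discInvolution z w * dslope f₁ 0 (discInvolution z w) := by
      intro w hw
      have h := sub_smul_dslope f₁ 0 (discInvolution z w)
      rw [sub_zero, hf₁0, sub_zero, smul_eq_mul] at h
      rw [h, hf₁]
      simp only
      rw [discInvolution_involutive hz (mem_ball_zero_iff.mp hw)]
    have hg := ih (fun w => dslope f₁ 0 (discInvolution z w))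
      (hds.comp (differentiableOn_discInvolution hz) hmaps) (fun w hw => hbd _ (hmaps hw)) (by
        intro z' hz'
        obtain ⟨h1, h2⟩ := hZ z' (Finset.mem_insert_of_mem hz')
        refine ⟨h1, ?_⟩
        have hz'1 : z' ∈ Metric.ball (0 : ℂ) 1 :=
          mem_ball_zero_iff.mpr (lt_of_le_of_lt h1 hρ)
        have h3 := hfac z' hz'1
        rw [h2, eq_comm, mul_eq_zero] at h3
        refine h3.resolve_left fun h4 => ?_
        have h5 := (div_eq_zero_iff.mp h4).resolve_right
          (one_sub_conj_mul_ne_zero hz (mem_ball_zero_iff.mp hz'1))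
        exact hzZ (sub_eq_zero.mp h5 ▸ hz'))
    rw [hfac 0 (by simp), norm_mul, Finset.card_insert_of_notMem hzZ, pow_succ]
    have h6 : discInvolution z 0 = z := by simp [discInvolution]
    rw [h6] at hg ⊢
    calc ‖z‖ * ‖dslope f₁ 0 z‖ ≤ ρ * (M * ρ ^ Z.card) := by
          apply mul_le_mul hzρ hg (norm_nonneg _) ((norm_nonneg _).trans hzρ)
      _ = M * (ρ ^ Z.card * ρ) := by ring

/-- The conformal map of the strip `|Im z| < ε` onto the unit disc with `0 ↦ 0`. -/
def stripToDisc (ε : ℝ) (z : ℂ) : ℂ :=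
  (Complex.exp ((π / (2 * ε) : ℝ) * z) - 1) / (Complex.exp ((π / (2 * ε) : ℝ) * z) + 1)

/-- The inverse conformal map from the unit disc to the strip `|Im z| < ε`. -/
def discToStrip (ε : ℝ) (w : ℂ) : ℂ := (2 * ε / π : ℝ) * Complex.log ((1 + w) / (1 - w))

theorem re_mobius_pos {w : ℂ} (hw : ‖w‖ < 1) : 0 < ((1 + w) / (1 - w)).re := by
  have h1 : (1 - w) ≠ 0 := by
    intro h
    rw [← sub_eq_zero.mp h] at hw
    simp at hw
  have h2 : 0 < Complex.normSq (1 - w) := Complex.normSq_pos.mpr h1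
  have h3 : ‖w‖ ^ 2 < 1 := by nlinarith [norm_nonneg w]
  rw [← Complex.normSq_eq_norm_sq, Complex.normSq_apply] at h3
  rw [Complex.div_re, ← add_div]
  apply div_pos _ h2
  simp
  nlinarith

theorem abs_im_discToStrip_lt {ε : ℝ} (hε : 0 < ε) {w : ℂ} (hw : ‖w‖ < 1) :
    |(discToStrip ε w).im| < ε := by
  have h := Complex.abs_arg_lt_pi_div_two_iff.mpr (Or.inl (re_mobius_pos hw))
  rw [discToStrip, Complex.im_ofReal_mul, Complex.log_im,
    abs_mul, abs_of_pos (by positivity)]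
  calc 2 * ε / π * |Complex.arg ((1 + w) / (1 - w))| < 2 * ε / π * (π / 2) := by gcongr
    _ = ε := by field_simp

theorem differentiableOn_discToStrip (ε : ℝ) :
    DifferentiableOn ℂ (discToStrip ε) (Metric.ball 0 1) := by
  intro w hw
  have hw' := mem_ball_zero_iff.mp hw
  have h1 : (1 - w) ≠ 0 := by
    intro h
    rw [← sub_eq_zero.mp h] at hw'
    simp at hw'
  have h2 : (1 + w) / (1 - w) ∈ Complex.slitPlane := Or.inl (re_mobius_pos hw')
  have : DifferentiableAt ℂ (discToStrip ε) w := by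
    unfold discToStrip
    fun_prop (disch := assumption)
  exact this.differentiableWithinAt

theorem re_exp_pos_of_abs_im_lt {ε : ℝ} (hε : 0 < ε) {z : ℂ} (hz : |z.im| < ε) :
    0 < (Complex.exp ((π / (2 * ε) : ℝ) * z)).re := by
  rw [Complex.exp_re]
  apply mul_pos (Real.exp_pos _)
  rw [Complex.im_ofReal_mul]
  have h := abs_lt.mp hz
  apply Real.cos_pos_of_mem_Ioo
  have h2 : π / (2 * ε) * ε = π / 2 := by field_simp
  have h3 : 0 < π / (2 * ε) := by positivity
  constructor <;> nlinarith

theorem norm_stripToDisc_lt_one {ε : ℝ} (hε : 0 < ε) {z : ℂ} (hz : |z.im| < ε) :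
    ‖stripToDisc ε z‖ < 1 := by
  have h := re_exp_pos_of_abs_im_lt hε hz
  rw [stripToDisc]
  set E := Complex.exp ((π / (2 * ε) : ℝ) * z)
  have h0 : E + 1 ≠ 0 := by
    intro h0
    have := congrArg Complex.re h0
    simp at this
    linarith
  rw [norm_div, div_lt_one (norm_pos_iff.mpr h0)]
  apply lt_of_pow_lt_pow_left₀ 2 (norm_nonneg _)
  simp only [← Complex.normSq_eq_norm_sq, Complex.normSq_apply]
  simp
  nlinarith

theorem discToStrip_stripToDisc {ε : ℝ} (hε : 0 < ε) {z : ℂ} (hz : |z.im| < ε) :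
    discToStrip ε (stripToDisc ε z) = z := by
  have h := re_exp_pos_of_abs_im_lt hε hz
  have h0 : Complex.exp ((π / (2 * ε) : ℝ) * z) + 1 ≠ 0 := by
    intro h0
    have := congrArg Complex.re h0
    simp at this
    rw [Complex.exp_re] at h
    simp [Complex.exp_re] at this h
    linarith
  have h1 : (1 + stripToDisc ε z) / (1 - stripToDisc ε z) =
      Complex.exp ((π / (2 * ε) : ℝ) * z) := by
    rw [stripToDisc]
    set E := Complex.exp ((π / (2 * ε) : ℝ) * z)
    have h3 : 1 - (E - 1) / (E + 1) = 2 / (E + 1) := by field_simp; ring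
    have h4 : 1 + (E - 1) / (E + 1) = 2 * E / (E + 1) := by field_simp; ring
    rw [h3, h4]
    field_simp
  have hb := abs_lt.mp hz
  have h2 : π / (2 * ε) * ε = π / 2 := by field_simp
  have h3 : 0 < π / (2 * ε) := by positivity
  rw [discToStrip, h1, Complex.log_exp, ← mul_assoc, ← Complex.ofReal_mul]
  · have : 2 * ε / π * (π / (2 * ε)) = 1 := by field_simp
    rw [this]; simp
  · rw [Complex.im_ofReal_mul]; nlinarith [Real.pi_pos]
  · rw [Complex.im_ofReal_mul]; nlinarith [Real.pi_pos]

theorem exists_norm_stripToDisc_le {ε : ℝ} (hε : 0 < ε) (L : ℝ) :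
    ∃ ρ : ℝ, 0 < ρ ∧ ρ < 1 ∧ ∀ z : ℂ, |z.re| ≤ L → |z.im| ≤ ε / 2 → ‖stripToDisc ε z‖ ≤ ρ := by
  have hK : IsCompact (Set.Icc (-L) L ×ℂ Set.Icc (-(ε / 2)) (ε / 2)) :=
    isCompact_Icc.reProdIm isCompact_Icc
  have hc : ContinuousOn (fun z => ‖stripToDisc ε z‖)
      (Set.Icc (-L) L ×ℂ Set.Icc (-(ε / 2)) (ε / 2)) := by
    intro z hz
    have hz2 : |z.im| < ε := by
      have := (Complex.mem_reProdIm.mp hz).2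
      rw [abs_lt]; constructor <;> linarith [this.1, this.2]
    have h := re_exp_pos_of_abs_im_lt hε hz2
    have h0 : Complex.exp ((π / (2 * ε) : ℝ) * z) + 1 ≠ 0 := by
      intro h0
      have := congrArg Complex.re h0
      rw [Complex.add_re] at this
      simp only [Complex.one_re, Complex.zero_re] at this
      linarith
    have : ContinuousAt (fun z => ‖stripToDisc ε z‖) z := by
      unfold stripToDisc
      fun_prop (disch := exact h0)
    exact this.continuousWithinAt
  rcases Set.eq_empty_or_nonempty (Set.Icc (-L) L ×ℂ Set.Icc (-(ε / 2)) (ε / 2)) with he | hne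
  · refine ⟨1 / 2, by norm_num, by norm_num, fun z h1 h2 => ?_⟩
    have : z ∈ (Set.Icc (-L) L ×ℂ Set.Icc (-(ε / 2)) (ε / 2)) :=
      Complex.mem_reProdIm.mpr ⟨abs_le.mp h1, abs_le.mp h2⟩
    rw [he] at this; exact this.elim
  · obtain ⟨z₀, hz₀, hmax⟩ := hK.exists_isMaxOn hne hc
    have hz2 : |z₀.im| < ε := by
      have := (Complex.mem_reProdIm.mp hz₀).2
      rw [abs_lt]; constructor <;> linarith [this.1, this.2]
    refine ⟨max (1 / 2) ‖stripToDisc ε z₀‖, by positivity, max_lt (by norm_num)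
      (norm_stripToDisc_lt_one hε hz2), fun z h1 h2 => le_max_of_le_right ?_⟩
    exact hmax (Complex.mem_reProdIm.mpr ⟨abs_le.mp h1, abs_le.mp h2⟩)

theorem exists_zero_count_strip {ε : ℝ} (hε : 0 < ε) (L : ℝ) :
    ∃ ρ : ℝ, 0 < ρ ∧ ρ < 1 ∧ ∀ (f : ℂ → ℂ) (M s₀ : ℝ) (Z : Finset ℂ),
      DifferentiableOn ℂ f (realStrip ε) → (∀ z ∈ realStrip ε, ‖f z‖ ≤ M) →
      (∀ z ∈ Z, |z.re - s₀| ≤ L ∧ |z.im| ≤ ε / 2 ∧ f z = 0) →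
      ‖f s₀‖ ≤ M * ρ ^ Z.card := by
  obtain ⟨ρ, hρ0, hρ1, hρ⟩ := exists_norm_stripToDisc_le hε L
  refine ⟨ρ, hρ0, hρ1, fun f M s₀ Z hf hM hZ => ?_⟩
  have hlt : ∀ z : ℂ, |z.im| ≤ ε / 2 → |(z - s₀).im| < ε := by
    intro z hz
    simp only [Complex.sub_im, Complex.ofReal_im, sub_zero]
    linarith
  have hmaps : Set.MapsTo (fun w => (s₀ : ℂ) + discToStrip ε w) (Metric.ball 0 1)
      (realStrip ε) := by
    intro w hw
    have := abs_im_discToStrip_lt hε (mem_ball_zero_iff.mp hw)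
    simpa [realStrip] using this
  have hinj : Set.InjOn (fun z : ℂ => stripToDisc ε (z - s₀)) (Z : Set ℂ) := by
    intro z hz z' hz' h
    have h1 := discToStrip_stripToDisc hε (hlt z (hZ z hz).2.1)
    have h2 := discToStrip_stripToDisc hε (hlt z' (hZ z' hz').2.1)
    simp only at h
    rw [h, h2] at h1
    simpa using h1.symm
  have := norm_apply_zero_le_of_zeros_ball (M := M) hρ1
    (Z.image fun z : ℂ => stripToDisc ε (z - s₀))
    (fun w => f (s₀ + discToStrip ε w))
    (hf.comp ((differentiableOn_discToStrip ε).const_add _) hmaps) (fun w hw => hM _ (hmaps hw))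
    (by
      intro w hw
      obtain ⟨z, hz, rfl⟩ := Finset.mem_image.mp hw
      obtain ⟨h1, h2, h3⟩ := hZ z hz
      refine ⟨hρ _ (by simpa using h1) (by simpa using h2), ?_⟩
      rw [discToStrip_stripToDisc hε (hlt z h2)]
      simpa using h3)
  rw [Finset.card_image_of_injOn hinj] at this
  simpa [discToStrip] using this

theorem finite_and_ncard_le_of_forall_finset {α : Type*} {s : Set α} {n : ℝ}
    (h : ∀ Z : Finset α, (Z : Set α) ⊆ s → (Z.card : ℝ) ≤ n) : s.Finite ∧ (s.ncard : ℝ) ≤ n := by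
  have hfin : s.Finite := by
    by_contra hinf
    obtain ⟨Z, hZ, hc⟩ := Set.Infinite.exists_subset_card_eq hinf (⌊n⌋₊ + 1)
    have h1 := h Z hZ
    rw [hc] at h1
    have := Nat.lt_floor_add_one n
    push_cast at h1
    linarith
  refine ⟨hfin, ?_⟩
  have := h hfin.toFinset (by simp)
  rwa [Set.ncard_eq_toFinset_card s hfin]

/-- Derivative of a function on `ℝ × ℝ` in the first coordinate direction. -/
def derivFst (f : ℝ × ℝ → ℝ) (p : ℝ × ℝ) : ℝ := fderiv ℝ f p (1, 0)

/-- Derivative of a function on `ℝ × ℝ` in the second coordinate direction. -/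
def derivSnd (f : ℝ × ℝ → ℝ) (p : ℝ × ℝ) : ℝ := fderiv ℝ f p (0, 1)

theorem AnalyticOnNhd.fderiv_apply_const {E : Type*} [NormedAddCommGroup E] [NormedSpace ℝ E]
    {f : E → ℝ} {O : Set E} (hf : AnalyticOnNhd ℝ f O) (v : E) :
    AnalyticOnNhd ℝ (fun p => fderiv ℝ f p v) O := fun p hp =>
  ((ContinuousLinearMap.apply ℝ ℝ v).analyticAt _).comp (hf.fderiv p hp)

theorem AnalyticOnNhd.derivFst {f : ℝ × ℝ → ℝ} {O : Set (ℝ × ℝ)} (hf : AnalyticOnNhd ℝ f O) :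
    AnalyticOnNhd ℝ (derivFst f) O := hf.fderiv_apply_const _

theorem AnalyticOnNhd.derivSnd {f : ℝ × ℝ → ℝ} {O : Set (ℝ × ℝ)} (hf : AnalyticOnNhd ℝ f O) :
    AnalyticOnNhd ℝ (derivSnd f) O := hf.fderiv_apply_const _

theorem AnalyticOnNhd.iterate_derivFst {f : ℝ × ℝ → ℝ} {O : Set (ℝ × ℝ)}
    (hf : AnalyticOnNhd ℝ f O) (k : ℕ) : AnalyticOnNhd ℝ (_root_.derivFst^[k] f) O := by
  induction k with
  | zero => exact hf
  | succ k ih => rw [Function.iterate_succ_apply']; exact ih.derivFst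

theorem AnalyticAt.fderiv_fderiv_comm {E : Type*} [NormedAddCommGroup E] [NormedSpace ℝ E]
    {f : E → ℝ} {p : E} (hf : AnalyticAt ℝ f p) (v w : E) :
    fderiv ℝ (fun x => fderiv ℝ f x v) p w = fderiv ℝ (fun x => fderiv ℝ f x w) p v := by
  have hs : IsSymmSndFDerivAt ℝ f p :=
    (hf.contDiffAt (n := 2)).isSymmSndFDerivAt (by simp)
  have hd : DifferentiableAt ℝ (fderiv ℝ f) p := hf.fderiv.differentiableAt
  have key : ∀ v w : E, fderiv ℝ (fun x => fderiv ℝ f x v) p w = fderiv ℝ (fderiv ℝ f) p w v := by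
    intro v w
    have := (hd.hasFDerivAt.clm_apply (hasFDerivAt_const v p)).fderiv
    rw [this]; simp
  rw [key, key, hs.eq]

theorem derivFst_congr {f g : ℝ × ℝ → ℝ} {O : Set (ℝ × ℝ)} (hO : IsOpen O)
    (h : Set.EqOn f g O) : Set.EqOn (derivFst f) (derivFst g) O := fun p hp => by
  unfold derivFst
  rw [(h.eventuallyEq_of_mem (hO.mem_nhds hp)).fderiv_eq]

theorem derivSnd_congr {f g : ℝ × ℝ → ℝ} {O : Set (ℝ × ℝ)} (hO : IsOpen O)
    (h : Set.EqOn f g O) : Set.EqOn (derivSnd f) (derivSnd g) O := fun p hp => by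
  unfold derivSnd
  rw [(h.eventuallyEq_of_mem (hO.mem_nhds hp)).fderiv_eq]

theorem derivSnd_iterate_derivFst {f : ℝ × ℝ → ℝ} {O : Set (ℝ × ℝ)} (hO : IsOpen O)
    (hf : AnalyticOnNhd ℝ f O) (k : ℕ) :
    Set.EqOn (derivSnd (derivFst^[k] f)) (derivFst^[k] (derivSnd f)) O := by
  induction k with
  | zero => exact fun _ _ => rfl
  | succ k ih =>
    simp only [Function.iterate_succ_apply']
    exact Set.EqOn.trans
      (fun p hp => (hf.iterate_derivFst k p hp).fderiv_fderiv_comm (1, 0) (0, 1))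
      (derivFst_congr hO ih)

/-- The Laplacian on `ℝ × ℝ`. -/
def lapProd (f : ℝ × ℝ → ℝ) (p : ℝ × ℝ) : ℝ :=
  derivFst (derivFst f) p + derivSnd (derivSnd f) p

theorem lapProd_iterate_derivFst {f : ℝ × ℝ → ℝ} {O : Set (ℝ × ℝ)} (hO : IsOpen O)
    (hf : AnalyticOnNhd ℝ f O) (k : ℕ) :
    Set.EqOn (lapProd (derivFst^[k] f)) (derivFst^[k] (lapProd f)) O := by
  induction k with
  | zero => exact fun _ _ => rfl
  | succ k ih =>
    simp only [Function.iterate_succ_apply']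
    refine Set.EqOn.trans (fun p hp => ?_) (derivFst_congr hO ih)
    set g := derivFst^[k] f
    have hg : AnalyticOnNhd ℝ g O := hf.iterate_derivFst k
    have h1 : derivSnd (derivSnd (derivFst g)) p = derivFst (derivSnd (derivSnd g)) p := by
      have h3 : Set.EqOn (derivSnd (derivFst g)) (derivFst (derivSnd g)) O :=
        derivSnd_iterate_derivFst hO hg 1
      rw [derivSnd_congr hO h3 hp]
      exact derivSnd_iterate_derivFst hO hg.derivSnd 1 hp
    have h2 : derivFst (lapProd g) p =
        derivFst (derivFst (derivFst g)) p + derivFst (derivSnd (derivSnd g)) p := by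
      have := fderiv_add (hg.derivFst.derivFst p hp).differentiableAt
        (hg.derivSnd.derivSnd p hp).differentiableAt
      have h3 := congrArg (fun T : ℝ × ℝ →L[ℝ] ℝ => T (1, 0)) this
      exact h3
    rw [h2, lapProd, h1]

theorem AnalyticAt.hasDerivAt_slice_fst {f : ℝ × ℝ → ℝ} {s η : ℝ}
    (hf : AnalyticAt ℝ f (s, η)) : HasDerivAt (fun x => f (x, η)) (derivFst f (s, η)) s := by
  have h1 : HasDerivAt (fun x : ℝ => (x, η)) ((1 : ℝ), (0 : ℝ)) s :=
    (hasDerivAt_id s).prodMk (hasDerivAt_const s η)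
  exact hf.differentiableAt.hasFDerivAt.comp_hasDerivAt s h1

theorem iterate_derivFst_eq_iteratedDeriv {f : ℝ × ℝ → ℝ} {O : Set (ℝ × ℝ)}
    (hf : AnalyticOnNhd ℝ f O) {η : ℝ} (hη : ∀ s, (s, η) ∈ O) (k : ℕ) (s : ℝ) :
    derivFst^[k] f (s, η) = iteratedDeriv k (fun x => f (x, η)) s := by
  induction k generalizing s with
  | zero => simp
  | succ k ih =>
    rw [Function.iterate_succ_apply', iteratedDeriv_succ, ← funext ih]
    exact ((hf.iterate_derivFst k _ (hη s)).hasDerivAt_slice_fst.deriv).symm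

theorem AnalyticOnNhd.slice_fst {f : ℝ × ℝ → ℝ} {O : Set (ℝ × ℝ)}
    (hf : AnalyticOnNhd ℝ f O) {η : ℝ} (hη : ∀ s, (s, η) ∈ O) :
    AnalyticOnNhd ℝ (fun s => f (s, η)) Set.univ := fun s _ =>
  AnalyticAt.fun_comp (f := fun s : ℝ => (s, η)) (hf _ (hη s)) (analyticAt_id.prod analyticAt_const)

theorem iterate_derivFst_mul {f g : ℝ × ℝ → ℝ} {O : Set (ℝ × ℝ)}
    (hf : AnalyticOnNhd ℝ f O) (hg : AnalyticOnNhd ℝ g O) {η : ℝ} (hη : ∀ s, (s, η) ∈ O)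
    (k : ℕ) (s : ℝ) :
    derivFst^[k] (fun p => f p * g p) (s, η) = ∑ j ∈ Finset.range (k + 1),
      k.choose j * derivFst^[j] f (s, η) * derivFst^[k - j] g (s, η) := by
  rw [iterate_derivFst_eq_iteratedDeriv (hf.mul hg) hη, iteratedDeriv_fun_mul
    ((hf.slice_fst hη s trivial).contDiffAt) ((hg.slice_fst hη s trivial).contDiffAt)]
  exact Finset.sum_congr rfl fun j _ => by
    rw [iterate_derivFst_eq_iteratedDeriv hf hη, iterate_derivFst_eq_iteratedDeriv hg hη]

theorem iterate_derivFst_periodic {f : ℝ × ℝ → ℝ} {O : Set (ℝ × ℝ)}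
    (hf : AnalyticOnNhd ℝ f O) {η ℓ : ℝ} (hη : ∀ s, (s, η) ∈ O)
    (hp : ∀ s, f (s + ℓ, η) = f (s, η)) (k : ℕ) (s : ℝ) :
    derivFst^[k] f (s + ℓ, η) = derivFst^[k] f (s, η) := by
  simp only [iterate_derivFst_eq_iteratedDeriv hf hη]
  have h := congrFun (iteratedDeriv_comp_add_const k (fun x => f (x, η)) ℓ) s
  rw [← h]
  congr 1
  exact funext hp

theorem sq_integral_mul_le {α : Type*} [MeasurableSpace α] {μ : Measure α} {f g : α → ℝ}
    (hf : Integrable (fun x => f x ^ 2) μ) (hg : Integrable (fun x => g x ^ 2) μ)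
    (hfg : Integrable (fun x => f x * g x) μ) :
    (∫ x, f x * g x ∂μ) ^ 2 ≤ (∫ x, f x ^ 2 ∂μ) * ∫ x, g x ^ 2 ∂μ := by
  have h : ∀ t : ℝ, 0 ≤ (∫ x, g x ^ 2 ∂μ) * (t * t) + (2 * ∫ x, f x * g x ∂μ) * t +
      ∫ x, f x ^ 2 ∂μ := by
    intro t
    have h1 : 0 ≤ ∫ x, (t * t) * g x ^ 2 + (2 * t) * (f x * g x) + f x ^ 2 ∂μ := by
      apply integral_nonneg
      intro x
      have : (t * t) * g x ^ 2 + (2 * t) * (f x * g x) + f x ^ 2 = (t * g x + f x) ^ 2 := by ring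
      simp only [this]; positivity
    have hs : Integrable (fun x => (t * t) * g x ^ 2 + (2 * t) * (f x * g x)) μ :=
      (hg.const_mul _).add (hfg.const_mul _)
    rw [integral_add hs hf,
      integral_add (hg.const_mul _) (hfg.const_mul _), integral_const_mul,
      integral_const_mul] at h1
    linarith
  have := discrim_le_zero h
  rw [discrim] at this
  nlinarith

theorem abs_integral_mul_le_sqrt {α : Type*} [MeasurableSpace α] {μ : Measure α} {f g : α → ℝ}
    (hf : Integrable (fun x => f x ^ 2) μ) (hg : Integrable (fun x => g x ^ 2) μ)
    (hfg : Integrable (fun x => f x * g x) μ) :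
    |∫ x, f x * g x ∂μ| ≤ √(∫ x, f x ^ 2 ∂μ) * √(∫ x, g x ^ 2 ∂μ) := by
  rw [← Real.sqrt_mul (integral_nonneg fun x => sq_nonneg _)]
  exact Real.abs_le_sqrt (sq_integral_mul_le hf hg hfg)

/-- The collar box `[0, ℓ] × [0, h]`. -/
def collarBox (ℓ h : ℝ) : Set (ℝ × ℝ) := Set.Icc (0, 0) (ℓ, h)

theorem isCompact_collarBox (ℓ h : ℝ) : IsCompact (collarBox ℓ h) := isCompact_Icc

theorem mem_collarBox {ℓ h : ℝ} {p : ℝ × ℝ} :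
    p ∈ collarBox ℓ h ↔ (0 ≤ p.1 ∧ p.1 ≤ ℓ) ∧ 0 ≤ p.2 ∧ p.2 ≤ h := by
  simp only [collarBox, Set.mem_Icc, Prod.le_def]
  tauto

theorem measurableSet_collarBox (ℓ h : ℝ) : MeasurableSet (collarBox ℓ h) := measurableSet_Icc

/-- The weight `1 - η / h`. -/
def collarWeight (h : ℝ) (p : ℝ × ℝ) : ℝ := 1 - p.2 / h

theorem collarWeight_mem {ℓ h : ℝ} (hh : 0 < h) {p : ℝ × ℝ} (hp : p ∈ collarBox ℓ h) :
    0 ≤ collarWeight h p ∧ collarWeight h p ≤ 1 := by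
  obtain ⟨-, h1, h2⟩ := mem_collarBox.mp hp
  unfold collarWeight
  constructor
  · rw [sub_nonneg, div_le_one hh]; exact h2
  · have : 0 ≤ p.2 / h := by positivity
    linarith

theorem analyticAt_collarWeight (h : ℝ) (p : ℝ × ℝ) : AnalyticAt ℝ (collarWeight h) p := by
  unfold collarWeight
  simp only [div_eq_mul_inv]
  exact analyticAt_const.sub (analyticAt_snd.mul analyticAt_const)

theorem derivFst_mul {f g : ℝ × ℝ → ℝ} {p : ℝ × ℝ} (hf : DifferentiableAt ℝ f p)
    (hg : DifferentiableAt ℝ g p) :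
    derivFst (fun x => f x * g x) p = f p * derivFst g p + g p * derivFst f p := by
  unfold derivFst
  rw [fderiv_fun_mul hf hg]
  simp

theorem derivSnd_mul {f g : ℝ × ℝ → ℝ} {p : ℝ × ℝ} (hf : DifferentiableAt ℝ f p)
    (hg : DifferentiableAt ℝ g p) :
    derivSnd (fun x => f x * g x) p = f p * derivSnd g p + g p * derivSnd f p := by
  unfold derivSnd
  rw [fderiv_fun_mul hf hg]
  simp

theorem hasFDerivAt_collarWeight (h : ℝ) (p : ℝ × ℝ) :
    HasFDerivAt (collarWeight h) (-(h⁻¹ • ContinuousLinearMap.snd ℝ ℝ ℝ)) p := by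
  have h1 : HasFDerivAt (fun p : ℝ × ℝ => h⁻¹ * p.2) (h⁻¹ • ContinuousLinearMap.snd ℝ ℝ ℝ) p :=
    (ContinuousLinearMap.snd ℝ ℝ ℝ).hasFDerivAt.const_mul h⁻¹
  have h2 := h1.const_sub 1
  refine h2.congr_of_eventuallyEq (Filter.Eventually.of_forall fun x => ?_)
  simp [collarWeight, div_eq_inv_mul]

theorem derivFst_collarWeight_pow (h : ℝ) (m : ℕ) (p : ℝ × ℝ) :
    derivFst (fun x => collarWeight h x ^ m) p = 0 := by
  unfold derivFst
  rw [((hasFDerivAt_collarWeight h p).pow m).fderiv]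
  simp

theorem derivSnd_collarWeight_pow (h : ℝ) (m : ℕ) (p : ℝ × ℝ) :
    derivSnd (fun x => collarWeight h x ^ (m + 1)) p =
      -((m + 1) / h * collarWeight h p ^ m) := by
  unfold derivSnd
  rw [((hasFDerivAt_collarWeight h p).pow (m + 1)).fderiv]
  simp
  ring

/-- An analytic periodic function on a neighbourhood of the collar whose normal derivative
vanishes on the boundary line `η = 0`. -/
structure IsCollarFunction (O : Set (ℝ × ℝ)) (ℓ h : ℝ) (V : ℝ × ℝ → ℝ) : Prop where
  isOpen : IsOpen O
  len_pos : 0 < ℓ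
  height_pos : 0 < h
  mem : ∀ s, ∀ η ∈ Set.Icc 0 h, (s, η) ∈ O
  analytic : AnalyticOnNhd ℝ V O
  periodic : ∀ s, ∀ η ∈ Set.Icc 0 h, V (s + ℓ, η) = V (s, η)
  neumann : ∀ s, derivSnd V (s, 0) = 0

namespace IsCollarFunction

variable {O : Set (ℝ × ℝ)} {ℓ h : ℝ} {V : ℝ × ℝ → ℝ}

theorem box_subset (hV : IsCollarFunction O ℓ h V) : collarBox ℓ h ⊆ O := fun p hp =>
  hV.mem p.1 p.2 (mem_collarBox.mp hp).2

theorem iterate_derivFst (hV : IsCollarFunction O ℓ h V) (k : ℕ) :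
    IsCollarFunction O ℓ h (derivFst^[k] V) where
  isOpen := hV.isOpen
  len_pos := hV.len_pos
  height_pos := hV.height_pos
  mem := hV.mem
  analytic := hV.analytic.iterate_derivFst k
  periodic := fun s η hη =>
    iterate_derivFst_periodic hV.analytic (fun s => hV.mem s η hη)
      (fun s => hV.periodic s η hη) k s
  neumann := fun s => by
    have h0 : ∀ s, (s, (0 : ℝ)) ∈ O := fun s => hV.mem s 0 ⟨le_rfl, hV.height_pos.le⟩
    rw [derivSnd_iterate_derivFst hV.isOpen hV.analytic k (h0 s),
      iterate_derivFst_eq_iteratedDeriv hV.analytic.derivSnd h0]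
    have : (fun x => derivSnd V (x, 0)) = fun _ => 0 := funext hV.neumann
    rw [this]
    simp [iteratedDeriv_fun_const_zero]

end IsCollarFunction

theorem ContDiffAt.continuousAt_fderiv_apply {E : Type*} [NormedAddCommGroup E] [NormedSpace ℝ E]
    {f : E → ℝ} {p : E} (hf : ContDiffAt ℝ 1 f p) (v : E) :
    ContinuousAt (fun x => fderiv ℝ f x v) p :=
  (hf.fderiv_right (m := 0) (by simp)).continuousAt.clm_apply continuousAt_const

theorem integral_box_divergence_of_contDiffAt {O : Set (ℝ × ℝ)} {ℓ h : ℝ} (hℓ : 0 < ℓ)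
    (hh : 0 < h) {f g : ℝ × ℝ → ℝ} (hO : collarBox ℓ h ⊆ O) (hf : ∀ p ∈ O, ContDiffAt ℝ 1 f p)
    (hg : ∀ p ∈ O, ContDiffAt ℝ 1 g p) (hp : ∀ η ∈ Set.Icc 0 h, f (ℓ, η) = f (0, η)) :
    ∫ p in collarBox ℓ h, derivFst f p + derivSnd g p =
      (∫ s in (0 : ℝ)..ℓ, g (s, h)) - ∫ s in (0 : ℝ)..ℓ, g (s, 0) := by
  have hbox : ∀ x ∈ Set.Ioo (0 : ℝ) ℓ ×ˢ Set.Ioo (0 : ℝ) h, x ∈ O := fun x hx =>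
    hO (mem_collarBox.mpr ⟨⟨hx.1.1.le, hx.1.2.le⟩, hx.2.1.le, hx.2.2.le⟩)
  have key := integral_divergence_prod_Icc_of_hasFDerivAt_of_le f g (fderiv ℝ f) (fderiv ℝ g)
    (0, 0) (ℓ, h) (Prod.mk_le_mk.mpr ⟨hℓ.le, hh.le⟩)
    (fun p hp => (hf p (hO hp)).continuousAt.continuousWithinAt)
    (fun p hp => (hg p (hO hp)).continuousAt.continuousWithinAt)
    (fun x hx => ((hf x (hbox x hx)).differentiableAt (by simp)).hasFDerivAt)
    (fun x hx => ((hg x (hbox x hx)).differentiableAt (by simp)).hasFDerivAt)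
    (ContinuousOn.integrableOn_compact (isCompact_collarBox ℓ h) fun p hp =>
      (((hf p (hO hp)).continuousAt_fderiv_apply _).add
        ((hg p (hO hp)).continuousAt_fderiv_apply _)).continuousWithinAt)
  have h2 : ∫ y in (0 : ℝ)..h, f (ℓ, y) = ∫ y in (0 : ℝ)..h, f (0, y) := by
    apply intervalIntegral.integral_congr
    intro y hy
    rw [Set.uIcc_of_le hh.le] at hy
    exact hp y hy
  rw [collarBox]
  simp only [h2] at key
  unfold derivFst derivSnd
  rw [key]
  ring

theorem integral_box_divergence {O : Set (ℝ × ℝ)} {ℓ h : ℝ} (hℓ : 0 < ℓ) (hh : 0 < h)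
    {f g : ℝ × ℝ → ℝ} (hO : collarBox ℓ h ⊆ O) (hf : AnalyticOnNhd ℝ f O)
    (hg : AnalyticOnNhd ℝ g O) (hp : ∀ η ∈ Set.Icc 0 h, f (ℓ, η) = f (0, η)) :
    ∫ p in collarBox ℓ h, derivFst f p + derivSnd g p =
      (∫ s in (0 : ℝ)..ℓ, g (s, h)) - ∫ s in (0 : ℝ)..ℓ, g (s, 0) :=
  integral_box_divergence_of_contDiffAt hℓ hh hO (fun p hp => (hf p hp).contDiffAt)
    (fun p hp => (hg p hp).contDiffAt) hp

namespace IsCollarFunction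

variable {O : Set (ℝ × ℝ)} {ℓ h : ℝ} {V : ℝ × ℝ → ℝ}

theorem energy_identity (hV : IsCollarFunction O ℓ h V) (m : ℕ) :
    ∫ p in collarBox ℓ h, collarWeight h p ^ (m + 1) * (derivFst V p ^ 2 + derivSnd V p ^ 2) =
      -(∫ p in collarBox ℓ h, collarWeight h p ^ (m + 1) * (V p * lapProd V p)) +
      (m + 1) / h * ∫ p in collarBox ℓ h, collarWeight h p ^ m * (V p * derivSnd V p) := by
  have hW : ∀ m : ℕ, AnalyticOnNhd ℝ (fun p => collarWeight h p ^ m) O :=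
    fun m p _ => (analyticAt_collarWeight h p).pow m
  have hVa := hV.analytic
  have hsub := hV.box_subset
  have hf : AnalyticOnNhd ℝ (fun p => collarWeight h p ^ (m + 1) * (V p * derivFst V p)) O :=
    (hW _).mul (hVa.mul hVa.derivFst)
  have hg : AnalyticOnNhd ℝ (fun p => collarWeight h p ^ (m + 1) * (V p * derivSnd V p)) O :=
    (hW _).mul (hVa.mul hVa.derivSnd)
  have key := integral_box_divergence hV.len_pos hV.height_pos hsub hf hg (by
    intro η hη
    have h1 := hV.periodic 0 η hη
    have h2 := (hV.iterate_derivFst 1).periodic 0 η hη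
    simp only [Function.iterate_one, zero_add] at h1 h2
    simp only [collarWeight, h1, h2])
  have hb1 : ∀ s : ℝ, collarWeight h (s, h) = 0 := fun s => by
    simp [collarWeight, hV.height_pos.ne']
  simp only [hb1, hV.neumann, ne_eq, Nat.add_eq_zero_iff, one_ne_zero, and_false,
    not_false_eq_true, zero_pow, zero_mul, mul_zero, intervalIntegral.integral_zero,
    sub_zero] at key
  have hi : ∀ {F : ℝ × ℝ → ℝ}, AnalyticOnNhd ℝ F O → IntegrableOn F (collarBox ℓ h) :=
    fun hF => (hF.continuousOn.mono hsub).integrableOn_compact (isCompact_collarBox ℓ h)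
  have hlap : AnalyticOnNhd ℝ (lapProd V) O := hVa.derivFst.derivFst.add hVa.derivSnd.derivSnd
  have i1 : IntegrableOn (fun p => collarWeight h p ^ (m + 1) *
      (derivFst V p ^ 2 + derivSnd V p ^ 2)) (collarBox ℓ h) :=
    hi ((hW (m + 1)).mul ((hVa.derivFst.pow 2).add (hVa.derivSnd.pow 2)))
  have i2 := hi ((hW (m + 1)).mul (hVa.mul hlap))
  have i12 : IntegrableOn (fun p => collarWeight h p ^ (m + 1) *
      (derivFst V p ^ 2 + derivSnd V p ^ 2) + collarWeight h p ^ (m + 1) * (V p * lapProd V p))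
      (collarBox ℓ h) := i1.add i2
  have i3 := (hi ((hW m).mul (hVa.mul hVa.derivSnd))).const_mul ((m + 1) / h)
  have e : ∫ p in collarBox ℓ h,
      derivFst (fun p => collarWeight h p ^ (m + 1) * (V p * derivFst V p)) p +
      derivSnd (fun p => collarWeight h p ^ (m + 1) * (V p * derivSnd V p)) p =
      ∫ p in collarBox ℓ h, (collarWeight h p ^ (m + 1) * (derivFst V p ^ 2 + derivSnd V p ^ 2) +
        collarWeight h p ^ (m + 1) * (V p * lapProd V p)) -
        (m + 1) / h * (collarWeight h p ^ m * (V p * derivSnd V p)) := by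
    apply setIntegral_congr_fun (measurableSet_collarBox ℓ h)
    intro p hp
    have hpO := hsub hp
    have d1 := (hW (m + 1) p hpO).differentiableAt
    have d2 := (hVa p hpO).differentiableAt
    have d3 := (hVa.derivFst p hpO).differentiableAt
    have d4 := (hVa.derivSnd p hpO).differentiableAt
    simp only
    rw [derivFst_mul d1 (d2.fun_mul d3), derivFst_mul d2 d3, derivSnd_mul d1 (d2.fun_mul d4),
      derivSnd_mul d2 d4, derivFst_collarWeight_pow, derivSnd_collarWeight_pow, lapProd]
    ring
  rw [e, integral_sub i12 i3, integral_add i1 i2, integral_const_mul] at key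
  linarith

theorem trace_identity (hV : IsCollarFunction O ℓ h V) (m : ℕ) :
    ∫ s in (0 : ℝ)..ℓ, V (s, 0) ^ 2 =
      (m + 1) / h * (∫ p in collarBox ℓ h, collarWeight h p ^ m * V p ^ 2) -
      2 * ∫ p in collarBox ℓ h, collarWeight h p ^ (m + 1) * (V p * derivSnd V p) := by
  have hW : ∀ m : ℕ, AnalyticOnNhd ℝ (fun p => collarWeight h p ^ m) O :=
    fun m p _ => (analyticAt_collarWeight h p).pow m
  have hVa := hV.analytic
  have hsub := hV.box_subset
  have hg : AnalyticOnNhd ℝ (fun p => collarWeight h p ^ (m + 1) * (V p * V p)) O :=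
    (hW _).mul (hVa.mul hVa)
  have key := integral_box_divergence hV.len_pos hV.height_pos hsub
    (f := fun _ => 0) analyticOnNhd_const hg (fun _ _ => rfl)
  have hb1 : ∀ s : ℝ, collarWeight h (s, h) = 0 := fun s => by
    simp [collarWeight, hV.height_pos.ne']
  have hb2 : ∀ s : ℝ, collarWeight h (s, 0) = 1 := fun s => by simp [collarWeight]
  simp only [hb1, hb2, ne_eq, Nat.add_eq_zero_iff, one_ne_zero, and_false, one_pow, one_mul,
    not_false_eq_true, zero_pow, zero_mul, intervalIntegral.integral_zero,
    zero_sub, ← pow_two] at key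
  have hi : ∀ {F : ℝ × ℝ → ℝ}, AnalyticOnNhd ℝ F O → IntegrableOn F (collarBox ℓ h) :=
    fun hF => (hF.continuousOn.mono hsub).integrableOn_compact (isCompact_collarBox ℓ h)
  have i2 := (hi ((hW (m + 1)).mul (hVa.mul hVa.derivSnd))).const_mul 2
  have i4 : IntegrableOn (fun p => collarWeight h p ^ m * V p ^ 2) (collarBox ℓ h) :=
    hi ((hW m).mul (hVa.pow 2))
  have i3 := i4.const_mul ((m + 1) / h)
  have e : ∫ p in collarBox ℓ h, derivFst (fun _ => (0 : ℝ)) p +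
      derivSnd (fun p => collarWeight h p ^ (m + 1) * V p ^ 2) p =
      ∫ p in collarBox ℓ h, 2 * (collarWeight h p ^ (m + 1) * (V p * derivSnd V p)) -
        (m + 1) / h * (collarWeight h p ^ m * V p ^ 2) := by
    apply setIntegral_congr_fun (measurableSet_collarBox ℓ h)
    intro p hp
    have hpO := hsub hp
    have d1 := (hW (m + 1) p hpO).differentiableAt
    have d2 := (hVa p hpO).differentiableAt
    simp only [pow_two (V _)]
    rw [derivSnd_mul d1 (d2.fun_mul d2), derivSnd_mul d2 d2, derivSnd_collarWeight_pow]
    simp only [derivFst, fderiv_fun_const, Pi.zero_apply, zero_apply]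
    ring
  rw [e, integral_sub i2 i3, integral_const_mul, integral_const_mul] at key
  linarith

end IsCollarFunction

theorem le_add_of_sq_le_mul_add_sq {E b c : ℝ} (hb : 0 ≤ b) (hc : 0 ≤ c)
    (h : E ^ 2 ≤ b * E + c ^ 2) : E ≤ b + c := by
  by_contra hlt
  push Not at hlt
  nlinarith [mul_nonneg hb hc]

/-- Growth bound for sequences satisfying the recursive energy inequality. -/
theorem energy_recursion_bound {N E : ℕ → ℝ} {α K lam A : ℝ} (hN : ∀ k, 0 ≤ N k)
    (hE : ∀ k, 0 ≤ E k) (hα : 0 ≤ α) (hK : 0 ≤ K) (hlam : 0 ≤ lam) (hA : α + 2 * K + 1 ≤ A)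
    (hNE : ∀ k, N (k + 1) ≤ E k)
    (hrec : ∀ k, E k ^ 2 ≤ α * (k + 1) * N k * E k + lam ^ 2 * N k *
      ∑ j ∈ Finset.range (k + 1), (k.choose j : ℝ) * (K ^ (j + 1) * j.factorial) * N (k - j))
    (k : ℕ) :
    N k ≤ N 0 * A ^ k * (k + lam) ^ k ∧ E k ≤ N 0 * A ^ (k + 1) * (k + 1 + lam) ^ (k + 1) := by
  have hA0 : 0 < A := by linarith
  have hN0 := hN 0
  have step : ∀ k, (∀ i ≤ k, N i ≤ N 0 * A ^ i * (i + lam) ^ i) →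
      E k ≤ N 0 * A ^ (k + 1) * (k + 1 + lam) ^ (k + 1) := by
    intro k ih
    have hkl : (0 : ℝ) ≤ k + lam := by positivity
    set b := N 0 * A ^ k * (k + lam) ^ k with hb
    have hb0 : 0 ≤ b := by positivity
    have hsum : ∑ j ∈ Finset.range (k + 1), (k.choose j : ℝ) * (K ^ (j + 1) * j.factorial) *
        N (k - j) ≤ 2 * K * b := by
      calc ∑ j ∈ Finset.range (k + 1), (k.choose j : ℝ) * (K ^ (j + 1) * j.factorial) * N (k - j)
          ≤ ∑ j ∈ Finset.range (k + 1), K * b * (1 / 2) ^ j := by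
            apply Finset.sum_le_sum
            intro j hj
            have hjk : j ≤ k := Nat.lt_succ_iff.mp (Finset.mem_range.mp hj)
            have h1 : (k.choose j : ℝ) * j.factorial ≤ (k + lam) ^ j := by
              have h2 : (k.choose j : ℝ) * j.factorial ≤ (k : ℝ) ^ j := by
                have := Nat.descFactorial_le_pow k j
                rw [Nat.descFactorial_eq_factorial_mul_choose] at this
                rw [mul_comm]
                exact_mod_cast this
              exact h2.trans (by gcongr; linarith)
            have h3 : N (k - j) ≤ N 0 * A ^ (k - j) * (k + lam) ^ (k - j) := by
              refine (ih (k - j) (Nat.sub_le k j)).trans ?_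
              gcongr
              exact_mod_cast Nat.sub_le k j
            have h4 : K ^ j ≤ A ^ j * (1 / 2) ^ j := by
              rw [← mul_pow]; gcongr; linarith
            calc (k.choose j : ℝ) * (K ^ (j + 1) * j.factorial) * N (k - j)
                = K * K ^ j * ((k.choose j : ℝ) * j.factorial) * N (k - j) := by ring
              _ ≤ K * (A ^ j * (1 / 2) ^ j) * (k + lam) ^ j *
                  (N 0 * A ^ (k - j) * (k + lam) ^ (k - j)) := by
                  gcongr
                  exact hN _
              _ = K * (N 0 * (A ^ j * A ^ (k - j)) * ((k + lam) ^ j * (k + lam) ^ (k - j))) *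
                  (1 / 2) ^ j := by ring
              _ = K * b * (1 / 2) ^ j := by
                  rw [← pow_add, ← pow_add, Nat.add_sub_cancel' hjk]
        _ = K * b * ∑ j ∈ Finset.range (k + 1), (1 / 2 : ℝ) ^ j := by rw [Finset.mul_sum]
        _ ≤ K * b * 2 := by
            gcongr
            exact sum_geometric_two_le (k + 1)
        _ = 2 * K * b := by ring
    have hNk : N k ≤ b := ih k le_rfl
    have h5 : E k ^ 2 ≤ (α * (k + 1) * b) * E k + (lam * (2 * K + 1) * b) ^ 2 := by
      have hEk := hE k
      have hNk0 := hN k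
      calc E k ^ 2 ≤ _ := hrec k
        _ ≤ α * (k + 1) * b * E k + lam ^ 2 * b * (2 * K * b) := by
            gcongr
            refine Finset.sum_nonneg fun j _ => ?_
            have := hN (k - j)
            positivity
        _ ≤ _ := by
            have : 2 * K ≤ (2 * K + 1) ^ 2 := by nlinarith
            have h6 : lam ^ 2 * b * (2 * K * b) = 2 * K * (lam * b) ^ 2 := by ring
            have h7 : (lam * (2 * K + 1) * b) ^ 2 = (2 * K + 1) ^ 2 * (lam * b) ^ 2 := by ring
            rw [h6, h7]
            gcongr
    have h8 := le_add_of_sq_le_mul_add_sq (by positivity) (by positivity) h5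
    calc E k ≤ (α * (k + 1) + lam * (2 * K + 1)) * b := by linarith
      _ ≤ (A * (k + 1 + lam)) * (N 0 * A ^ k * (k + 1 + lam) ^ k) := by
          rw [hb]
          have h9 : α * (k + 1) + lam * (2 * K + 1) ≤ A * (k + 1 + lam) := by
            have hk : (0 : ℝ) ≤ k := Nat.cast_nonneg k
            nlinarith [mul_nonneg hα hlam, mul_nonneg hK hk]
          have h10 : (k : ℝ) + lam ≤ k + 1 + lam := by linarith
          gcongr
      _ = _ := by ring
  have hall : ∀ k, ∀ i ≤ k, N i ≤ N 0 * A ^ i * (i + lam) ^ i := by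
    intro k
    induction k with
    | zero =>
      intro i hi
      obtain rfl : i = 0 := Nat.le_zero.mp hi
      simp
    | succ k ih =>
      intro i hi
      rcases Nat.lt_or_ge i (k + 1) with h | h
      · exact ih i (Nat.lt_succ_iff.mp h)
      · obtain rfl : i = k + 1 := le_antisymm hi h
        push_cast
        exact (hNE k).trans (step k ih)
  exact ⟨hall k k le_rfl, step k (hall k)⟩

/-- Weighted `L²` norm over the collar box. -/
def collarNorm (ℓ h : ℝ) (f : ℝ × ℝ → ℝ) : ℝ := √(∫ p in collarBox ℓ h, f p ^ 2)

theorem collarNorm_nonneg (ℓ h : ℝ) (f : ℝ × ℝ → ℝ) : 0 ≤ collarNorm ℓ h f := Real.sqrt_nonneg _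

theorem collarNorm_sq (ℓ h : ℝ) (f : ℝ × ℝ → ℝ) :
    collarNorm ℓ h f ^ 2 = ∫ p in collarBox ℓ h, f p ^ 2 :=
  Real.sq_sqrt (integral_nonneg fun _ => sq_nonneg _)

theorem abs_integral_collarBox_mul_le {ℓ h : ℝ} {f g : ℝ × ℝ → ℝ}
    (hf : ContinuousOn f (collarBox ℓ h)) (hg : ContinuousOn g (collarBox ℓ h)) :
    |∫ p in collarBox ℓ h, f p * g p| ≤ collarNorm ℓ h f * collarNorm ℓ h g :=
  abs_integral_mul_le_sqrt ((hf.pow 2).integrableOn_compact (isCompact_collarBox ℓ h))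
    ((hg.pow 2).integrableOn_compact (isCompact_collarBox ℓ h))
    ((hf.mul hg).integrableOn_compact (isCompact_collarBox ℓ h))

theorem integral_collarBox_abs_mul_le {ℓ h : ℝ} {f g : ℝ × ℝ → ℝ}
    (hf : ContinuousOn f (collarBox ℓ h)) (hg : ContinuousOn g (collarBox ℓ h)) :
    ∫ p in collarBox ℓ h, |f p| * |g p| ≤ collarNorm ℓ h f * collarNorm ℓ h g := by
  have := abs_integral_collarBox_mul_le hf.abs hg.abs
  simp only [collarNorm, sq_abs] at this
  exact (le_abs_self _).trans this

theorem collarNorm_le_of_sq_le {ℓ h : ℝ} {f g : ℝ × ℝ → ℝ}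
    (hf : ContinuousOn f (collarBox ℓ h)) (hg : ContinuousOn g (collarBox ℓ h))
    (hfg : ∀ p ∈ collarBox ℓ h, f p ^ 2 ≤ g p ^ 2) : collarNorm ℓ h f ≤ collarNorm ℓ h g :=
  Real.sqrt_le_sqrt (setIntegral_mono_on
    ((hf.pow 2).integrableOn_compact (isCompact_collarBox ℓ h))
    ((hg.pow 2).integrableOn_compact (isCompact_collarBox ℓ h))
    (measurableSet_collarBox ℓ h) hfg)

/-- `collarMass k V = ‖χ^k V‖` -/
def collarMass (ℓ h : ℝ) (k : ℕ) (V : ℝ × ℝ → ℝ) : ℝ :=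
  collarNorm ℓ h fun p => collarWeight h p ^ k * V p

/-- `collarEnergy k V = ‖χ^(k+1) ∇V‖` -/
def collarEnergy (ℓ h : ℝ) (k : ℕ) (V : ℝ × ℝ → ℝ) : ℝ :=
  √(∫ p in collarBox ℓ h, collarWeight h p ^ (2 * k + 2) * (derivFst V p ^ 2 + derivSnd V p ^ 2))

namespace IsCollarFunction

variable {O : Set (ℝ × ℝ)} {ℓ h : ℝ} {V : ℝ × ℝ → ℝ}

theorem continuousOn_of_analytic (hV : IsCollarFunction O ℓ h V) {F : ℝ × ℝ → ℝ}
    (hF : AnalyticOnNhd ℝ F O) : ContinuousOn F (collarBox ℓ h) :=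
  hF.continuousOn.mono hV.box_subset

theorem analytic_weight_mul (_hV : IsCollarFunction O ℓ h V) {F : ℝ × ℝ → ℝ}
    (hF : AnalyticOnNhd ℝ F O) (m : ℕ) :
    AnalyticOnNhd ℝ (fun p => collarWeight h p ^ m * F p) O := fun p hp =>
  ((analyticAt_collarWeight h p).pow m).mul (hF p hp)

theorem continuousOn_weight_mul (hV : IsCollarFunction O ℓ h V) {F : ℝ × ℝ → ℝ}
    (hF : AnalyticOnNhd ℝ F O) (m : ℕ) :
    ContinuousOn (fun p => collarWeight h p ^ m * F p) (collarBox ℓ h) :=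
  hV.continuousOn_of_analytic (hV.analytic_weight_mul hF m)

theorem analytic_grad_sq (hV : IsCollarFunction O ℓ h V) :
    AnalyticOnNhd ℝ (fun p => derivFst V p ^ 2 + derivSnd V p ^ 2) O :=
  (hV.analytic.derivFst.pow 2).add (hV.analytic.derivSnd.pow 2)

theorem collarEnergy_sq (hV : IsCollarFunction O ℓ h V) (k : ℕ) :
    collarEnergy ℓ h k V ^ 2 = ∫ p in collarBox ℓ h,
      collarWeight h p ^ (2 * k + 2) * (derivFst V p ^ 2 + derivSnd V p ^ 2) := by
  refine Real.sq_sqrt (setIntegral_nonneg (measurableSet_collarBox ℓ h) fun p hp => ?_)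
  have := (collarWeight_mem hV.height_pos hp).1
  positivity

theorem collarNorm_le_collarEnergy (hV : IsCollarFunction O ℓ h V) (k : ℕ) {F : ℝ × ℝ → ℝ}
    (hF : AnalyticOnNhd ℝ F O)
    (hle : ∀ p ∈ collarBox ℓ h, F p ^ 2 ≤ derivFst V p ^ 2 + derivSnd V p ^ 2) :
    (collarNorm ℓ h fun p => collarWeight h p ^ (k + 1) * F p) ≤ collarEnergy ℓ h k V := by
  refine Real.sqrt_le_sqrt (setIntegral_mono_on
    (((hV.continuousOn_weight_mul hF _).pow 2).integrableOn_compact (isCompact_collarBox ℓ h))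
    ((hV.continuousOn_weight_mul hV.analytic_grad_sq _).integrableOn_compact
      (isCompact_collarBox ℓ h)) (measurableSet_collarBox ℓ h) fun p hp => ?_)
  have := (collarWeight_mem hV.height_pos hp).1
  calc (collarWeight h p ^ (k + 1) * F p) ^ 2 = collarWeight h p ^ (2 * k + 2) * F p ^ 2 := by ring
    _ ≤ _ := by gcongr; exact hle p hp

theorem collarMass_succ_le (hV : IsCollarFunction O ℓ h V) (k : ℕ) :
    collarMass ℓ h (k + 1) (derivFst V) ≤ collarEnergy ℓ h k V :=
  hV.collarNorm_le_collarEnergy k hV.analytic.derivFst fun p _ => by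
    nlinarith [sq_nonneg (derivSnd V p)]

theorem abs_integral_mul_derivSnd_le (hV : IsCollarFunction O ℓ h V) (k : ℕ) :
    |∫ p in collarBox ℓ h, collarWeight h p ^ (2 * k + 1) * (V p * derivSnd V p)| ≤
      collarMass ℓ h k V * collarEnergy ℓ h k V := by
  have h1 := abs_integral_collarBox_mul_le (hV.continuousOn_weight_mul hV.analytic k)
    (hV.continuousOn_weight_mul hV.analytic.derivSnd (k + 1))
  have h2 := hV.collarNorm_le_collarEnergy k hV.analytic.derivSnd fun p _ => by
    nlinarith [sq_nonneg (derivFst V p)]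
  have e : ∀ p, collarWeight h p ^ (2 * k + 1) * (V p * derivSnd V p) =
      collarWeight h p ^ k * V p * (collarWeight h p ^ (k + 1) * derivSnd V p) := fun p => by ring
  simp only [e]
  exact h1.trans (mul_le_mul_of_nonneg_left h2 (collarNorm_nonneg _ _ _))

theorem collarEnergy_sq_le (hV : IsCollarFunction O ℓ h V) (k : ℕ) :
    collarEnergy ℓ h k V ^ 2 ≤ 2 / h * (k + 1) * collarMass ℓ h k V * collarEnergy ℓ h k V +
      |∫ p in collarBox ℓ h, collarWeight h p ^ (2 * k + 2) * (V p * lapProd V p)| := by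
  have h1 := hV.energy_identity (2 * k + 1)
  rw [hV.collarEnergy_sq k, h1]
  have h2 := hV.abs_integral_mul_derivSnd_le k
  have h3 := (abs_le.mp h2).2
  have hh := hV.height_pos
  push_cast
  have e : (2 * (k : ℝ) + 1 + 1) / h = 2 / h * (k + 1) := by ring
  rw [e, add_comm]
  have h4 : (0 : ℝ) ≤ 2 / h * (k + 1) := by positivity
  have h5 := mul_le_mul_of_nonneg_left h3 h4
  have h6 := neg_abs_le (∫ p in collarBox ℓ h, collarWeight h p ^ (2 * k + 2) * (V p * lapProd V p))
  have e2 : 2 * k + 1 + 1 = 2 * k + 2 := rfl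
  rw [e2]
  linarith

theorem trace_sq_le (hV : IsCollarFunction O ℓ h V) (k : ℕ) :
    ∫ s in (0 : ℝ)..ℓ, V (s, 0) ^ 2 ≤ 2 / h * (k + 1) * collarMass ℓ h k V ^ 2 +
      2 * collarMass ℓ h k V * collarEnergy ℓ h k V := by
  have hh := hV.height_pos
  rw [hV.trace_identity (2 * k + 1)]
  have h1 : ∫ p in collarBox ℓ h, collarWeight h p ^ (2 * k + 1) * V p ^ 2 ≤
      collarMass ℓ h k V ^ 2 := by
    rw [collarMass, collarNorm_sq]
    refine setIntegral_mono_on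
      ((hV.continuousOn_weight_mul (hV.analytic.pow 2) _).integrableOn_compact
        (isCompact_collarBox ℓ h))
      (((hV.continuousOn_weight_mul hV.analytic _).pow 2).integrableOn_compact
        (isCompact_collarBox ℓ h)) (measurableSet_collarBox ℓ h) fun p hp => ?_
    obtain ⟨h0, h1⟩ := collarWeight_mem hV.height_pos hp
    calc collarWeight h p ^ (2 * k + 1) * V p ^ 2 ≤ collarWeight h p ^ (2 * k) * V p ^ 2 := by
          gcongr ?_ * _
          exact pow_le_pow_of_le_one h0 h1 (Nat.le_succ _)
      _ = (collarWeight h p ^ k * V p) ^ 2 := by ring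
  have h2 : -(collarMass ℓ h k V * collarEnergy ℓ h k V) ≤
      ∫ p in collarBox ℓ h, collarWeight h p ^ (2 * k + 2) * (V p * derivSnd V p) := by
    have h3 := abs_integral_collarBox_mul_le (hV.continuousOn_weight_mul hV.analytic (k + 1))
      (hV.continuousOn_weight_mul hV.analytic.derivSnd (k + 1))
    have h4 := hV.collarNorm_le_collarEnergy k hV.analytic.derivSnd fun p _ => by
      nlinarith [sq_nonneg (derivFst V p)]
    have h5 : (collarNorm ℓ h fun p => collarWeight h p ^ (k + 1) * V p) ≤ collarMass ℓ h k V := by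
      refine collarNorm_le_of_sq_le (hV.continuousOn_weight_mul hV.analytic _)
        (hV.continuousOn_weight_mul hV.analytic _) fun p hp => ?_
      obtain ⟨h0, h1⟩ := collarWeight_mem hV.height_pos hp
      rw [mul_pow, mul_pow]
      gcongr ?_ * _
      exact pow_le_pow_left₀ (by positivity) (pow_le_pow_of_le_one h0 h1 (Nat.le_succ _)) 2
    have e : ∀ p, collarWeight h p ^ (2 * k + 2) * (V p * derivSnd V p) =
      collarWeight h p ^ (k + 1) * V p * (collarWeight h p ^ (k + 1) * derivSnd V p) :=
      fun p => by ring
    simp only [e]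
    have h6 := (abs_le.mp h3).1
    have h7 := mul_le_mul h5 h4 (collarNorm_nonneg _ _ _) (collarNorm_nonneg _ _ _)
    linarith
  push_cast
  have e : (2 * (k : ℝ) + 1 + 1) / h = 2 / h * (k + 1) := by ring
  have e2 : 2 * k + 1 + 1 = 2 * k + 2 := rfl
  rw [e, e2]
  have h4 : (0 : ℝ) ≤ 2 / h * (k + 1) := by positivity
  have h5 := mul_le_mul_of_nonneg_left h1 h4
  linarith

end IsCollarFunction

namespace IsCollarFunction

variable {O : Set (ℝ × ℝ)} {ℓ h : ℝ} {V : ℝ × ℝ → ℝ}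

theorem lapProd_iterate_eq_sum (hV : IsCollarFunction O ℓ h V) {a : ℝ × ℝ → ℝ} {lam : ℝ}
    (ha : AnalyticOnNhd ℝ a O)
    (hpde : ∀ s, ∀ η ∈ Set.Icc 0 h, lapProd V (s, η) = -lam ^ 2 * (a (s, η) * V (s, η)))
    (k : ℕ) {p : ℝ × ℝ} (hp : p ∈ collarBox ℓ h) :
    lapProd (derivFst^[k] V) p = -lam ^ 2 * ∑ j ∈ Finset.range (k + 1),
      k.choose j * derivFst^[j] a p * derivFst^[k - j] V p := by
  obtain ⟨s, η⟩ := p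
  have hη := (mem_collarBox.mp hp).2
  have hslice : ∀ s, (s, η) ∈ O := fun s => hV.mem s η hη
  have hVa := hV.analytic
  have hlap : AnalyticOnNhd ℝ (lapProd V) O := hVa.derivFst.derivFst.add hVa.derivSnd.derivSnd
  rw [lapProd_iterate_derivFst hV.isOpen hVa k (hslice s),
    iterate_derivFst_eq_iteratedDeriv hlap hslice, funext fun x => hpde x η hη]
  have h1 := iterate_derivFst_mul ha hVa hslice k s
  rw [← h1, iterate_derivFst_eq_iteratedDeriv (ha.mul hVa) hslice]
  exact iteratedDeriv_const_mul_field _ _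

theorem abs_integral_lapProd_le (hV : IsCollarFunction O ℓ h V) {a : ℝ × ℝ → ℝ} {lam K : ℝ}
    (ha : AnalyticOnNhd ℝ a O)
    (hpde : ∀ s, ∀ η ∈ Set.Icc 0 h, lapProd V (s, η) = -lam ^ 2 * (a (s, η) * V (s, η)))
    (hK : 0 ≤ K)
    (haK : ∀ j : ℕ, ∀ p ∈ collarBox ℓ h, |derivFst^[j] a p| ≤ K ^ (j + 1) * j.factorial)
    (k : ℕ) :
    |∫ p in collarBox ℓ h, collarWeight h p ^ (2 * k + 2) *
        (derivFst^[k] V p * lapProd (derivFst^[k] V) p)| ≤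
      lam ^ 2 * collarMass ℓ h k (derivFst^[k] V) * ∑ j ∈ Finset.range (k + 1),
        (k.choose j : ℝ) * (K ^ (j + 1) * j.factorial) *
          collarMass ℓ h (k - j) (derivFst^[k - j] V) := by
  have hVk := fun i => (hV.iterate_derivFst i).analytic
  have hc : ∀ i, ContinuousOn (fun p => collarWeight h p ^ i * derivFst^[i] V p)
      (collarBox ℓ h) := fun i => hV.continuousOn_weight_mul (hVk i) i
  have hi : ∀ j, IntegrableOn (fun p => lam ^ 2 * ((k.choose j : ℝ) * (K ^ (j + 1) * j.factorial)) *
      (|collarWeight h p ^ k * derivFst^[k] V p| *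
        |collarWeight h p ^ (k - j) * derivFst^[k - j] V p|)) (collarBox ℓ h) := fun j =>
    (continuousOn_const.mul ((hc k).abs.mul (hc (k - j)).abs)).integrableOn_compact
      (isCompact_collarBox ℓ h)
  have hlap : AnalyticOnNhd ℝ (lapProd (derivFst^[k] V)) O :=
    (hVk k).derivFst.derivFst.add (hVk k).derivSnd.derivSnd
  calc |∫ p in collarBox ℓ h, collarWeight h p ^ (2 * k + 2) *
        (derivFst^[k] V p * lapProd (derivFst^[k] V) p)|
      ≤ ∫ p in collarBox ℓ h, |collarWeight h p ^ (2 * k + 2) *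
        (derivFst^[k] V p * lapProd (derivFst^[k] V) p)| := abs_integral_le_integral_abs
    _ ≤ ∫ p in collarBox ℓ h, ∑ j ∈ Finset.range (k + 1),
        lam ^ 2 * ((k.choose j : ℝ) * (K ^ (j + 1) * j.factorial)) *
        (|collarWeight h p ^ k * derivFst^[k] V p| *
        |collarWeight h p ^ (k - j) * derivFst^[k - j] V p|) := by
        refine setIntegral_mono_on
          ((hV.continuousOn_weight_mul ((hVk k).mul hlap) _).abs.integrableOn_compact
            (isCompact_collarBox ℓ h)) (integrable_finsetSum _ fun j _ => hi j)
          (measurableSet_collarBox ℓ h) fun p hp => ?_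
        obtain ⟨h0, h1⟩ := collarWeight_mem hV.height_pos hp
        rw [hV.lapProd_iterate_eq_sum ha hpde k hp]
        rw [Finset.mul_sum, Finset.mul_sum, Finset.mul_sum]
        refine (Finset.abs_sum_le_sum_abs _ _).trans (Finset.sum_le_sum fun j hj => ?_)
        have hjk : j ≤ k := Nat.lt_succ_iff.mp (Finset.mem_range.mp hj)
        simp only [abs_mul, abs_neg, abs_pow, abs_of_nonneg h0, Nat.abs_cast, sq_abs]
        have h2 : collarWeight h p ^ (2 * k + 2) ≤ collarWeight h p ^ k * collarWeight h p ^ (k - j) := by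
          rw [← pow_add]
          exact pow_le_pow_of_le_one h0 h1 (by omega)
        have h3 := haK j p hp
        calc collarWeight h p ^ (2 * k + 2) * (|derivFst^[k] V p| *
              (lam ^ 2 * (k.choose j * |derivFst^[j] a p| * |derivFst^[k - j] V p|)))
            ≤ collarWeight h p ^ k * collarWeight h p ^ (k - j) * (|derivFst^[k] V p| *
              (lam ^ 2 * (k.choose j * (K ^ (j + 1) * j.factorial) * |derivFst^[k - j] V p|))) := by
              gcongr
          _ = _ := by ring
    _ = ∑ j ∈ Finset.range (k + 1), lam ^ 2 * ((k.choose j : ℝ) * (K ^ (j + 1) * j.factorial)) *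
        ∫ p in collarBox ℓ h, |collarWeight h p ^ k * derivFst^[k] V p| *
        |collarWeight h p ^ (k - j) * derivFst^[k - j] V p| := by
        rw [integral_finsetSum _ fun j _ => hi j]
        exact Finset.sum_congr rfl fun j _ => integral_const_mul _ _
    _ ≤ ∑ j ∈ Finset.range (k + 1), lam ^ 2 * ((k.choose j : ℝ) * (K ^ (j + 1) * j.factorial)) *
        (collarMass ℓ h k (derivFst^[k] V) * collarMass ℓ h (k - j) (derivFst^[k - j] V)) := by
        refine Finset.sum_le_sum fun j _ => ?_
        gcongr
        exact integral_collarBox_abs_mul_le (hc k) (hc (k - j))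
    _ = _ := by
        rw [Finset.mul_sum]
        exact Finset.sum_congr rfl fun j _ => by ring

theorem collarEnergy_iterate_sq_le (hV : IsCollarFunction O ℓ h V) {a : ℝ × ℝ → ℝ} {lam K : ℝ}
    (ha : AnalyticOnNhd ℝ a O)
    (hpde : ∀ s, ∀ η ∈ Set.Icc 0 h, lapProd V (s, η) = -lam ^ 2 * (a (s, η) * V (s, η)))
    (hK : 0 ≤ K)
    (haK : ∀ j : ℕ, ∀ p ∈ collarBox ℓ h, |derivFst^[j] a p| ≤ K ^ (j + 1) * j.factorial)
    (k : ℕ) :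
    collarEnergy ℓ h k (derivFst^[k] V) ^ 2 ≤ 2 / h * (k + 1) *
      collarMass ℓ h k (derivFst^[k] V) * collarEnergy ℓ h k (derivFst^[k] V) +
      lam ^ 2 * collarMass ℓ h k (derivFst^[k] V) * ∑ j ∈ Finset.range (k + 1),
        (k.choose j : ℝ) * (K ^ (j + 1) * j.factorial) *
          collarMass ℓ h (k - j) (derivFst^[k - j] V) :=
  ((hV.iterate_derivFst k).collarEnergy_sq_le k).trans
    (by gcongr; exact hV.abs_integral_lapProd_le ha hpde hK haK k)

/-- Square of the boundary norm of tangential derivatives. -/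
theorem trace_iterate_sq_le (hV : IsCollarFunction O ℓ h V) {a : ℝ × ℝ → ℝ} {lam K A : ℝ}
    (ha : AnalyticOnNhd ℝ a O)
    (hpde : ∀ s, ∀ η ∈ Set.Icc 0 h, lapProd V (s, η) = -lam ^ 2 * (a (s, η) * V (s, η)))
    (hK : 0 ≤ K) (hlam : 0 ≤ lam)
    (haK : ∀ j : ℕ, ∀ p ∈ collarBox ℓ h, |derivFst^[j] a p| ≤ K ^ (j + 1) * j.factorial)
    (hA : 2 / h + 2 * K + 1 ≤ A) (k : ℕ) :
    ∫ s in (0 : ℝ)..ℓ, derivFst^[k] V (s, 0) ^ 2 ≤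
      (2 * (collarNorm ℓ h V * A ^ (k + 1) * (k + 1 + lam) ^ (k + 1))) ^ 2 := by
  have hh := hV.height_pos
  have hα : 0 ≤ 2 / h := by positivity
  have hA1 : 1 ≤ A := by linarith
  obtain ⟨h1, h2⟩ := energy_recursion_bound
    (N := fun k => collarMass ℓ h k (derivFst^[k] V))
    (E := fun k => collarEnergy ℓ h k (derivFst^[k] V)) (α := 2 / h) (K := K) (lam := lam) (A := A)
    (fun k => collarNorm_nonneg _ _ _) (fun k => Real.sqrt_nonneg _) hα hK hlam hA
    (fun k => by
      simp only [Function.iterate_succ_apply']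
      exact (hV.iterate_derivFst k).collarMass_succ_le k)
    (fun k => hV.collarEnergy_iterate_sq_le ha hpde hK haK k) k
  have e0 : collarMass ℓ h 0 (derivFst^[0] V) = collarNorm ℓ h V := by
    simp [collarMass]
  simp only [e0] at h1 h2
  set N₀ := collarNorm ℓ h V
  have hN0 : 0 ≤ N₀ := collarNorm_nonneg _ _ _
  set N := collarMass ℓ h k (derivFst^[k] V)
  have hN : 0 ≤ N := collarNorm_nonneg _ _ _
  set D := N₀ * A ^ (k + 1) * (k + 1 + lam) ^ (k + 1) with hD
  have hD0 : 0 ≤ D := by positivity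
  have h3 : 2 / h * (k + 1) * N ≤ D := by
    calc 2 / h * (k + 1) * N ≤ A * (k + 1 + lam) * (N₀ * A ^ k * (k + 1 + lam) ^ k) := by
          have : N ≤ N₀ * A ^ k * (k + 1 + lam) ^ k := by
            refine h1.trans ?_
            gcongr
            linarith
          have h6 : (k : ℝ) + 1 ≤ k + 1 + lam := by linarith
          have h7 : 2 / h ≤ A := by linarith
          exact mul_le_mul (mul_le_mul h7 h6 (by positivity) (by positivity)) this hN (by positivity)
      _ = D := by rw [hD]; ring
  have h4 : N ≤ D := by
    calc N ≤ N₀ * A ^ k * (k + 1 + lam) ^ k := by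
            refine h1.trans ?_
            gcongr
            linarith
      _ ≤ D := by
          rw [hD]
          have : (1 : ℝ) ≤ k + 1 + lam := by
            have : (0 : ℝ) ≤ k := Nat.cast_nonneg k
            linarith
          gcongr <;> first | assumption | omega
  have h5 := (hV.iterate_derivFst k).trace_sq_le k
  calc _ ≤ 2 / h * (k + 1) * N ^ 2 + 2 * N * collarEnergy ℓ h k (derivFst^[k] V) := h5
    _ = (2 / h * (k + 1) * N) * N + 2 * (N * collarEnergy ℓ h k (derivFst^[k] V)) := by ring
    _ ≤ D * D + 2 * (D * D) := by
        gcongr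
        exact Real.sqrt_nonneg _
    _ ≤ (2 * D) ^ 2 := by nlinarith [sq_nonneg D]

end IsCollarFunction

theorem abs_le_of_integral_sq_le {f f' : ℝ → ℝ} {ℓ T T' : ℝ} (hℓ : 0 < ℓ)
    (hf : ∀ s, HasDerivAt f (f' s) s) (hf' : Continuous f') (hp : Function.Periodic f ℓ)
    (hT : 0 ≤ T) (hT' : 0 ≤ T')
    (h1 : ∫ s in (0 : ℝ)..ℓ, f s ^ 2 ≤ T ^ 2) (h2 : ∫ s in (0 : ℝ)..ℓ, f' s ^ 2 ≤ T' ^ 2) (s : ℝ) :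
    |f s| ≤ T / √ℓ + √ℓ * T' := by
  have hfc : Continuous f := continuous_iff_continuousAt.mpr fun s => (hf s).continuousAt
  have hCS : ∀ g : ℝ → ℝ, Continuous g → ∀ T, 0 ≤ T → ∫ s in (0 : ℝ)..ℓ, g s ^ 2 ≤ T ^ 2 →
      ∫ s in (0 : ℝ)..ℓ, |g s| ≤ √ℓ * T := by
    intro g hg T hT h
    have i : ∀ k : ℝ → ℝ, Continuous k → Integrable k (volume.restrict (Set.Ioc 0 ℓ)) :=
      fun k hk => (hk.integrableOn_Icc (a := 0) (b := ℓ)).mono_set Set.Ioc_subset_Icc_self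
    have h3 := abs_integral_mul_le_sqrt (μ := volume.restrict (Set.Ioc 0 ℓ)) (f := fun _ => (1 : ℝ))
      (g := fun s => |g s|) (i _ (by fun_prop)) (i _ (by fun_prop)) (i _ (by fun_prop))
    simp only [← intervalIntegral.integral_of_le hℓ.le, sq_abs, one_mul, one_pow] at h3
    refine (le_abs_self _).trans (h3.trans ?_)
    rw [intervalIntegral.integral_const]
    simp only [sub_zero, smul_eq_mul, mul_one]
    gcongr
    exact Real.sqrt_le_iff.mpr ⟨hT, h⟩
  obtain ⟨s₀, hs₀, hs⟩ := hp.exists_mem_Ico₀ hℓ s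
  rw [hs]
  have hx : ∀ x ∈ Set.Icc 0 ℓ, |f s₀| ≤ |f x| + √ℓ * T' := by
    intro x hx
    have h3 : ∫ t in x..s₀, f' t = f s₀ - f x :=
      intervalIntegral.integral_eq_sub_of_hasDerivAt (fun t _ => hf t) (hf'.intervalIntegrable _ _)
    have h4 : |∫ t in x..s₀, f' t| ≤ ∫ t in (0 : ℝ)..ℓ, |f' t| := by
      have h5 := intervalIntegral.abs_integral_mono_interval (μ := volume) (f := fun t => |f' t|)
        (a := x) (b := s₀) (c := 0) (d := ℓ) (by
          rw [Set.uIoc_of_le hℓ.le]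
          intro t ht
          rw [Set.mem_uIoc] at ht
          rcases ht with ht | ht
          · exact ⟨hx.1.trans_lt ht.1, ht.2.trans hs₀.2.le⟩
          · exact ⟨hs₀.1.trans_lt ht.1, ht.2.trans hx.2⟩)
        (Filter.Eventually.of_forall fun t => abs_nonneg _) (hf'.abs.intervalIntegrable _ _)
      refine (intervalIntegral.norm_integral_le_abs_integral_norm (f := f')).trans (h5.trans ?_)
      rw [abs_of_nonneg (intervalIntegral.integral_nonneg hℓ.le fun t _ => abs_nonneg _)]
    have h6 := hCS f' hf' T' hT' h2
    rw [h3] at h4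
    have h7 := abs_sub_abs_le_abs_sub (f s₀) (f x)
    linarith
  have h8 : ∫ x in (0 : ℝ)..ℓ, |f s₀| ≤ ∫ x in (0 : ℝ)..ℓ, (|f x| + √ℓ * T') :=
    intervalIntegral.integral_mono_on hℓ.le (by simp)
      ((hfc.abs.add continuous_const).intervalIntegrable _ _) hx
  rw [intervalIntegral.integral_add (hfc.abs.intervalIntegrable _ _) (by simp)] at h8
  simp only [intervalIntegral.integral_const, sub_zero, smul_eq_mul] at h8
  have h9 := hCS f hfc T hT h1
  have h10 : ℓ * |f s₀| ≤ √ℓ * T + ℓ * (√ℓ * T') := by linarith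
  have hsq : √ℓ * √ℓ = ℓ := Real.mul_self_sqrt hℓ.le
  have hsp : 0 < √ℓ := Real.sqrt_pos.mpr hℓ
  have h11 : √ℓ * T + ℓ * (√ℓ * T') = ℓ * (T / √ℓ + √ℓ * T') := by
    field_simp
    rw [← hsq]
    simp only [Real.sqrt_mul_self hsp.le]
    ring
  rw [h11] at h10
  exact le_of_mul_le_mul_left h10 hℓ

theorem pow_le_factorial_mul_exp {x : ℝ} (hx : 0 ≤ x) (n : ℕ) :
    x ^ n ≤ n.factorial * Real.exp x := by
  have h := Real.pow_div_factorial_le_exp x hx n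
  rwa [div_le_iff₀' (by positivity)] at h

theorem factorial_add_two_le (k : ℕ) : ((k + 2).factorial : ℝ) ≤ 2 * 4 ^ k * k.factorial := by
  have h : (k + 2) * (k + 1) ≤ 2 * 4 ^ k := by
    induction k with
    | zero => norm_num
    | succ k ih => rw [pow_succ]; nlinarith
  have h2 : (k + 2).factorial = (k + 2) * (k + 1) * k.factorial := by
    simp only [Nat.factorial_succ]; ring
  rw [h2]
  exact_mod_cast Nat.mul_le_mul_right _ h

/-- The boundary values of a solution in the collar extend to a uniform strip with an exponential
bound in terms of the frequency. -/
theorem exists_strip_extension_of_collar {ℓ h K : ℝ} (hℓ : 0 < ℓ) (hh : 0 < h) (hK : 0 ≤ K) :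
    ∃ r > (0 : ℝ), ∃ C > (0 : ℝ), ∀ (O : Set (ℝ × ℝ)) (V a : ℝ × ℝ → ℝ) (lam : ℝ), 0 ≤ lam →
      IsCollarFunction O ℓ h V → AnalyticOnNhd ℝ a O →
      (∀ s, ∀ η ∈ Set.Icc 0 h, lapProd V (s, η) = -lam ^ 2 * (a (s, η) * V (s, η))) →
      (∀ j : ℕ, ∀ p ∈ collarBox ℓ h, |derivFst^[j] a p| ≤ K ^ (j + 1) * j.factorial) →
      ∃ F : ℂ → ℂ, DifferentiableOn ℂ F (realStrip r) ∧ (∀ s : ℝ, F s = V (s, 0)) ∧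
        ∀ t ∈ realStrip r, ‖F t‖ ≤ C * Real.exp lam * collarNorm ℓ h V := by
  set A : ℝ := 2 / h + 2 * K + 1 with hA
  have hA0 : 0 < A := by positivity
  have hA1 : 1 ≤ A := by
    have : 0 ≤ 2 / h + 2 * K := by positivity
    linarith
  set B : ℝ := 4 * A * Real.exp 1 with hB
  have hB0 : 0 < B := by positivity
  have hsp : 0 < √ℓ := Real.sqrt_pos.mpr hℓ
  set C₁ : ℝ := 1 / √ℓ + √ℓ with hC₁
  set C₂ : ℝ := C₁ * 2 * A ^ 2 * 2 * Real.exp 2 with hC₂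
  refine ⟨1 / (2 * B), by positivity, 2 * C₂, by positivity, ?_⟩
  intro O V a lam hlam hV ha hpde haK
  set N₀ := collarNorm ℓ h V with hN₀
  have hN : 0 ≤ N₀ := collarNorm_nonneg _ _ _
  have h0 : ∀ s, (s, (0 : ℝ)) ∈ O := fun s => hV.mem s 0 ⟨le_rfl, hh.le⟩
  have hfa : AnalyticOnNhd ℝ (fun s => V (s, 0)) Set.univ := hV.analytic.slice_fst h0
  have hbd : ∀ (k : ℕ) (s : ℝ), |iteratedDeriv k (fun s => V (s, 0)) s| ≤
      (C₂ * Real.exp lam * N₀) * B ^ k * k.factorial := by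
    intro k s
    rw [← iterate_derivFst_eq_iteratedDeriv hV.analytic h0]
    have hVk := fun k => (hV.iterate_derivFst k)
    have t1 := hV.trace_iterate_sq_le ha hpde hK hlam haK le_rfl k
    have t2 := hV.trace_iterate_sq_le ha hpde hK hlam haK le_rfl (k + 1)
    rw [← hA] at t1 t2
    have h1 := abs_le_of_integral_sq_le (f := fun s => derivFst^[k] V (s, 0))
      (f' := fun s => derivFst^[k + 1] V (s, 0)) hℓ
      (fun s => by
        have := ((hVk k).analytic _ (h0 s)).hasDerivAt_slice_fst
        rwa [← Function.iterate_succ_apply' derivFst k V] at this)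
      ((hVk (k + 1)).analytic.slice_fst h0).continuous
      (fun s => (hVk k).periodic s 0 ⟨le_rfl, hh.le⟩) (by positivity) (by positivity) t1 t2 s
    have hk : (0 : ℝ) ≤ k := Nat.cast_nonneg k
    set D := N₀ * A ^ (k + 2) * (k + 2 + lam) ^ (k + 2) with hD
    have d1 : N₀ * A ^ (k + 1) * (k + 1 + lam) ^ (k + 1) ≤ D := by
      have e1 : A ^ (k + 1) ≤ A ^ (k + 2) := pow_le_pow_right₀ hA1 (by omega)
      have e2 : ((k : ℝ) + 1 + lam) ^ (k + 1) ≤ (k + 2 + lam) ^ (k + 2) :=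
        (pow_le_pow_left₀ (by positivity) (by linarith) _).trans
          (pow_le_pow_right₀ (by linarith) (by omega))
      rw [hD]
      gcongr
    have d2 : N₀ * A ^ (k + 1 + 1) * (((k + 1 : ℕ) : ℝ) + 1 + lam) ^ (k + 1 + 1) = D := by
      rw [hD]; push_cast; ring
    rw [d2] at h1
    have d3 : ((k : ℝ) + 2 + lam) ^ (k + 2) ≤
        2 * 4 ^ k * k.factorial * (Real.exp 2 * Real.exp 1 ^ k * Real.exp lam) := by
      have e1 := pow_le_factorial_mul_exp (x := (k : ℝ) + 2 + lam) (by positivity) (k + 2)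
      have e2 : Real.exp (k + 2 + lam) = Real.exp 2 * Real.exp 1 ^ k * Real.exp lam := by
        rw [← Real.exp_nat_mul, ← Real.exp_add, ← Real.exp_add]
        congr 1; ring
      rw [e2] at e1
      refine e1.trans ?_
      gcongr
      exact factorial_add_two_le k
    calc |derivFst^[k] V (s, 0)| ≤ 2 * D / √ℓ + √ℓ * (2 * D) := by
          refine h1.trans ?_
          gcongr
      _ = C₁ * 2 * D := by rw [hC₁]; ring
      _ ≤ C₁ * 2 * (N₀ * A ^ (k + 2) *
          (2 * 4 ^ k * k.factorial * (Real.exp 2 * Real.exp 1 ^ k * Real.exp lam))) := by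
          rw [hD]; gcongr
      _ = _ := by rw [hC₂, hB, mul_pow, mul_pow]; ring
  obtain ⟨F, hF1, hF2, hF3⟩ := exists_strip_extension_of_iteratedDeriv_le hfa hB0
    (by positivity) hbd
  have hle : 1 / (2 * B) ≤ 1 / B := by
    apply one_div_le_one_div_of_le hB0; linarith
  refine ⟨F, hF1.mono fun t ht => lt_of_lt_of_le (show |t.im| < _ from ht) hle, hF2,
    fun t ht => ?_⟩
  refine (hF3 t (le_of_lt ht)).trans (le_of_eq ?_)
  ring

/-- Boundary energy bound for low frequencies. -/
theorem exists_trace_deriv_sq_le {h K : ℝ} (hh : 0 < h) (hK : 0 ≤ K) :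
    ∃ C > (0 : ℝ), ∀ (O : Set (ℝ × ℝ)) (ℓ : ℝ) (V a : ℝ × ℝ → ℝ) (lam X : ℝ), 0 ≤ lam → lam ≤ 1 →
      0 ≤ X → IsCollarFunction O ℓ h V → AnalyticOnNhd ℝ a O →
      (∀ s, ∀ η ∈ Set.Icc 0 h, lapProd V (s, η) = -lam ^ 2 * (a (s, η) * V (s, η))) →
      (∀ j : ℕ, ∀ p ∈ collarBox ℓ h, |derivFst^[j] a p| ≤ K ^ (j + 1) * j.factorial) →
      collarNorm ℓ h V ≤ X → collarNorm ℓ h (derivFst V) ≤ lam * X →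
      ∫ s in (0 : ℝ)..ℓ, derivFst V (s, 0) ^ 2 ≤ C * (lam ^ 2 * X ^ 2) := by
  set D : ℝ := 4 / h + (K + K ^ 2 + 1) with hD
  have hD0 : 0 < D := by positivity
  refine ⟨4 / h + 2 * D, by positivity, ?_⟩
  intro O ℓ V a lam X hlam hlam1 hX hV ha hpde haK hN0 hN1
  set N := collarMass ℓ h 1 (derivFst V) with hN
  set E := collarEnergy ℓ h 1 (derivFst V) with hE
  have hNnn : 0 ≤ N := collarNorm_nonneg _ _ _
  have hEnn : 0 ≤ E := Real.sqrt_nonneg _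
  have hV1 : IsCollarFunction O ℓ h (derivFst V) := hV.iterate_derivFst 1
  have hNle : N ≤ lam * X := by
    refine le_trans (collarNorm_le_of_sq_le (hV.continuousOn_weight_mul hV1.analytic _)
      (hV.continuousOn_of_analytic hV1.analytic) fun p hp => ?_) hN1
    obtain ⟨h0, h1⟩ := collarWeight_mem hh hp
    rw [mul_pow, pow_one]
    have : collarWeight h p ^ 2 ≤ 1 := pow_le_one₀ h0 h1
    nlinarith [sq_nonneg (derivFst V p)]
  have hrec := hV.collarEnergy_iterate_sq_le ha hpde hK haK 1
  simp only [Function.iterate_one, Nat.cast_one, Finset.sum_range_succ, Finset.sum_range_zero,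
    zero_add, Nat.choose_zero_right, Nat.choose_self, one_mul, Nat.factorial, Nat.sub_zero,
    Nat.sub_self, Function.iterate_zero, id_eq, pow_one, Nat.cast_one, mul_one] at hrec
  rw [← hN, ← hE] at hrec
  have e0 : collarMass ℓ h 0 V = collarNorm ℓ h V := by simp [collarMass]
  rw [e0] at hrec
  have hE2 : E ≤ D * (lam * X) := by
    have h1 : E ^ 2 ≤ (4 / h * (lam * X)) * E + ((K + K ^ 2 + 1) * (lam * X)) ^ 2 := by
      have hc := collarNorm_nonneg ℓ h V
      have h2 : 2 / h * (1 + 1) * N * E ≤ (4 / h * (lam * X)) * E := by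
        have : 2 / h * (1 + 1) * N = 4 / h * N := by ring
        rw [this]; gcongr
      have h3 : lam ^ 2 * N * (K * N + K ^ (1 + 1) * collarNorm ℓ h V) ≤
          lam ^ 2 * (lam * X) * (K * (lam * X) + K ^ (1 + 1) * X) := by gcongr
      have h4 : lam ^ 2 * (lam * X) * (K * (lam * X) + K ^ (1 + 1) * X) ≤
          ((K + K ^ 2 + 1) * (lam * X)) ^ 2 := by
        have h5 : lam ^ 2 * (lam * X) * (K * (lam * X) + K ^ (1 + 1) * X) =
          (lam * X) ^ 2 * (lam * (K * lam + K ^ 2)) := by ring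
        rw [h5, mul_pow _ (lam * X), mul_comm]
        have h6 : lam * (K * lam + K ^ 2) ≤ (K + K ^ 2 + 1) ^ 2 := by
          have : lam * (K * lam + K ^ 2) ≤ 1 * (K * 1 + K ^ 2) := by gcongr
          nlinarith [sq_nonneg K]
        exact mul_le_mul_of_nonneg_right h6 (sq_nonneg _)
      exact hrec.trans (add_le_add h2 (h3.trans h4))
    have h2 := le_add_of_sq_le_mul_add_sq (by positivity) (by positivity) h1
    rw [hD]; linarith
  have htr := hV1.trace_sq_le 1
  rw [← hN, ← hE] at htr
  calc _ ≤ _ := htr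
    _ = 4 / h * N ^ 2 + 2 * (N * E) := by push_cast; ring
    _ ≤ 4 / h * (lam * X) ^ 2 + 2 * ((lam * X) * (D * (lam * X))) := by gcongr
    _ = _ := by ring

/-- `q` is an analytic, arc-length, simple closed parametrization, of period `ℓ`, of the frontier
of the bounded open set `Ω ⊆ ℂ`, positively oriented at the parameter `0`. -/
structure IsBoundaryCurve (Ω : Set ℂ) (q : ℝ → ℂ) (ℓ : ℝ) : Prop where
  isOpen : IsOpen Ω
  isBounded : Bornology.IsBounded Ω
  len_pos : 0 < ℓ
  analytic : AnalyticOnNhd ℝ q Set.univ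
  periodic : Function.Periodic q ℓ
  injOn : Set.InjOn q (Set.Ico 0 ℓ)
  norm_deriv : ∀ s, ‖deriv q s‖ = 1
  range_eq : Set.range q = frontier Ω
  inward : ∃ δ > 0, ∀ t ∈ Set.Ioo (0 : ℝ) δ, q 0 + t * (Complex.I * deriv q 0) ∈ Ω

/-- `Q` maps the strip `|Im t| < r` conformally, and injectively modulo `ℓ`, to a neighbourhood
of the frontier of `Ω`; the upper half of the strip goes to `Ω`, the real line to the frontier and
the lower half to the complement. -/
structure IsConformalCollar (Ω : Set ℂ) (Q : ℂ → ℂ) (ℓ r : ℝ) : Prop where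
  pos : 0 < r
  len_pos : 0 < ℓ
  differentiableOn : DifferentiableOn ℂ Q (realStrip r)
  periodic : ∀ t ∈ realStrip r, Q (t + ℓ) = Q t
  lt_norm_deriv : ∀ t ∈ realStrip r, 1 / 2 < ‖deriv Q t‖
  norm_deriv_lt : ∀ t ∈ realStrip r, ‖deriv Q t‖ < 2
  inj : ∀ t ∈ realStrip r, ∀ t' ∈ realStrip r, Q t = Q t' → ∃ n : ℤ, t' = t + n * ℓ
  mem_of_pos : ∀ t ∈ realStrip r, 0 < t.im → Q t ∈ Ω
  notMem_of_neg : ∀ t ∈ realStrip r, t.im < 0 → Q t ∉ closure Ω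
  real_mem_frontier : ∀ s : ℝ, Q s ∈ frontier Ω
  frontier_subset : ∀ x ∈ frontier Ω, ∃ s : ℝ, Q s = x

theorem realStrip_mono {r r' : ℝ} (h : r ≤ r') : realStrip r ⊆ realStrip r' :=
  fun _ ht => lt_of_lt_of_le ht h

theorem add_mem_realStrip {r : ℝ} {t : ℂ} (ht : t ∈ realStrip r) (x : ℝ) :
    t + x ∈ realStrip r := by simpa [realStrip] using ht

/-- A function which is periodic on a strip takes equal values at translates by multiples of the
period. -/
theorem periodic_int_of_periodic_realStrip {α : Type*} {F : ℂ → α} {r ℓ : ℝ}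
    (h : ∀ t ∈ realStrip r, F (t + ℓ) = F t) (n : ℤ) {t : ℂ} (ht : t ∈ realStrip r) :
    F (t + n * ℓ) = F t := by
  have hm : ∀ n : ℤ, t + n * ℓ ∈ realStrip r := fun n => by
    have := add_mem_realStrip ht (n * ℓ)
    simpa using this
  induction n using Int.induction_on with
  | zero => simp
  | succ k ih =>
    rw [← ih, ← h _ (hm k)]; congr 1; push_cast; ring
  | pred k ih =>
    rw [← ih, ← h _ (hm (-k - 1))]; congr 1; push_cast; ring

theorem exists_int_shift_mem_Ico {ℓ : ℝ} (hℓ : 0 < ℓ) (c x : ℝ) :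
    ∃ n : ℤ, c ≤ x + n * ℓ ∧ x + n * ℓ < c + ℓ := by
  obtain ⟨n, hn, -⟩ := existsUnique_add_zsmul_mem_Ico hℓ x c
  exact ⟨n, by simpa using hn⟩

theorem thickening_segment {δ a b : ℝ} {t : ℂ} (h0 : a ≤ t.re) (h1 : t.re ≤ b)
    (h2 : |t.im| < δ) : t ∈ Metric.thickening δ ((fun x : ℝ => (x : ℂ)) '' Set.Icc a b) := by
  rw [Metric.mem_thickening_iff]
  refine ⟨t.re, ⟨t.re, ⟨h0, h1⟩, rfl⟩, ?_⟩
  rw [Complex.dist_of_re_eq (by simp)]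
  simpa [Real.dist_eq] using h2

/-- An open neighbourhood of the real line which is periodic contains a strip. -/
theorem exists_realStrip_subset {U : Set ℂ} (hU : IsOpen U) {ℓ : ℝ} (hℓ : 0 < ℓ)
    (hr : ∀ x : ℝ, (x : ℂ) ∈ U) (hp : ∀ t ∈ U, ∀ n : ℤ, t + n * ℓ ∈ U) :
    ∃ r > 0, realStrip r ⊆ U := by
  have hc : IsCompact ((fun x : ℝ => (x : ℂ)) '' Set.Icc 0 ℓ) :=
    isCompact_Icc.image Complex.continuous_ofReal
  obtain ⟨δ, hδ, hsub⟩ := hc.exists_thickening_subset_open hU (by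
    rintro _ ⟨x, -, rfl⟩; exact hr x)
  refine ⟨δ, hδ, fun t ht => ?_⟩
  obtain ⟨n, h0, h1⟩ := exists_int_shift_mem_Ico hℓ 0 t.re
  have h2 : t + n * ℓ ∈ U := hsub (thickening_segment (by simpa using h0)
    (by simpa using h1.le) (by simpa [realStrip] using ht))
  have := hp _ h2 (-n)
  push_cast at this
  convert this using 1
  ring

theorem HasStrictDerivAt.exists_injOn {f : ℂ → ℂ} {f' a : ℂ} (hf : HasStrictDerivAt f f' a)
    (hf' : f' ≠ 0) : ∃ u ∈ nhds a, Set.InjOn f u :=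
  ⟨_, hf.eventually_left_inverse hf', Set.LeftInvOn.injOn (f₁' := hf.localInverse f f' a hf')
    fun _ hx => hx⟩

theorem injOn_real_segment {q : ℝ → ℂ} {ℓ : ℝ} (hℓ : 0 < ℓ) (hp : Function.Periodic q ℓ)
    (hi : Set.InjOn q (Set.Ico 0 ℓ)) {x y : ℝ} (hxy : q x = q y) : ∃ n : ℤ, y = x + n * ℓ := by
  obtain ⟨n, hn⟩ := exists_int_shift_mem_Ico hℓ 0 x
  obtain ⟨m, hm⟩ := exists_int_shift_mem_Ico hℓ 0 y
  rw [zero_add] at hn hm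
  have h : q (x + n * ℓ) = q (y + m * ℓ) := by
    rw [hp.int_mul n x, hp.int_mul m y, hxy]
  have := hi ⟨hn.1, hn.2⟩ ⟨hm.1, hm.2⟩ h
  exact ⟨n - m, by push_cast; linarith⟩

/-- Injectivity on short closed segments of the real line persists on thin rectangles. -/
theorem exists_injOn_rectangle {Q : ℂ → ℂ} {q : ℝ → ℂ} {ℓ r : ℝ} (hr : 0 < r) (hℓ : 0 < ℓ)
    (hQ : DifferentiableOn ℂ Q (realStrip r)) (hQ' : ∀ s : ℝ, deriv Q s ≠ 0)
    (hq : ∀ s : ℝ, Q s = q s) (hp : Function.Periodic q ℓ) (hi : Set.InjOn q (Set.Ico 0 ℓ))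
    (c : ℝ) : ∃ δ > 0, ∀ t t' : ℂ, c ≤ t.re → t.re ≤ c + 3 * ℓ / 4 → |t.im| < δ →
      c ≤ t'.re → t'.re ≤ c + 3 * ℓ / 4 → |t'.im| < δ → Q t = Q t' → t = t' := by
  have hc : IsCompact ((fun x : ℝ => (x : ℂ)) '' Set.Icc c (c + 3 * ℓ / 4)) :=
    isCompact_Icc.image Complex.continuous_ofReal
  have hd : ∀ s : ℝ, AnalyticAt ℂ Q s := fun s =>
    hQ.analyticAt ((isOpen_realStrip r).mem_nhds (ofReal_mem_realStrip hr s))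
  have hinj : Set.InjOn Q ((fun x : ℝ => (x : ℂ)) '' Set.Icc c (c + 3 * ℓ / 4)) := by
    rintro _ ⟨x, hx, rfl⟩ _ ⟨y, hy, rfl⟩ h
    simp only [hq] at h
    obtain ⟨n, hn⟩ := injOn_real_segment hℓ hp hi h
    have h1 : |(n : ℝ)| * ℓ < 1 * ℓ := by
      rw [← abs_of_pos hℓ, ← abs_mul, abs_of_pos hℓ, abs_lt]
      constructor <;> linarith [hx.1, hx.2, hy.1, hy.2]
    have h2 : |(n : ℝ)| < 1 := lt_of_mul_lt_mul_right h1 hℓ.le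
    have h3 : n = 0 := by
      rw [← Int.abs_lt_one_iff]; exact_mod_cast h2
    subst h3
    simp at hn
    simp [hn]
  obtain ⟨u, hu, hinju⟩ := hinj.exists_mem_nhdsSet hc
    (by rintro _ ⟨x, -, rfl⟩; exact (hd x).continuousAt)
    (by
      rintro _ ⟨x, -, rfl⟩
      exact (hd x).hasStrictDerivAt.exists_injOn (hQ' x))
  obtain ⟨v, hv, hsv, hvu⟩ := mem_nhdsSet_iff_exists.1 hu
  obtain ⟨δ, hδ, hsub⟩ := hc.exists_thickening_subset_open hv hsv
  refine ⟨δ, hδ, fun t t' h1 h2 h3 h4 h5 h6 h => hinju (hvu (hsub ?_)) (hvu (hsub ?_)) h⟩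
  · exact thickening_segment h1 h2 h3
  · exact thickening_segment h4 h5 h6

/-- Injectivity modulo the period on the real line persists on a strip. -/
theorem exists_inj_realStrip {Q : ℂ → ℂ} {q : ℝ → ℂ} {ℓ r : ℝ} (hr : 0 < r) (hℓ : 0 < ℓ)
    (hQ : DifferentiableOn ℂ Q (realStrip r)) (hQ' : ∀ s : ℝ, deriv Q s ≠ 0)
    (hq : ∀ s : ℝ, Q s = q s) (hp : Function.Periodic q ℓ) (hi : Set.InjOn q (Set.Ico 0 ℓ)) :
    ∃ δ > 0, δ ≤ r ∧ ∀ t ∈ realStrip δ, ∀ t' ∈ realStrip δ, Q t = Q t' →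
      ∃ n : ℤ, t' = t + n * ℓ := by
  obtain ⟨δ₀, hδ₀, H₀⟩ := exists_injOn_rectangle hr hℓ hQ hQ' hq hp hi 0
  obtain ⟨δ₁, hδ₁, H₁⟩ := exists_injOn_rectangle hr hℓ hQ hQ' hq hp hi (ℓ / 4)
  obtain ⟨δ₂, hδ₂, H₂⟩ := exists_injOn_rectangle hr hℓ hQ hQ' hq hp hi (ℓ / 2)
  obtain ⟨δ₃, hδ₃, H₃⟩ := exists_injOn_rectangle hr hℓ hQ hQ' hq hp hi (3 * ℓ / 4)
  have hQp : ∀ t ∈ realStrip r, Q (t + ℓ) = Q t :=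
    periodic_of_periodic_real hQ fun s => by
      rw [← Complex.ofReal_add, hq, hq, hp]
  set δ := min r (min (min δ₀ δ₁) (min δ₂ δ₃)) with hδ
  have hδr : δ ≤ r := min_le_left _ _
  have hd0 : δ ≤ δ₀ := (min_le_right _ _).trans ((min_le_left _ _).trans (min_le_left _ _))
  have hd1 : δ ≤ δ₁ := (min_le_right _ _).trans ((min_le_left _ _).trans (min_le_right _ _))
  have hd2 : δ ≤ δ₂ := (min_le_right _ _).trans ((min_le_right _ _).trans (min_le_left _ _))
  have hd3 : δ ≤ δ₃ := (min_le_right _ _).trans ((min_le_right _ _).trans (min_le_right _ _))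
  have key : ∀ t ∈ realStrip δ, ∀ t' ∈ realStrip δ, 0 ≤ t.re → t.re < ℓ → t.re ≤ t'.re →
      t'.re ≤ t.re + ℓ / 2 → Q t = Q t' → t = t' := by
    intro t ht t' ht' h0 h1 h2 h3 h
    have ht : |t.im| < δ := ht
    have ht' : |t'.im| < δ := ht'
    rcases le_total t.re (ℓ / 4) with h4 | h4
    · exact H₀ t t' (by linarith) (by linarith) (by linarith) (by linarith) (by linarith)
        (by linarith) h
    rcases le_total t.re (ℓ / 2) with h5 | h5
    · exact H₁ t t' (by linarith) (by linarith) (by linarith) (by linarith) (by linarith)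
        (by linarith) h
    rcases le_total t.re (3 * ℓ / 4) with h6 | h6
    · exact H₂ t t' (by linarith) (by linarith) (by linarith) (by linarith) (by linarith)
        (by linarith) h
    · exact H₃ t t' (by linarith) (by linarith) (by linarith) (by linarith) (by linarith)
        (by linarith) h
  have hper : ∀ t ∈ realStrip δ, ∀ n : ℤ, Q (t + n * ℓ) = Q t := fun t ht n =>
    periodic_int_of_periodic_realStrip hQp n (realStrip_mono hδr ht)
  have hmem : ∀ t ∈ realStrip δ, ∀ n : ℤ, t + n * ℓ ∈ realStrip δ := fun t ht n => by
    simpa using add_mem_realStrip ht (n * ℓ)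
  have key2 : ∀ t ∈ realStrip δ, ∀ t' ∈ realStrip δ, t.re ≤ t'.re →
      t'.re ≤ t.re + ℓ / 2 → Q t = Q t' → t = t' := by
    intro t ht t' ht' h2 h3 h
    obtain ⟨n, hn⟩ := exists_int_shift_mem_Ico hℓ 0 t.re
    have := key (t + n * ℓ) (hmem t ht n) (t' + n * ℓ) (hmem t' ht' n) (by simpa using hn.1)
      (by simpa using hn.2) (by simpa using h2) (by simp; linarith)
      (by rw [hper t ht, hper t' ht', h])
    simpa using this
  refine ⟨δ, by positivity, hδr, fun t ht t' ht' h => ?_⟩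
  obtain ⟨n, hn⟩ := exists_int_shift_mem_Ico hℓ t.re t'.re
  have hre : (t' + n * ℓ).re = t'.re + n * ℓ := by simp
  have h' : Q t = Q (t' + n * ℓ) := by rw [hper t' ht', h]
  rcases le_total (t'.re + n * ℓ) (t.re + ℓ / 2) with h1 | h1
  · have := key2 t ht _ (hmem t' ht' n) (by rw [hre]; exact hn.1) (by rw [hre]; exact h1) h'
    exact ⟨-n, by rw [this]; push_cast; ring⟩
  · have h1' : (t + (1 : ℤ) * ℓ).re = t.re + ℓ := by simp
    have := key2 _ (hmem t' ht' n) (t + (1 : ℤ) * ℓ) (hmem t ht 1)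
      (by rw [hre, h1']; linarith [hn.2]) (by rw [hre, h1']; linarith)
      (by rw [hper t ht, ← h'])
    refine ⟨1 - n, ?_⟩
    push_cast at this ⊢
    linear_combination this

theorem IsPreconnected.subset_of_disjoint_frontier {X : Type*} [TopologicalSpace X] {u v : Set X}
    (hv : IsPreconnected v) (hu : IsOpen u) (hd : Disjoint (frontier u) v)
    (hne : (v ∩ u).Nonempty) : v ⊆ u := by
  have hs : v ⊆ u ∪ (closure u)ᶜ := fun x hx => by
    by_cases h : x ∈ closure u
    · rw [closure_eq_self_union_frontier] at h
      exact Or.inl (h.resolve_right fun h' => Set.disjoint_left.1 hd h' hx)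
    · exact Or.inr h
  refine hv.subset_left_of_subset_union hu isClosed_closure.isOpen_compl ?_ hs hne
  exact Set.disjoint_left.2 fun x hx hx' => hx' (subset_closure hx)

theorem convex_halfStrip_pos (r : ℝ) : Convex ℝ {t : ℂ | 0 < t.im ∧ t.im < r} :=
  (convex_halfSpace_im_gt 0).inter (convex_halfSpace_im_lt r)

theorem convex_halfStrip_neg (r : ℝ) : Convex ℝ {t : ℂ | -r < t.im ∧ t.im < 0} :=
  (convex_halfSpace_im_gt (-r)).inter (convex_halfSpace_im_lt 0)

open Filter Topology in
/-- A conformal map along the real axis sends some points above the axis to any set which is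
entered when moving to the left of the curve. -/
theorem exists_im_pos_mem {Q : ℂ → ℂ} {d : ℂ} {r : ℝ} {Ω : Set ℂ} (hr : 0 < r)
    (hQ : HasStrictDerivAt Q d 0) (hd : d ≠ 0)
    (hin : ∃ δ > 0, ∀ t ∈ Set.Ioo (0 : ℝ) δ, Q 0 + t * (Complex.I * d) ∈ Ω) :
    ∃ t : ℂ, 0 < t.im ∧ t.im < r ∧ Q t ∈ Ω := by
  obtain ⟨δ, hδ, hin⟩ := hin
  set g := hQ.localInverse Q d 0 hd with hg
  have hgd : HasDerivAt g d⁻¹ (Q 0) := (hQ.to_localInverse hd).hasDerivAt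
  have hg0 : g (Q 0) = 0 := (hQ.eventually_left_inverse hd).self_of_nhds
  set p : ℝ → ℂ := fun x => Q 0 + x * (Complex.I * d) with hp
  have hp0 : p 0 = Q 0 := by simp [hp]
  have hpd : HasDerivAt p (Complex.I * d) 0 := by
    have := ((Complex.ofRealCLM.hasDerivAt (x := (0 : ℝ))).mul_const (Complex.I * d)).const_add (Q 0)
    simpa [hp] using this
  have hcomp : HasDerivAt (fun x => g (p x)) (d⁻¹ * (Complex.I * d)) 0 := by
    rw [← hp0] at hgd
    exact hgd.comp_of_eq (𝕜 := ℝ) (𝕜' := ℂ) (0 : ℝ) hpd rfl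
  have hI : d⁻¹ * (Complex.I * d) = Complex.I := by field_simp
  rw [hI] at hcomp
  have him : HasDerivAt (fun x => (g (p x)).im) 1 0 := by
    have := Complex.imCLM.hasFDerivAt.comp_hasDerivAt (0 : ℝ) hcomp
    simp only [Complex.imCLM_apply, Complex.I_im] at this
    exact this
  have hsign := eventually_nhdsWithin_sign_eq_of_deriv_pos (f := fun x => (g (p x)).im) (x₀ := 0)
    (by rw [him.deriv]; norm_num) (by simp [hp0, hg0])
  have hpt : Tendsto p (𝓝 0) (𝓝 (Q 0)) := by
    have := hpd.continuousAt.tendsto; rwa [hp0] at this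
  have hri : ∀ᶠ x in 𝓝 (0 : ℝ), Q (g (p x)) = p x := hpt.eventually (hQ.eventually_right_inverse hd)
  have hlt : ∀ᶠ x in 𝓝 (0 : ℝ), (g (p x)).im < r := by
    have := him.continuousAt.tendsto.eventually (eventually_lt_nhds (b := r) (by simpa [hp0, hg0] using hr))
    exact this
  have hIoo : ∀ᶠ x in 𝓝[>] (0 : ℝ), x ∈ Set.Ioo 0 δ := Ioo_mem_nhdsGT hδ
  obtain ⟨x, ⟨hx1, hx2, hx3⟩, hx4⟩ := (((hsign.and (hri.and hlt)).filter_mono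
    nhdsWithin_le_nhds).and hIoo).exists
  refine ⟨g (p x), ?_, hx3, ?_⟩
  · have : SignType.sign (x - 0) = 1 := sign_pos (by simpa using hx4.1)
    rw [this] at hx1
    exact sign_eq_one_iff.1 hx1
  · rw [hx2]; exact hin x hx4

open Filter Topology in
/-- An analytic boundary curve has a conformal collar. -/
theorem IsBoundaryCurve.exists_isConformalCollar {Ω : Set ℂ} {q : ℝ → ℂ} {ℓ : ℝ}
    (hq : IsBoundaryCurve Ω q ℓ) :
    ∃ r > 0, ∃ Q : ℂ → ℂ, IsConformalCollar Ω Q ℓ r ∧ ∀ s : ℝ, Q s = q s := by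
  have hℓ := hq.len_pos
  obtain ⟨r₀, hr₀, Q, hQ, hQq⟩ := exists_strip_extension_of_periodic hq.analytic hℓ hq.periodic
  have hper : ∀ t ∈ realStrip r₀, Q (t + ℓ) = Q t :=
    periodic_of_periodic_real hQ fun s => by
      rw [← Complex.ofReal_add, hQq, hQq, hq.periodic]
  have hopen := isOpen_realStrip r₀
  have hQa : ∀ t ∈ realStrip r₀, AnalyticAt ℂ Q t := fun t ht =>
    hQ.analyticAt (hopen.mem_nhds ht)
  have hderiv : ∀ s : ℝ, deriv Q s = deriv q s := fun s => by
    have h1 := (hQa s (ofReal_mem_realStrip hr₀ s)).differentiableAt.hasDerivAt.comp_ofReal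
    have h2 : (fun x : ℝ => Q x) = q := funext hQq
    rw [h2] at h1
    exact h1.deriv.symm
  have hne : ∀ s : ℝ, deriv Q s ≠ 0 := fun s h => by
    have := hq.norm_deriv s
    rw [← hderiv, h] at this
    simp at this
  have hdper : ∀ t ∈ realStrip r₀, deriv Q (t + ℓ) = deriv Q t := fun t ht => by
    rw [← deriv_comp_add_const]
    exact Filter.EventuallyEq.deriv_eq (Filter.eventually_of_mem (hopen.mem_nhds ht) hper)
  obtain ⟨r₁, hr₁, hsub⟩ := exists_realStrip_subset
    (U := realStrip r₀ ∩ (fun t => ‖deriv Q t‖) ⁻¹' Set.Ioo (1 / 2) 2)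
    (((hQ.deriv hopen).continuousOn.norm).isOpen_inter_preimage hopen isOpen_Ioo) hℓ
    (fun x => ⟨ofReal_mem_realStrip hr₀ x, by
      simp only [Set.mem_preimage, hderiv, hq.norm_deriv]; norm_num⟩)
    (fun t ht n => ⟨by simpa using add_mem_realStrip ht.1 (n * ℓ), by
      simp only [Set.mem_preimage]
      rw [periodic_int_of_periodic_realStrip hdper n ht.1]
      exact ht.2⟩)
  have hr10 : realStrip r₁ ⊆ realStrip r₀ := fun t ht => (hsub ht).1
  obtain ⟨r, hr, hrr₁, hinj⟩ := exists_inj_realStrip hr₁ hℓ (hQ.mono hr10) hne hQq hq.periodic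
    hq.injOn
  have hr0 : realStrip r ⊆ realStrip r₀ := (realStrip_mono hrr₁).trans hr10
  have hfr : ∀ t ∈ realStrip r, t.im ≠ 0 → Q t ∉ frontier Ω := by
    intro t ht him hmem
    rw [← hq.range_eq] at hmem
    obtain ⟨s, hs⟩ := hmem
    rw [← hQq] at hs
    obtain ⟨n, hn⟩ := hinj s (ofReal_mem_realStrip hr s) t ht hs
    apply him
    rw [hn]
    simp
  have hcont : ContinuousOn Q (realStrip r) := (hQ.mono hr0).continuousOn
  have hpos : {t : ℂ | 0 < t.im ∧ t.im < r} ⊆ realStrip r := fun t ht => by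
    simp only [realStrip, Set.mem_ofPred_eq, abs_lt]; exact ⟨by linarith [ht.1], ht.2⟩
  have hneg : {t : ℂ | -r < t.im ∧ t.im < 0} ⊆ realStrip r := fun t ht => by
    simp only [realStrip, Set.mem_ofPred_eq, abs_lt]; exact ⟨ht.1, by linarith [ht.2]⟩
  have hup : Q '' {t : ℂ | 0 < t.im ∧ t.im < r} ⊆ Ω := by
    refine IsPreconnected.subset_of_disjoint_frontier
      ((convex_halfStrip_pos r).isPreconnected.image _ (hcont.mono hpos)) hq.isOpen ?_ ?_
    · rw [Set.disjoint_right]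
      rintro _ ⟨t, ht, rfl⟩
      exact hfr t (hpos ht) ht.1.ne'
    · obtain ⟨t, h1, h2, h3⟩ := exists_im_pos_mem hr
        ((hQa 0 (by simpa using ofReal_mem_realStrip hr₀ 0)).hasStrictDerivAt)
        (by simpa using hne 0) (Ω := Ω) (by
          have h0 := hQq 0
          have h0' := hderiv 0
          simp only [Complex.ofReal_zero] at h0 h0'
          rw [h0, h0']
          exact hq.inward)
      exact ⟨Q t, ⟨t, ⟨h1, h2⟩, rfl⟩, h3⟩
  have hreal : ∀ s : ℝ, Q s ∈ frontier Ω := fun s => by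
    rw [hQq, ← hq.range_eq]; exact ⟨s, rfl⟩
  have hlow : ∀ t ∈ realStrip r, t.im < 0 → Q t ∉ Ω := by
    intro t ht him hmem
    have ht' : -r < t.im := (abs_lt.1 ht).1
    have hlow : Q '' {t : ℂ | -r < t.im ∧ t.im < 0} ⊆ Ω := by
      refine IsPreconnected.subset_of_disjoint_frontier
        ((convex_halfStrip_neg r).isPreconnected.image _ (hcont.mono hneg)) hq.isOpen ?_
        ⟨Q t, ⟨t, ⟨ht', him⟩, rfl⟩, hmem⟩
      rw [Set.disjoint_right]
      rintro _ ⟨t, ht, rfl⟩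
      exact hfr t (hneg ht) ht.2.ne
    have hclo : IsOpen (closure Ω) := by
      rw [isOpen_iff_mem_nhds]
      intro x hx
      rw [closure_eq_self_union_frontier] at hx
      rcases hx with hx | hx
      · exact Filter.mem_of_superset (hq.isOpen.mem_nhds hx) subset_closure
      · rw [← hq.range_eq] at hx
        obtain ⟨s, rfl⟩ := hx
        have hs := (hQa s (ofReal_mem_realStrip hr₀ s)).hasStrictDerivAt.map_nhds_eq (hne s)
        rw [← hQq, ← hs]
        refine Filter.mem_map.2 (Filter.mem_of_superset
          ((isOpen_realStrip r).mem_nhds (ofReal_mem_realStrip hr s)) fun z hz => ?_)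
        have hz : |z.im| < r := hz
        rw [abs_lt] at hz
        rcases lt_trichotomy z.im 0 with h | h | h
        · exact subset_closure (hlow ⟨z, ⟨hz.1, h⟩, rfl⟩)
        · have : z = (z.re : ℂ) := Complex.ext rfl (by simpa using h)
          rw [Set.mem_preimage, this]
          exact frontier_subset_closure (hreal _)
        · exact subset_closure (hup ⟨z, ⟨h, hz.2⟩, rfl⟩)
    have huniv : closure Ω = Set.univ :=
      IsClopen.eq_univ ⟨isClosed_closure, hclo⟩ ⟨Q t, subset_closure hmem⟩
    have hb := hq.isBounded.closure
    rw [huniv] at hb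
    exact NoncompactSpace.noncompact_univ (X := ℂ) (by
      simpa using hb.isCompact_closure)
  refine ⟨r, hr, Q, ⟨hr, hℓ, hQ.mono hr0, fun t ht => hper t (hr0 ht),
    fun t ht => (hsub (realStrip_mono hrr₁ ht)).2.1, fun t ht => (hsub (realStrip_mono hrr₁ ht)).2.2,
    hinj, fun t ht h => hup ⟨t, ⟨h, (abs_lt.1 ht).2⟩, rfl⟩, ?_, hreal, ?_⟩, hQq⟩
  · intro t ht h hmem
    rw [closure_eq_self_union_frontier] at hmem
    rcases hmem with hmem | hmem
    · exact hlow t ht h hmem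
    · exact hfr t ht h.ne hmem
  · intro x hx
    rw [← hq.range_eq] at hx
    obtain ⟨s, hs⟩ := hx
    exact ⟨s, by rw [hQq, hs]⟩

/-- The point `s + i η` of the complex plane with coordinates `(s, η)`. -/
def planePoint (p : ℝ × ℝ) : ℂ := ⟨p.1, p.2⟩

@[simp] theorem planePoint_re (p : ℝ × ℝ) : (planePoint p).re = p.1 := rfl

@[simp] theorem planePoint_im (p : ℝ × ℝ) : (planePoint p).im = p.2 := rfl

theorem planePoint_zero_snd (s : ℝ) : planePoint (s, 0) = s := rfl

theorem planePoint_add_fst (s η x : ℝ) : planePoint (s + x, η) = planePoint (s, η) + x :=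
  Complex.ext (by simp) (by simp)

theorem planePoint_eq_equiv : planePoint = Complex.equivRealProdCLM.symm := by
  ext p; rfl

theorem hasFDerivAt_planePoint (p : ℝ × ℝ) :
    HasFDerivAt planePoint (Complex.equivRealProdCLM.symm : ℝ × ℝ →L[ℝ] ℂ) p := by
  rw [planePoint_eq_equiv]
  exact Complex.equivRealProdCLM.symm.hasFDerivAt

theorem continuous_planePoint : Continuous planePoint := by
  rw [planePoint_eq_equiv]; exact Complex.equivRealProdCLM.symm.continuous

theorem analyticAt_planePoint (p : ℝ × ℝ) : AnalyticAt ℝ planePoint p := by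
  rw [planePoint_eq_equiv]
  exact (Complex.equivRealProdCLM.symm : ℝ × ℝ →L[ℝ] ℂ).analyticAt p

theorem hasFDerivAt_comp_planePoint {A : ℂ → ℝ} {Q : ℂ → ℂ} {d : ℂ} {p : ℝ × ℝ}
    (hA : DifferentiableAt ℝ A (Q (planePoint p))) (hQ : HasDerivAt Q d (planePoint p)) :
    HasFDerivAt (fun p => A (Q (planePoint p)))
      ((fderiv ℝ A (Q (planePoint p))).comp
        (((ContinuousLinearMap.toSpanSingleton ℂ d).restrictScalars ℝ).comp
        (Complex.equivRealProdCLM.symm : ℝ × ℝ →L[ℝ] ℂ))) p :=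
  hA.hasFDerivAt.comp p ((hQ.hasFDerivAt.restrictScalars ℝ).comp p (hasFDerivAt_planePoint p))

theorem derivFst_comp_planePoint {A : ℂ → ℝ} {Q : ℂ → ℂ} {d : ℂ} {p : ℝ × ℝ}
    (hA : DifferentiableAt ℝ A (Q (planePoint p))) (hQ : HasDerivAt Q d (planePoint p)) :
    derivFst (fun p => A (Q (planePoint p))) p = fderiv ℝ A (Q (planePoint p)) d := by
  unfold derivFst
  rw [(hasFDerivAt_comp_planePoint hA hQ).fderiv]
  have : Complex.equivRealProdCLM.symm ((1 : ℝ), (0 : ℝ)) = 1 := by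
    apply Complex.ext <;> simp
  simp [this]

theorem derivSnd_comp_planePoint {A : ℂ → ℝ} {Q : ℂ → ℂ} {d : ℂ} {p : ℝ × ℝ}
    (hA : DifferentiableAt ℝ A (Q (planePoint p))) (hQ : HasDerivAt Q d (planePoint p)) :
    derivSnd (fun p => A (Q (planePoint p))) p =
      fderiv ℝ A (Q (planePoint p)) (Complex.I * d) := by
  unfold derivSnd
  rw [(hasFDerivAt_comp_planePoint hA hQ).fderiv]
  have : Complex.equivRealProdCLM.symm ((0 : ℝ), (1 : ℝ)) = Complex.I := by
    apply Complex.ext <;> simp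
  simp [this]

theorem fderiv_apply_complex (A : ℂ → ℝ) (x w : ℂ) :
    fderiv ℝ A x w = w.re * fderiv ℝ A x 1 + w.im * fderiv ℝ A x Complex.I := by
  have h : w = w.re • (1 : ℂ) + w.im • Complex.I := by
    apply Complex.ext <;> simp
  conv_lhs => rw [h]
  rw [map_add, map_smul, map_smul, smul_eq_mul, smul_eq_mul]

/-- The Piola transform: the divergence of a vector field in conformal coordinates. -/
theorem divergence_piola {A B : ℂ → ℝ} {Q : ℂ → ℂ} {p : ℝ × ℝ}
    (hA : DifferentiableAt ℝ A (Q (planePoint p))) (hB : DifferentiableAt ℝ B (Q (planePoint p)))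
    (hQ : AnalyticAt ℂ Q (planePoint p)) :
    derivFst (fun p => A (Q (planePoint p)) * (deriv Q (planePoint p)).re +
        B (Q (planePoint p)) * (deriv Q (planePoint p)).im) p +
      derivSnd (fun p => B (Q (planePoint p)) * (deriv Q (planePoint p)).re -
        A (Q (planePoint p)) * (deriv Q (planePoint p)).im) p =
      ‖deriv Q (planePoint p)‖ ^ 2 * (fderiv ℝ A (Q (planePoint p)) 1 +
        fderiv ℝ B (Q (planePoint p)) Complex.I) := by
  have hQ1 := hQ.differentiableAt.hasDerivAt
  have hQ2 := hQ.deriv.differentiableAt.hasDerivAt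
  have hre : DifferentiableAt ℝ (fun z : ℂ => z.re) (deriv Q (planePoint p)) :=
    Complex.reCLM.differentiableAt
  have him : DifferentiableAt ℝ (fun z : ℂ => z.im) (deriv Q (planePoint p)) :=
    Complex.imCLM.differentiableAt
  have dA := (hasFDerivAt_comp_planePoint hA hQ1).differentiableAt
  have dB := (hasFDerivAt_comp_planePoint hB hQ1).differentiableAt
  have dr := (hasFDerivAt_comp_planePoint (A := fun z : ℂ => z.re) hre hQ2).differentiableAt
  have di := (hasFDerivAt_comp_planePoint (A := fun z : ℂ => z.im) him hQ2).differentiableAt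
  have fre : ∀ z w : ℂ, fderiv ℝ (fun z : ℂ => z.re) z w = w.re := fun z w => by
    have : (fun z : ℂ => z.re) = Complex.reCLM := rfl
    rw [this, ContinuousLinearMap.fderiv]; rfl
  have fim : ∀ z w : ℂ, fderiv ℝ (fun z : ℂ => z.im) z w = w.im := fun z w => by
    have : (fun z : ℂ => z.im) = Complex.imCLM := rfl
    rw [this, ContinuousLinearMap.fderiv]; rfl
  have e1 := derivFst_comp_planePoint hA hQ1
  have e2 := derivFst_comp_planePoint hB hQ1
  have e3 := derivSnd_comp_planePoint hA hQ1
  have e4 := derivSnd_comp_planePoint hB hQ1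
  have e5 := derivFst_comp_planePoint (A := fun z : ℂ => z.re) hre hQ2
  have e6 := derivFst_comp_planePoint (A := fun z : ℂ => z.im) him hQ2
  have e7 := derivSnd_comp_planePoint (A := fun z : ℂ => z.re) hre hQ2
  have e8 := derivSnd_comp_planePoint (A := fun z : ℂ => z.im) him hQ2
  rw [fre] at e5 e7
  rw [fim] at e6 e8
  rw [fderiv_apply_complex] at e1 e2 e3 e4
  have s1 : derivFst (fun p => A (Q (planePoint p)) * (deriv Q (planePoint p)).re +
        B (Q (planePoint p)) * (deriv Q (planePoint p)).im) p =
      derivFst (fun p => A (Q (planePoint p)) * (deriv Q (planePoint p)).re) p +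
      derivFst (fun p => B (Q (planePoint p)) * (deriv Q (planePoint p)).im) p := by
    unfold derivFst
    rw [fderiv_fun_add (dA.fun_mul dr) (dB.fun_mul di)]; rfl
  have s2 : derivSnd (fun p => B (Q (planePoint p)) * (deriv Q (planePoint p)).re -
        A (Q (planePoint p)) * (deriv Q (planePoint p)).im) p =
      derivSnd (fun p => B (Q (planePoint p)) * (deriv Q (planePoint p)).re) p -
      derivSnd (fun p => A (Q (planePoint p)) * (deriv Q (planePoint p)).im) p := by
    unfold derivSnd
    rw [fderiv_fun_sub (dB.fun_mul dr) (dA.fun_mul di)]; rfl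
  rw [s1, s2, derivFst_mul dA dr, derivFst_mul dB di, derivSnd_mul dB dr, derivSnd_mul dA di,
    e1, e2, e3, e4, e5, e6, e7, e8, ← Complex.normSq_eq_norm_sq, Complex.normSq_apply]
  simp only [Complex.mul_re, Complex.mul_im, Complex.I_re, Complex.I_im]
  ring

theorem det_smul_complex (d : ℂ) :
    ((ContinuousLinearMap.toSpanSingleton ℂ d).restrictScalars ℝ : ℂ →L[ℝ] ℂ).det = ‖d‖ ^ 2 := by
  have h := LinearMap.det_restrictScalars (R := ℝ) (S := ℂ) (A := ℂ)
    (f := (ContinuousLinearMap.toSpanSingleton ℂ d : ℂ →ₗ[ℂ] ℂ))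
  rw [LinearMap.det_ring, Algebra.norm_complex_apply] at h
  rw [← Complex.normSq_eq_norm_sq]
  simp only [ContinuousLinearMap.coe_coe, ContinuousLinearMap.toSpanSingleton_apply,
    one_smul] at h
  exact h

/-- The half-open rectangle on which a collar map is injective. -/
def collarRect (ℓ h : ℝ) : Set ℂ := {t | (0 ≤ t.re ∧ t.re < ℓ) ∧ 0 < t.im ∧ t.im < h}

theorem measurableSet_collarRect (ℓ h : ℝ) : MeasurableSet (collarRect ℓ h) := by
  have : collarRect ℓ h = Complex.re ⁻¹' Set.Ico 0 ℓ ∩ Complex.im ⁻¹' Set.Ioo 0 h := rfl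
  rw [this]
  exact (Complex.measurable_re measurableSet_Ico).inter (Complex.measurable_im measurableSet_Ioo)

theorem setIntegral_collarRect (ℓ h : ℝ) (D : ℂ → ℝ) :
    ∫ t in collarRect ℓ h, D t = ∫ p in collarBox ℓ h, D (planePoint p) := by
  have hmp := Complex.volume_preserving_equiv_real_prod.symm Complex.measurableEquivRealProd
  have h1 := hmp.setIntegral_preimage_emb
    Complex.measurableEquivRealProd.symm.measurableEmbedding D (collarRect ℓ h)
  rw [← h1]
  have h2 : Complex.measurableEquivRealProd.symm ⁻¹' collarRect ℓ h =
      Set.Ico 0 ℓ ×ˢ Set.Ioo 0 h := by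
    ext p; rfl
  have h3 : (Set.Ico 0 ℓ ×ˢ Set.Ioo 0 h : Set (ℝ × ℝ)) =ᵐ[volume] collarBox ℓ h := by
    have : collarBox ℓ h = Set.Icc 0 ℓ ×ˢ Set.Icc 0 h := by
      ext p; rw [mem_collarBox]; rfl
    rw [this]
    exact Measure.set_prod_ae_eq Ico_ae_eq_Icc Ioo_ae_eq_Icc
  rw [h2, setIntegral_congr_set h3]
  rfl

namespace IsConformalCollar

variable {Ω : Set ℂ} {Q : ℂ → ℂ} {ℓ r h : ℝ}

theorem collarRect_subset (hh : h ≤ r) : collarRect ℓ h ⊆ realStrip r := fun t ht => by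
  have : |t.im| = t.im := abs_of_pos ht.2.1
  change |t.im| < r
  rw [this]; linarith [ht.2.2]

theorem analyticAt (hQ : IsConformalCollar Ω Q ℓ r) {t : ℂ} (ht : t ∈ realStrip r) :
    AnalyticAt ℂ Q t :=
  hQ.differentiableOn.analyticAt ((isOpen_realStrip r).mem_nhds ht)

theorem deriv_ne_zero (hQ : IsConformalCollar Ω Q ℓ r) {t : ℂ} (ht : t ∈ realStrip r) :
    deriv Q t ≠ 0 := fun h => by
  have := hQ.lt_norm_deriv t ht
  rw [h, norm_zero] at this
  norm_num at this

theorem injOn_collarRect (hQ : IsConformalCollar Ω Q ℓ r) (hh : h ≤ r) :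
    Set.InjOn Q (collarRect ℓ h) := by
  intro t ht t' ht' he
  obtain ⟨n, hn⟩ := hQ.inj t (collarRect_subset hh ht) t' (collarRect_subset hh ht') he
  have h1 : t'.re = t.re + n * ℓ := by rw [hn]; simp
  have hℓ := hQ.len_pos
  have h2 : |(n : ℝ)| * ℓ < 1 * ℓ := by
    rw [← abs_of_pos hℓ, ← abs_mul, abs_of_pos hℓ, abs_lt]
    constructor <;> linarith [ht.1.1, ht.1.2, ht'.1.1, ht'.1.2]
  have h3 : |(n : ℝ)| < 1 := lt_of_mul_lt_mul_right h2 hℓ.le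
  have h4 : n = 0 := by rw [← Int.abs_lt_one_iff]; exact_mod_cast h3
  rw [hn, h4]; simp

/-- Change of variables on the image of the collar. -/
theorem setIntegral_image (hQ : IsConformalCollar Ω Q ℓ r) (hh : h ≤ r) (D : ℂ → ℝ) :
    ∫ x in Q '' collarRect ℓ h, D x =
      ∫ p in collarBox ℓ h, ‖deriv Q (planePoint p)‖ ^ 2 * D (Q (planePoint p)) := by
  rw [integral_image_eq_integral_abs_det_fderiv_smul volume (measurableSet_collarRect ℓ h)
    (f' := fun t => (ContinuousLinearMap.toSpanSingleton ℂ (deriv Q t)).restrictScalars ℝ)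
    (fun t ht => ((hQ.analyticAt (collarRect_subset hh ht)).differentiableAt.hasDerivAt.hasFDerivAt
      |>.restrictScalars ℝ).hasFDerivWithinAt) (hQ.injOn_collarRect hh),
    ← setIntegral_collarRect ℓ h fun t => ‖deriv Q t‖ ^ 2 * D (Q t)]
  simp only [det_smul_complex, abs_pow, abs_norm, smul_eq_mul]

end IsConformalCollar

/-- A smooth function of the height, equal to `1` below `r / 8` and to `0` above `r / 4`. -/
def heightCutoff (r η : ℝ) : ℝ := smoothTransition (2 - 8 * η / r)

theorem heightCutoff_of_le {r η : ℝ} (hr : 0 < r) (h : η ≤ r / 8) : heightCutoff r η = 1 := by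
  apply smoothTransition.one_of_one_le
  have : 8 * η / r ≤ 1 := by rw [div_le_one hr]; linarith
  linarith

theorem heightCutoff_of_ge {r η : ℝ} (hr : 0 < r) (h : r / 4 ≤ η) : heightCutoff r η = 0 := by
  apply smoothTransition.zero_of_nonpos
  have : 2 ≤ 8 * η / r := by rw [le_div_iff₀ hr]; linarith
  linarith

theorem contDiff_heightCutoff (r : ℝ) : ContDiff ℝ 1 (heightCutoff r) :=
  (smoothTransition.contDiff (n := 1)).comp
    (contDiff_const.sub ((contDiff_const.mul contDiff_id).div_const _))

open Classical in
/-- The height cutoff transported to the plane by a collar map, extended by zero. -/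
def planeCutoff (Q : ℂ → ℂ) (r : ℝ) (x : ℂ) : ℝ :=
  if h : ∃ t ∈ realStrip r, Q t = x then heightCutoff r h.choose.im else 0

namespace IsConformalCollar

variable {Ω : Set ℂ} {Q : ℂ → ℂ} {ℓ r : ℝ}

theorem im_eq_of_eq (hQ : IsConformalCollar Ω Q ℓ r) {t t' : ℂ} (ht : t ∈ realStrip r)
    (ht' : t' ∈ realStrip r) (h : Q t = Q t') : t.im = t'.im := by
  obtain ⟨n, hn⟩ := hQ.inj t ht t' ht' h
  rw [hn]; simp

theorem planeCutoff_apply (hQ : IsConformalCollar Ω Q ℓ r) {t : ℂ} (ht : t ∈ realStrip r) :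
    planeCutoff Q r (Q t) = heightCutoff r t.im := by
  have h : ∃ t' ∈ realStrip r, Q t' = Q t := ⟨t, ht, rfl⟩
  rw [planeCutoff, dif_pos h, hQ.im_eq_of_eq h.choose_spec.1 ht h.choose_spec.2]

open Filter Topology in
theorem contDiffAt_planeCutoff (hQ : IsConformalCollar Ω Q ℓ r) {t : ℂ} (ht : t ∈ realStrip r) :
    ContDiffAt ℝ 1 (planeCutoff Q r) (Q t) := by
  have ha := hQ.analyticAt ht
  have hs := ha.hasStrictDerivAt
  have hne := hQ.deriv_ne_zero ht
  set g := hs.localInverse Q _ t hne with hg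
  have h1 : ∀ᶠ y in 𝓝 (Q t), Q (g y) = y := hs.eventually_right_inverse hne
  have hgt : g (Q t) = t := (hs.eventually_left_inverse hne).self_of_nhds
  have hcd : ContDiffAt ℂ 1 g (Q t) := by
    have := (ha.contDiffAt (n := 1)).to_localInverse
      (hs.hasStrictFDerivAt_equiv hne).hasFDerivAt one_ne_zero
    exact this
  have h2 : ∀ᶠ y in 𝓝 (Q t), g y ∈ realStrip r := by
    apply hcd.continuousAt.tendsto.eventually
    rw [hgt]
    exact (isOpen_realStrip r).mem_nhds ht
  have h3 : planeCutoff Q r =ᶠ[𝓝 (Q t)] fun y => heightCutoff r (g y).im := by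
    filter_upwards [h1, h2] with y hy1 hy2
    conv_lhs => rw [← hy1]
    rw [hQ.planeCutoff_apply hy2]
  refine ContDiffAt.congr_of_eventuallyEq ?_ h3
  have h4 : ContDiffAt ℝ 1 (fun y => (g y).im) (Q t) :=
    Complex.imCLM.contDiff.contDiffAt.comp (Q t) (hcd.restrict_scalars ℝ)
  exact (contDiff_heightCutoff r).contDiffAt.comp (Q t) h4

theorem exists_rep (hQ : IsConformalCollar Ω Q ℓ r) {t : ℂ} (ht : t ∈ realStrip r) :
    ∃ t' ∈ realStrip r, (0 ≤ t'.re ∧ t'.re < ℓ) ∧ t'.im = t.im ∧ Q t' = Q t := by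
  obtain ⟨n, h0, h1⟩ := exists_int_shift_mem_Ico hQ.len_pos 0 t.re
  refine ⟨t + n * ℓ, by simpa using add_mem_realStrip ht (n * ℓ), ?_, by simp,
    periodic_int_of_periodic_realStrip hQ.periodic n ht⟩
  simpa using And.intro h0 h1

theorem im_pos_of_mem (hΩ : IsOpen Ω) (hQ : IsConformalCollar Ω Q ℓ r) {t : ℂ}
    (ht : t ∈ realStrip r) (h : Q t ∈ Ω) : 0 < t.im := by
  rcases lt_trichotomy t.im 0 with h1 | h1 | h1
  · exact absurd (subset_closure h) (hQ.notMem_of_neg t ht h1)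
  · have h2 : t = (t.re : ℂ) := Complex.ext rfl (by simpa using h1)
    have h3 := hQ.real_mem_frontier t.re
    rw [← h2, hΩ.frontier_eq] at h3
    exact absurd h h3.2
  · exact h1

theorem image_collarRect_subset (hQ : IsConformalCollar Ω Q ℓ r) :
    Q '' collarRect ℓ (r / 2) ⊆ Ω := by
  rintro _ ⟨t, ht, rfl⟩
  exact hQ.mem_of_pos t (collarRect_subset (by linarith [hQ.pos]) ht) ht.2.1

open Filter Topology in
theorem planeCutoff_eventuallyEq_zero (hΩ : IsOpen Ω) (hQ : IsConformalCollar Ω Q ℓ r) {x : ℂ}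
    (hx : x ∈ Ω) (hx' : x ∉ Q '' collarRect ℓ (r / 2)) : planeCutoff Q r =ᶠ[𝓝 x] 0 := by
  have hr := hQ.pos
  set K : Set ℂ := Q '' (Set.Icc 0 ℓ ×ℂ Set.Icc (-(r / 4)) (r / 4)) with hK
  have hstrip : ∀ t ∈ (Set.Icc 0 ℓ ×ℂ Set.Icc (-(r / 4)) (r / 4)), t ∈ realStrip r := by
    intro t ht
    rw [Complex.mem_reProdIm] at ht
    have := abs_le.2 ht.2
    change |t.im| < r
    linarith
  have hKc : IsClosed K := by
    apply IsCompact.isClosed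
    exact (isCompact_Icc.reProdIm isCompact_Icc).image_of_continuousOn
      (hQ.differentiableOn.continuousOn.mono hstrip)
  have hxK : x ∉ K := by
    rintro ⟨t, ht, rfl⟩
    obtain ⟨t', ht'r, hre, him, he⟩ := hQ.exists_rep (hstrip t ht)
    rw [← he] at hx
    refine hx' ⟨t', ⟨hre, hQ.im_pos_of_mem hΩ ht'r hx, ?_⟩, he⟩
    rw [Complex.mem_reProdIm] at ht
    rw [him]; linarith [ht.2.2]
  filter_upwards [hKc.isOpen_compl.mem_nhds hxK, hΩ.mem_nhds hx] with y hy1 hy2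
  by_cases h : ∃ t ∈ realStrip r, Q t = y
  · obtain ⟨t, ht, rfl⟩ := h
    rw [hQ.planeCutoff_apply ht]
    apply heightCutoff_of_ge hr
    have hpos := hQ.im_pos_of_mem hΩ ht hy2
    by_contra! hlt
    obtain ⟨t', -, hre, him, he⟩ := hQ.exists_rep ht
    refine hy1 ⟨t', ?_, he⟩
    rw [Complex.mem_reProdIm, him]
    exact ⟨⟨hre.1, hre.2.le⟩, by linarith, hlt.le⟩
  · rw [planeCutoff, dif_neg h]; rfl

open Filter Topology in
theorem contDiffAt_planeCutoff_of_mem (hΩ : IsOpen Ω) (hQ : IsConformalCollar Ω Q ℓ r) {x : ℂ}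
    (hx : x ∈ Ω) : ContDiffAt ℝ 1 (planeCutoff Q r) x := by
  by_cases h : x ∈ Q '' collarRect ℓ (r / 2)
  · obtain ⟨t, ht, rfl⟩ := h
    exact hQ.contDiffAt_planeCutoff (collarRect_subset (by linarith [hQ.pos]) ht)
  · exact contDiffAt_const.congr_of_eventuallyEq (hQ.planeCutoff_eventuallyEq_zero hΩ hx h)

open Filter Topology in
theorem planeCutoff_eventuallyEq_one (hQ : IsConformalCollar Ω Q ℓ r) {x : ℂ}
    (hx : x ∈ frontier Ω) : planeCutoff Q r =ᶠ[𝓝 x] 1 := by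
  have hr := hQ.pos
  obtain ⟨s, rfl⟩ := hQ.frontier_subset x hx
  have hs := (hQ.analyticAt (ofReal_mem_realStrip hr s)).hasStrictDerivAt.map_nhds_eq
    (hQ.deriv_ne_zero (ofReal_mem_realStrip hr s))
  rw [← hs]
  refine Filter.mem_map.2 (Filter.mem_of_superset
    ((isOpen_realStrip (r / 8)).mem_nhds (ofReal_mem_realStrip (by linarith) s)) fun z hz => ?_)
  have hz' : z ∈ realStrip r := realStrip_mono (by linarith) hz
  change planeCutoff Q r (Q z) = 1
  rw [hQ.planeCutoff_apply hz', heightCutoff_of_le hr]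
  exact (le_abs_self _).trans (le_of_lt hz)

end IsConformalCollar

theorem integral_fderiv_eq_zero_of_hasCompactSupport {F : ℂ → ℝ} (hF : ContDiff ℝ 1 F)
    (hc : HasCompactSupport F) (v : ℂ) : ∫ x, fderiv ℝ F x v = 0 := by
  have h1 : Integrable F := hF.continuous.integrable_of_hasCompactSupport hc
  have h2 : Integrable (fun x => fderiv ℝ F x v) :=
    ((hF.continuous_fderiv (by simp)).clm_apply continuous_const).integrable_of_hasCompactSupport
      (hc.fderiv_apply ℝ v)
  have := integral_mul_fderiv_eq_neg_fderiv_mul_of_integrable (μ := (volume : Measure ℂ))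
    (f := F) (g := fun _ => (1 : ℝ)) (v := v) (by simpa using h2) (by simp) (by simpa using h1)
    (fun x _ => hF.differentiable (by simp) x) (fun x _ => differentiableAt_const _)
  simpa using this.symm

namespace IsConformalCollar

variable {Ω : Set ℂ} {Q : ℂ → ℂ} {ℓ r : ℝ}

open Filter Topology in
/-- Away from the frontier the integral of a derivative vanishes. -/
theorem setIntegral_fderiv_one_sub_cutoff (hΩ : IsOpen Ω) (hb : Bornology.IsBounded Ω)
    (hQ : IsConformalCollar Ω Q ℓ r) {A : ℂ → ℝ} (hA : ∀ x ∈ closure Ω, ContDiffAt ℝ 1 A x)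
    (v : ℂ) :
    ∫ x in Ω, fderiv ℝ (fun x => (1 - planeCutoff Q r x) * A x) x v = 0 ∧
      IntegrableOn (fun x => fderiv ℝ (fun x => (1 - planeCutoff Q r x) * A x) x v) Ω := by
  set G : ℂ → ℝ := fun x => (1 - planeCutoff Q r x) * A x with hG
  set F : ℂ → ℝ := Ω.indicator G with hF
  have hin : ∀ x ∈ Ω, F =ᶠ[𝓝 x] G := fun x hx => by
    filter_upwards [hΩ.mem_nhds hx] with y hy
    exact Set.indicator_of_mem hy _
  have hout : ∀ x ∉ Ω, F =ᶠ[𝓝 x] 0 := fun x hx => by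
    by_cases hx' : x ∈ frontier Ω
    · filter_upwards [hQ.planeCutoff_eventuallyEq_one hx'] with y hy
      have : G y = 0 := by simp [hG, hy]
      by_cases hy' : y ∈ Ω
      · rw [hF, Set.indicator_of_mem hy', this]; rfl
      · rw [hF, Set.indicator_of_notMem hy']; rfl
    · have : x ∉ closure Ω := by
        rw [closure_eq_self_union_frontier]; rintro (h | h)
        exacts [hx h, hx' h]
      filter_upwards [isClosed_closure.isOpen_compl.mem_nhds this] with y hy
      rw [hF, Set.indicator_of_notMem fun h => hy (subset_closure h)]; rfl
  have hFc : ContDiff ℝ 1 F := by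
    rw [contDiff_iff_contDiffAt]
    intro x
    by_cases hx : x ∈ Ω
    · refine ContDiffAt.congr_of_eventuallyEq ?_ (hin x hx)
      exact (contDiffAt_const.sub (hQ.contDiffAt_planeCutoff_of_mem hΩ hx)).mul
        (hA x (subset_closure hx))
    · exact contDiffAt_const.congr_of_eventuallyEq (hout x hx)
  have hFs : HasCompactSupport F := by
    refine HasCompactSupport.of_support_subset_isCompact hb.isCompact_closure ?_
    intro x hx
    by_contra h
    exact hx (Set.indicator_of_notMem (fun h' => h (subset_closure h')) _)
  have h0 := integral_fderiv_eq_zero_of_hasCompactSupport hFc hFs v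
  have hfd : ∀ x ∈ Ω, fderiv ℝ F x v = fderiv ℝ G x v := fun x hx => by
    rw [(hin x hx).fderiv_eq]
  rw [← setIntegral_eq_integral_of_forall_compl_eq_zero (s := Ω)
    (fun x hx => by rw [(hout x hx).fderiv_eq]; simp)] at h0
  refine ⟨by rw [← h0]; exact setIntegral_congr_fun hΩ.measurableSet fun x hx => (hfd x hx).symm, ?_⟩
  have hi : Integrable (fun x => fderiv ℝ F x v) :=
    ((hFc.continuous_fderiv (by simp)).clm_apply continuous_const).integrable_of_hasCompactSupport
      (hFs.fderiv_apply ℝ v)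
  exact hi.integrableOn.congr_fun hfd hΩ.measurableSet

theorem planePoint_mem_realStrip (hQ : IsConformalCollar Ω Q ℓ r) {p : ℝ × ℝ} (h0 : 0 ≤ p.2)
    (h1 : p.2 ≤ r / 2) : planePoint p ∈ realStrip r := by
  change |p.2| < r
  rw [abs_of_nonneg h0]
  linarith [hQ.pos]

theorem planePoint_mem_closure (hQ : IsConformalCollar Ω Q ℓ r) {p : ℝ × ℝ} (h0 : 0 ≤ p.2)
    (h1 : p.2 ≤ r / 2) : Q (planePoint p) ∈ closure Ω := by
  rcases h0.eq_or_lt with h | h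
  · have : planePoint p = (p.1 : ℂ) := Complex.ext rfl (by simp [← h])
    rw [this]
    exact frontier_subset_closure (hQ.real_mem_frontier _)
  · exact subset_closure (hQ.mem_of_pos _ (hQ.planePoint_mem_realStrip h0 h1) h)

theorem contDiffAt_comp_planePoint (hQ : IsConformalCollar Ω Q ℓ r) {A : ℂ → ℝ} {p : ℝ × ℝ}
    (hp : planePoint p ∈ realStrip r) (hA : ContDiffAt ℝ 1 A (Q (planePoint p))) :
    ContDiffAt ℝ 1 (fun p => A (Q (planePoint p))) p := by
  have h1 : ContDiffAt ℝ 1 (fun p => Q (planePoint p)) p :=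
    ((hQ.analyticAt hp).contDiffAt.restrict_scalars ℝ).comp p (analyticAt_planePoint p).contDiffAt
  exact hA.comp p h1

theorem contDiffAt_deriv_comp_planePoint (hQ : IsConformalCollar Ω Q ℓ r) {p : ℝ × ℝ}
    (hp : planePoint p ∈ realStrip r) :
    ContDiffAt ℝ 1 (fun p => (deriv Q (planePoint p)).re) p ∧
      ContDiffAt ℝ 1 (fun p => (deriv Q (planePoint p)).im) p := by
  have h1 : ContDiffAt ℝ 1 (fun p => deriv Q (planePoint p)) p :=
    ((hQ.analyticAt hp).deriv.contDiffAt.restrict_scalars ℝ).comp p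
      (analyticAt_planePoint p).contDiffAt
  exact ⟨Complex.reCLM.contDiff.contDiffAt.comp p h1, Complex.imCLM.contDiff.contDiffAt.comp p h1⟩

theorem deriv_periodic (hQ : IsConformalCollar Ω Q ℓ r) {t : ℂ} (ht : t ∈ realStrip r) :
    deriv Q (t + ℓ) = deriv Q t := by
  rw [← deriv_comp_add_const]
  exact Filter.EventuallyEq.deriv_eq
    (Filter.eventually_of_mem ((isOpen_realStrip r).mem_nhds ht) hQ.periodic)

open Filter Topology in
/-- The divergence theorem in a domain with a conformal collar. -/
theorem setIntegral_divergence (hΩ : IsOpen Ω) (hb : Bornology.IsBounded Ω)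
    (hQ : IsConformalCollar Ω Q ℓ r) {A B : ℂ → ℝ} (hA : ∀ x ∈ closure Ω, ContDiffAt ℝ 1 A x)
    (hB : ∀ x ∈ closure Ω, ContDiffAt ℝ 1 B x) :
    ∫ x in Ω, fderiv ℝ A x 1 + fderiv ℝ B x Complex.I =
      -∫ s in (0 : ℝ)..ℓ, (B (Q s) * (deriv Q s).re - A (Q s) * (deriv Q s).im) := by
  have hr := hQ.pos
  set χ := planeCutoff Q r with hχ
  have hsplit : ∀ {A : ℂ → ℝ}, (∀ x ∈ closure Ω, ContDiffAt ℝ 1 A x) → ∀ v : ℂ, ∀ x ∈ Ω,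
      fderiv ℝ (fun x => (1 - χ x) * A x) x v + fderiv ℝ (fun x => χ x * A x) x v =
        fderiv ℝ A x v := by
    intro A hA v x hx
    have h1 := (hQ.contDiffAt_planeCutoff_of_mem hΩ hx).differentiableAt one_ne_zero
    have h2 := (hA x (subset_closure hx)).differentiableAt one_ne_zero
    have h1' : DifferentiableAt ℝ (fun x => 1 - χ x) x := (differentiableAt_const _).sub h1
    rw [← add_apply, ← fderiv_fun_add (h1'.fun_mul h2) (h1.fun_mul h2)]
    congr 2
    ext y; ring
  obtain ⟨zA, iA⟩ := hQ.setIntegral_fderiv_one_sub_cutoff hΩ hb hA 1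
  obtain ⟨zB, iB⟩ := hQ.setIntegral_fderiv_one_sub_cutoff hΩ hb hB Complex.I
  have hintegrable : ∀ {A : ℂ → ℝ}, (∀ x ∈ closure Ω, ContDiffAt ℝ 1 A x) → ∀ v : ℂ,
      IntegrableOn (fun x => fderiv ℝ A x v) Ω := fun hA v =>
    (ContinuousOn.integrableOn_compact hb.isCompact_closure fun x hx =>
      ((hA x hx).continuousAt_fderiv_apply v).continuousWithinAt).mono_set subset_closure
  set D : ℂ → ℝ := fun x => fderiv ℝ (fun x => χ x * A x) x 1 +
    fderiv ℝ (fun x => χ x * B x) x Complex.I with hD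
  have e1 : ∫ x in Ω, fderiv ℝ A x 1 + fderiv ℝ B x Complex.I = ∫ x in Ω, D x := by
    have hDeq : ∀ x ∈ Ω, D x = (fderiv ℝ A x 1 + fderiv ℝ B x Complex.I) -
        (fderiv ℝ (fun x => (1 - χ x) * A x) x 1 +
          fderiv ℝ (fun x => (1 - χ x) * B x) x Complex.I) := fun x hx => by
      rw [← hsplit hA 1 x hx, ← hsplit hB Complex.I x hx, hD]; ring
    have hs1 : IntegrableOn (fun x => fderiv ℝ A x 1 + fderiv ℝ B x Complex.I) Ω :=
      (hintegrable hA 1).add (hintegrable hB Complex.I)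
    have hs2 : IntegrableOn (fun x => fderiv ℝ (fun x => (1 - χ x) * A x) x 1 +
        fderiv ℝ (fun x => (1 - χ x) * B x) x Complex.I) Ω := iA.add iB
    rw [setIntegral_congr_fun hΩ.measurableSet hDeq, integral_sub hs1 hs2, integral_add iA iB,
      zA, zB]
    ring
  have e2 : ∫ x in Ω, D x = ∫ x in Q '' collarRect ℓ (r / 2), D x := by
    refine setIntegral_eq_of_subset_of_forall_sdiff_eq_zero hΩ.measurableSet
      hQ.image_collarRect_subset fun x hx => ?_
    have h0 := hQ.planeCutoff_eventuallyEq_zero hΩ hx.1 hx.2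
    have : ∀ A : ℂ → ℝ, (fun x => χ x * A x) =ᶠ[𝓝 x] fun _ => 0 := fun A => by
      filter_upwards [h0] with y hy
      rw [hχ, hy]; simp
    rw [hD]
    simp only [(this A).fderiv_eq, (this B).fderiv_eq]
    simp
  set f : ℝ × ℝ → ℝ := fun p => heightCutoff r p.2 * A (Q (planePoint p)) *
    (deriv Q (planePoint p)).re +
    heightCutoff r p.2 * B (Q (planePoint p)) * (deriv Q (planePoint p)).im with hf
  set g : ℝ × ℝ → ℝ := fun p => heightCutoff r p.2 * B (Q (planePoint p)) *
    (deriv Q (planePoint p)).re -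
    heightCutoff r p.2 * A (Q (planePoint p)) * (deriv Q (planePoint p)).im with hg
  have e3 : ∫ x in Q '' collarRect ℓ (r / 2), D x =
      ∫ p in collarBox ℓ (r / 2), derivFst f p + derivSnd g p := by
    rw [hQ.setIntegral_image (by linarith)]
    have hae : ∀ᵐ p : ℝ × ℝ ∂volume.restrict (collarBox ℓ (r / 2)), 0 < p.2 := by
      have h3 : (Set.Ioc 0 ℓ ×ˢ Set.Ioc 0 (r / 2) : Set (ℝ × ℝ)) =ᵐ[volume]
          collarBox ℓ (r / 2) := by
        have : collarBox ℓ (r / 2) = Set.Icc 0 ℓ ×ˢ Set.Icc 0 (r / 2) := by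
          ext p; rw [mem_collarBox]; rfl
        rw [this]
        exact Measure.set_prod_ae_eq Ioc_ae_eq_Icc Ioc_ae_eq_Icc
      rw [← Measure.restrict_congr_set h3]
      filter_upwards [ae_restrict_mem (measurableSet_Ioc.prod measurableSet_Ioc)] with p hp
      exact hp.2.1
    apply integral_congr_ae
    filter_upwards [hae, ae_restrict_mem (measurableSet_collarBox ℓ (r / 2))] with p hp0 hp
    obtain ⟨-, -, hp1⟩ := mem_collarBox.1 hp
    have hps := hQ.planePoint_mem_realStrip hp0.le hp1
    have hpΩ : Q (planePoint p) ∈ Ω := hQ.mem_of_pos _ hps hp0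
    have hc := (hQ.contDiffAt_planeCutoff_of_mem hΩ hpΩ).differentiableAt one_ne_zero
    have hA' := (hA _ (subset_closure hpΩ)).differentiableAt one_ne_zero
    have hB' := (hB _ (subset_closure hpΩ)).differentiableAt one_ne_zero
    rw [hD]
    simp only
    rw [← divergence_piola (A := fun x => χ x * A x) (B := fun x => χ x * B x)
      (hc.fun_mul hA') (hc.fun_mul hB') (hQ.analyticAt hps)]
    have hnear : ∀ᶠ p' in 𝓝 p, planePoint p' ∈ realStrip r :=
      continuous_planePoint.continuousAt.eventually ((isOpen_realStrip r).mem_nhds hps)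
    have hfe : (fun p => χ (Q (planePoint p)) * A (Q (planePoint p)) *
        (deriv Q (planePoint p)).re + χ (Q (planePoint p)) * B (Q (planePoint p)) *
        (deriv Q (planePoint p)).im) =ᶠ[𝓝 p] f := by
      filter_upwards [hnear] with p' hp'
      rw [hχ, hQ.planeCutoff_apply hp']; rfl
    have hge : (fun p => χ (Q (planePoint p)) * B (Q (planePoint p)) *
        (deriv Q (planePoint p)).re - χ (Q (planePoint p)) * A (Q (planePoint p)) *
        (deriv Q (planePoint p)).im) =ᶠ[𝓝 p] g := by
      filter_upwards [hnear] with p' hp'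
      rw [hχ, hQ.planeCutoff_apply hp']; rfl
    unfold derivFst derivSnd
    rw [hfe.fderiv_eq, hge.fderiv_eq]
  have hcut : ∀ p : ℝ × ℝ, ContDiffAt ℝ 1 (fun p : ℝ × ℝ => heightCutoff r p.2) p := fun p =>
    ((contDiff_heightCutoff r).comp contDiff_snd).contDiffAt
  have hmem : ∀ p ∈ collarBox ℓ (r / 2), planePoint p ∈ realStrip r ∧
      Q (planePoint p) ∈ closure Ω := fun p hp => by
    obtain ⟨-, h0, h1⟩ := mem_collarBox.1 hp
    exact ⟨hQ.planePoint_mem_realStrip h0 h1, hQ.planePoint_mem_closure h0 h1⟩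
  have e4 := integral_box_divergence_of_contDiffAt hQ.len_pos (half_pos hr)
    (f := f) (g := g) subset_rfl
    (fun p hp => by
      obtain ⟨h1, h2⟩ := hmem p hp
      obtain ⟨h3, h4⟩ := hQ.contDiffAt_deriv_comp_planePoint h1
      exact (((hcut p).mul (hQ.contDiffAt_comp_planePoint h1 (hA _ h2))).mul h3).add
        (((hcut p).mul (hQ.contDiffAt_comp_planePoint h1 (hB _ h2))).mul h4))
    (fun p hp => by
      obtain ⟨h1, h2⟩ := hmem p hp
      obtain ⟨h3, h4⟩ := hQ.contDiffAt_deriv_comp_planePoint h1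
      exact (((hcut p).mul (hQ.contDiffAt_comp_planePoint h1 (hB _ h2))).mul h3).sub
        (((hcut p).mul (hQ.contDiffAt_comp_planePoint h1 (hA _ h2))).mul h4))
    (fun η hη => by
      have h1 := planePoint_add_fst 0 η ℓ
      rw [zero_add] at h1
      have h2 : planePoint (0, η) ∈ realStrip r := hQ.planePoint_mem_realStrip hη.1 hη.2
      simp only [hf, h1, hQ.periodic _ h2, hQ.deriv_periodic h2])
  rw [e1, e2, e3, e4]
  have g1 : ∀ s, g (s, r / 2) = 0 := fun s => by
    simp [hg, heightCutoff_of_ge hr (show r / 4 ≤ r / 2 by linarith)]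
  have g0 : ∀ s, g (s, 0) = B (Q s) * (deriv Q s).re - A (Q s) * (deriv Q s).im := fun s => by
    simp [hg, heightCutoff_of_le hr (show 0 ≤ r / 8 by linarith), planePoint_zero_snd]
  simp only [g1, g0, intervalIntegral.integral_zero]
  ring

end IsConformalCollar

open Set Filter Topology in
theorem iteratedDeriv_re_comp_ofReal {A : ℂ → ℂ} {r : ℝ} (hr : 0 < r)
    (hA : DifferentiableOn ℂ A (realStrip r)) (k : ℕ) :
    iteratedDeriv k (fun s : ℝ => (A s).re) = fun s : ℝ => (iteratedDeriv k A s).re := by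
  induction k with
  | zero => simp
  | succ k ih =>
    rw [iteratedDeriv_succ, ih]
    funext s
    have h1 : AnalyticAt ℂ (iteratedDeriv k A) s := by
      rw [iteratedDeriv_eq_iterate]
      exact (hA.analyticOnNhd (isOpen_realStrip r)).iterated_deriv k s (ofReal_mem_realStrip hr s)
    rw [iteratedDeriv_succ]
    exact (h1.differentiableAt.hasDerivAt.real_of_complex).deriv

open Set Filter Topology ComplexConjugate in
/-- The squared modulus of a bounded holomorphic function has real-analytic horizontal slices with
uniform bounds on the derivatives. -/
theorem abs_iteratedDeriv_norm_sq_le {g : ℂ → ℂ} {r η M : ℝ} (hr : 0 < r)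
    (hg : DifferentiableOn ℂ g (realStrip r)) (hM : ∀ t ∈ realStrip r, ‖g t‖ ≤ M)
    (hη : |η| ≤ r / 2) (k : ℕ) (s : ℝ) :
    |iteratedDeriv k (fun s : ℝ => ‖g (planePoint (s, η))‖ ^ 2) s| ≤
      k.factorial * M ^ 2 / (r / 4) ^ k := by
  set A : ℂ → ℂ := fun z => g (z + η * Complex.I) * conj (g (conj (z - η * Complex.I))) with hAdef
  have hm1 : ∀ z ∈ realStrip (r / 2), z + η * Complex.I ∈ realStrip r := by
    intro z hz
    have h : |z.im| < r / 2 := hz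
    change |(z + η * Complex.I).im| < r
    have h2 : (z + η * Complex.I).im = z.im + η := by simp
    rw [h2]
    exact (abs_add_le _ _).trans_lt (by linarith)
  have hm2 : ∀ z ∈ realStrip (r / 2), conj (z - η * Complex.I) ∈ realStrip r := by
    intro z hz
    have h : |z.im| < r / 2 := hz
    change |(conj (z - η * Complex.I)).im| < r
    have h2 : (conj (z - η * Complex.I)).im = -z.im + η := by simp
    rw [h2]
    refine (abs_add_le _ _).trans_lt ?_
    rw [abs_neg]; linarith
  have hA : DifferentiableOn ℂ A (realStrip (r / 2)) := by
    intro z hz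
    refine DifferentiableAt.differentiableWithinAt ?_
    have h1 : DifferentiableAt ℂ g (z + η * Complex.I) :=
      hg.differentiableAt ((isOpen_realStrip r).mem_nhds (hm1 z hz))
    have h2 : DifferentiableAt ℂ g (conj (z - η * Complex.I)) :=
      hg.differentiableAt ((isOpen_realStrip r).mem_nhds (hm2 z hz))
    have h3 : DifferentiableAt ℂ (fun w => conj (g (conj w))) (z - η * Complex.I) := by
      have := h2.conj_conj
      simp only [Complex.conj_conj] at this
      exact this
    exact (DifferentiableAt.comp z h1 (differentiableAt_id.add_const _)).mul
      (DifferentiableAt.comp (g := fun w => conj (g (conj w))) z h3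
        (differentiableAt_id.sub_const _))
  have hAM : ∀ z ∈ realStrip (r / 2), ‖A z‖ ≤ M ^ 2 := by
    intro z hz
    have h1 := hM _ (hm1 z hz)
    have h2 := hM _ (hm2 z hz)
    simp only [hAdef, norm_mul, RCLike.norm_conj, sq]
    exact mul_le_mul h1 h2 (norm_nonneg _) ((norm_nonneg _).trans h1)
  have heq : (fun s : ℝ => ‖g (planePoint (s, η))‖ ^ 2) = fun s : ℝ => (A s).re := by
    funext s
    have e1 : planePoint (s, η) = s + η * Complex.I := by apply Complex.ext <;> simp
    have e2 : conj ((s : ℂ) - η * Complex.I) = s + η * Complex.I := by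
      apply Complex.ext <;> simp
    simp only [hAdef]
    rw [e1, e2, Complex.mul_conj, Complex.ofReal_re, Complex.normSq_eq_norm_sq]
  rw [heq, iteratedDeriv_re_comp_ofReal (half_pos hr) hA]
  refine (Complex.abs_re_le_norm _).trans ?_
  have hsub : Metric.closedBall (s : ℂ) (r / 4) ⊆ realStrip (r / 2) := by
    intro z hz
    have h1 : ‖z - s‖ ≤ r / 4 := by simpa [dist_eq_norm] using hz
    have h2 := (Complex.abs_im_le_norm (z - s)).trans h1
    change |z.im| < r / 2
    have h3 : (z - s).im = z.im := by simp
    rw [h3] at h2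
    linarith
  refine Complex.norm_iteratedDeriv_le_of_forall_mem_sphere_norm_le k (by linarith) ?_ ?_
  · exact (hA.mono ((closure_minimal Metric.ball_subset_closedBall
      Metric.isClosed_closedBall).trans hsub)).diffContOnCl
  · exact fun z hz => hAM z (hsub (Metric.sphere_subset_closedBall hz))

namespace IsConformalCollar

variable {Ω : Set ℂ} {Q : ℂ → ℂ} {ℓ r : ℝ}

/-- The coordinate region on which a function on `U` pulls back under a collar map. -/
def _root_.collarRegion (Q : ℂ → ℂ) (r : ℝ) (U : Set ℂ) : Set (ℝ × ℝ) :=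
  {p | planePoint p ∈ realStrip r ∧ Q (planePoint p) ∈ U}

theorem isOpen_collarRegion (hQ : IsConformalCollar Ω Q ℓ r) {U : Set ℂ} (hU : IsOpen U) :
    IsOpen (collarRegion Q r U) := by
  have h := hQ.differentiableOn.continuousOn.isOpen_inter_preimage (isOpen_realStrip r) hU
  exact h.preimage continuous_planePoint

theorem analyticAt_deriv_re (hQ : IsConformalCollar Ω Q ℓ r) {p : ℝ × ℝ}
    (hp : planePoint p ∈ realStrip r) :
    AnalyticAt ℝ (fun p => (deriv Q (planePoint p)).re) p :=
  ((Complex.reCLM.analyticAt _).comp ((hQ.analyticAt hp).deriv.restrictScalars (𝕜 := ℝ))).comp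
    (analyticAt_planePoint p)

theorem analyticAt_deriv_im (hQ : IsConformalCollar Ω Q ℓ r) {p : ℝ × ℝ}
    (hp : planePoint p ∈ realStrip r) :
    AnalyticAt ℝ (fun p => (deriv Q (planePoint p)).im) p :=
  ((Complex.imCLM.analyticAt _).comp ((hQ.analyticAt hp).deriv.restrictScalars (𝕜 := ℝ))).comp
    (analyticAt_planePoint p)

theorem analyticAt_norm_sq_deriv (hQ : IsConformalCollar Ω Q ℓ r) {p : ℝ × ℝ}
    (hp : planePoint p ∈ realStrip r) :
    AnalyticAt ℝ (fun p => ‖deriv Q (planePoint p)‖ ^ 2) p := by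
  have h : (fun p => ‖deriv Q (planePoint p)‖ ^ 2) =
      fun p => (deriv Q (planePoint p)).re ^ 2 + (deriv Q (planePoint p)).im ^ 2 := by
    funext p
    rw [← Complex.normSq_eq_norm_sq, Complex.normSq_apply]; ring
  rw [h]
  exact ((hQ.analyticAt_deriv_re hp).pow 2).add ((hQ.analyticAt_deriv_im hp).pow 2)

theorem abs_iterate_derivFst_norm_sq_deriv_le (hQ : IsConformalCollar Ω Q ℓ r) (j : ℕ)
    (p : ℝ × ℝ) (hp : p ∈ collarBox ℓ (r / 2)) :
    |derivFst^[j] (fun p => ‖deriv Q (planePoint p)‖ ^ 2) p| ≤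
      (4 + 4 / r) ^ (j + 1) * j.factorial := by
  obtain ⟨s, η⟩ := p
  rw [mem_collarBox] at hp
  have hr := hQ.pos
  have hη : |η| ≤ r / 2 := by rw [abs_of_nonneg hp.2.1]; exact hp.2.2
  rw [iterate_derivFst_eq_iteratedDeriv (O := planePoint ⁻¹' realStrip r)
    (fun p hp => hQ.analyticAt_norm_sq_deriv hp)
    (fun s => hQ.planePoint_mem_realStrip hp.2.1 hp.2.2)]
  refine (abs_iteratedDeriv_norm_sq_le hr
    (hQ.differentiableOn.deriv (isOpen_realStrip r)) (M := 2)
    (fun t ht => (hQ.norm_deriv_lt t ht).le) hη j s).trans ?_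
  have h4 : (0 : ℝ) < 4 / r := by positivity
  have h1 : ((r / 4) ^ j)⁻¹ = (4 / r) ^ j := by rw [← inv_pow, inv_div]
  have h2 : (4 / r) ^ j ≤ (4 + 4 / r) ^ j := by gcongr; linarith
  have h3 : (0:ℝ) < j.factorial := by positivity
  have h5 : (4 / r) ^ j * 4 ≤ (4 + 4 / r) ^ j * (4 + 4 / r) :=
    mul_le_mul h2 (by linarith) (by norm_num) (by positivity)
  calc (j.factorial : ℝ) * 2 ^ 2 / (r / 4) ^ j = (4 / r) ^ j * 4 * j.factorial := by
        rw [div_eq_mul_inv, h1]; ring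
    _ ≤ (4 + 4 / r) ^ (j + 1) * j.factorial := by
        rw [pow_succ]; exact mul_le_mul_of_nonneg_right h5 h3.le

end IsConformalCollar

/-- The Laplacian of a function on the complex plane. -/
def planeLap (ψ : ℂ → ℝ) (x : ℂ) : ℝ :=
  fderiv ℝ (fun y => fderiv ℝ ψ y 1) x 1 + fderiv ℝ (fun y => fderiv ℝ ψ y Complex.I) x Complex.I

/-- A Neumann eigenfunction of a planar domain whose boundary is the image of the real line under
`Q`, analytic on the open neighbourhood `U` of the closed domain. -/
structure IsPlaneEigenfunction (Ω U : Set ℂ) (Q : ℂ → ℂ) (lam : ℝ) (ψ : ℂ → ℝ) : Prop where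
  isOpen : IsOpen U
  closure_subset : closure Ω ⊆ U
  analytic : AnalyticOnNhd ℝ ψ U
  eigen : ∀ x ∈ Ω, planeLap ψ x = -lam ^ 2 * ψ x
  neumann : ∀ s : ℝ, fderiv ℝ ψ (Q s) (Complex.I * deriv Q s) = 0

namespace IsPlaneEigenfunction

variable {Ω U : Set ℂ} {Q : ℂ → ℂ} {ℓ r lam : ℝ} {ψ : ℂ → ℝ}

theorem analyticOnNhd_planeLap (hψ : IsPlaneEigenfunction Ω U Q lam ψ) :
    AnalyticOnNhd ℝ (planeLap ψ) U :=
  ((hψ.analytic.fderiv_apply_const 1).fderiv_apply_const 1).add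
    ((hψ.analytic.fderiv_apply_const Complex.I).fderiv_apply_const Complex.I)

theorem eigen_closure (hψ : IsPlaneEigenfunction Ω U Q lam ψ) :
    ∀ x ∈ closure Ω, planeLap ψ x = -lam ^ 2 * ψ x :=
  Set.EqOn.of_subset_closure (f := planeLap ψ) (g := fun x => -lam ^ 2 * ψ x) hψ.eigen
    (hψ.analyticOnNhd_planeLap.continuousOn.mono hψ.closure_subset)
    ((continuousOn_const.mul hψ.analytic.continuousOn).mono hψ.closure_subset)
    subset_closure subset_rfl

theorem integrableOn {g : ℂ → ℝ} (hb : Bornology.IsBounded Ω)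
    (hg : ContinuousOn g (closure Ω)) : IntegrableOn g Ω :=
  (hg.integrableOn_compact hb.isCompact_closure).mono_set subset_closure

/-- The pullback of a function on the plane to collar coordinates. -/
def _root_.collarPullback (Q : ℂ → ℂ) (ψ : ℂ → ℝ) (p : ℝ × ℝ) : ℝ := ψ (Q (planePoint p))

theorem analyticOnNhd_collarPullback (hQ : IsConformalCollar Ω Q ℓ r) {ψ : ℂ → ℝ}
    (hψ : AnalyticOnNhd ℝ ψ U) : AnalyticOnNhd ℝ (collarPullback Q ψ) (collarRegion Q r U) :=
  fun p hp => AnalyticAt.fun_comp (f := fun p => Q (planePoint p)) (hψ _ hp.2)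
    (AnalyticAt.fun_comp (f := planePoint) ((hQ.analyticAt hp.1).restrictScalars (𝕜 := ℝ))
      (analyticAt_planePoint p))

theorem derivFst_collarPullback (hQ : IsConformalCollar Ω Q ℓ r)
    (hψ : AnalyticOnNhd ℝ ψ U) {p : ℝ × ℝ} (hp : p ∈ collarRegion Q r U) :
    derivFst (collarPullback Q ψ) p =
      fderiv ℝ ψ (Q (planePoint p)) 1 * (deriv Q (planePoint p)).re +
        fderiv ℝ ψ (Q (planePoint p)) Complex.I * (deriv Q (planePoint p)).im := by
  refine (derivFst_comp_planePoint (hψ _ hp.2).differentiableAt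
    (hQ.analyticAt hp.1).differentiableAt.hasDerivAt).trans ?_
  rw [fderiv_apply_complex]; ring

theorem derivSnd_collarPullback (hQ : IsConformalCollar Ω Q ℓ r)
    (hψ : AnalyticOnNhd ℝ ψ U) {p : ℝ × ℝ} (hp : p ∈ collarRegion Q r U) :
    derivSnd (collarPullback Q ψ) p =
      fderiv ℝ ψ (Q (planePoint p)) Complex.I * (deriv Q (planePoint p)).re -
        fderiv ℝ ψ (Q (planePoint p)) 1 * (deriv Q (planePoint p)).im := by
  refine (derivSnd_comp_planePoint (hψ _ hp.2).differentiableAt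
    (hQ.analyticAt hp.1).differentiableAt.hasDerivAt).trans ?_
  rw [fderiv_apply_complex]
  simp
  ring

theorem lapProd_collarPullback (hQ : IsConformalCollar Ω Q ℓ r) (hU : IsOpen U)
    (hψ : AnalyticOnNhd ℝ ψ U) {p : ℝ × ℝ} (hp : p ∈ collarRegion Q r U) :
    lapProd (collarPullback Q ψ) p =
      ‖deriv Q (planePoint p)‖ ^ 2 * planeLap ψ (Q (planePoint p)) := by
  have hO := hQ.isOpen_collarRegion hU
  rw [lapProd, derivFst_congr hO (fun p hp => derivFst_collarPullback hQ hψ hp) hp,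
    derivSnd_congr hO (fun p hp => derivSnd_collarPullback hQ hψ hp) hp]
  exact divergence_piola ((hψ.fderiv_apply_const 1) _ hp.2).differentiableAt
    ((hψ.fderiv_apply_const Complex.I) _ hp.2).differentiableAt (hQ.analyticAt hp.1)

theorem mem_collarRegion (hψ : IsPlaneEigenfunction Ω U Q lam ψ)
    (hQ : IsConformalCollar Ω Q ℓ r) {p : ℝ × ℝ} (h0 : 0 ≤ p.2) (h1 : p.2 ≤ r / 2) :
    p ∈ collarRegion Q r U :=
  ⟨hQ.planePoint_mem_realStrip h0 h1, hψ.closure_subset (hQ.planePoint_mem_closure h0 h1)⟩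

theorem isCollarFunction (hψ : IsPlaneEigenfunction Ω U Q lam ψ)
    (hQ : IsConformalCollar Ω Q ℓ r) :
    IsCollarFunction (collarRegion Q r U) ℓ (r / 2) (collarPullback Q ψ) where
  isOpen := hQ.isOpen_collarRegion hψ.isOpen
  len_pos := hQ.len_pos
  height_pos := half_pos hQ.pos
  mem := fun s η hη => hψ.mem_collarRegion hQ (p := (s, η)) hη.1 hη.2
  analytic := analyticOnNhd_collarPullback hQ hψ.analytic
  periodic := fun s η hη => by
    simp only [collarPullback]
    rw [planePoint_add_fst, hQ.periodic _ (hQ.planePoint_mem_realStrip (p := (s, η)) hη.1 hη.2)]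
  neumann := fun s => by
    have hm := hψ.mem_collarRegion hQ (p := (s, 0)) le_rfl (half_pos hQ.pos).le
    refine (derivSnd_comp_planePoint (hψ.analytic _ hm.2).differentiableAt
      (hQ.analyticAt hm.1).differentiableAt.hasDerivAt).trans ?_
    exact hψ.neumann s

theorem lapProd_eq (hψ : IsPlaneEigenfunction Ω U Q lam ψ) (hQ : IsConformalCollar Ω Q ℓ r) :
    ∀ s, ∀ η ∈ Set.Icc 0 (r / 2), lapProd (collarPullback Q ψ) (s, η) =
      -lam ^ 2 * (‖deriv Q (planePoint (s, η))‖ ^ 2 * collarPullback Q ψ (s, η)) := by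
  intro s η hη
  rw [lapProd_collarPullback hQ hψ.isOpen hψ.analytic
    (hψ.mem_collarRegion hQ (p := (s, η)) hη.1 hη.2),
    hψ.eigen_closure _ (hQ.planePoint_mem_closure (p := (s, η)) hη.1 hη.2), collarPullback]
  ring

/-- Integrals over the collar are bounded by integrals over the domain. -/
theorem setIntegral_collarBox_le (hb : Bornology.IsBounded Ω)
    (hQ : IsConformalCollar Ω Q ℓ r) {D : ℂ → ℝ} (hD : ContinuousOn D (closure Ω))
    (hD0 : ∀ x, 0 ≤ D x) :
    ∫ p in collarBox ℓ (r / 2), ‖deriv Q (planePoint p)‖ ^ 2 * D (Q (planePoint p)) ≤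
      ∫ x in Ω, D x := by
  rw [← hQ.setIntegral_image (by linarith [hQ.pos])]
  exact setIntegral_mono_set (integrableOn hb hD) (Filter.Eventually.of_forall hD0)
    hQ.image_collarRect_subset.eventuallyLE

theorem continuousOn_planePoint_comp (hQ : IsConformalCollar Ω Q ℓ r) {D : ℂ → ℝ}
    (hD : ContinuousOn D (closure Ω)) :
    ContinuousOn (fun p => D (Q (planePoint p))) (collarBox ℓ (r / 2)) := by
  refine hD.comp (hQ.differentiableOn.continuousOn.comp continuous_planePoint.continuousOn ?_) ?_
  · exact fun p hp => hQ.planePoint_mem_realStrip (mem_collarBox.mp hp).2.1 (mem_collarBox.mp hp).2.2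
  · exact fun p hp => hQ.planePoint_mem_closure (mem_collarBox.mp hp).2.1 (mem_collarBox.mp hp).2.2

theorem continuousOn_norm_sq_deriv (hQ : IsConformalCollar Ω Q ℓ r) :
    ContinuousOn (fun p => ‖deriv Q (planePoint p)‖ ^ 2) (collarBox ℓ (r / 2)) := fun _ hp =>
  (hQ.analyticAt_norm_sq_deriv (hQ.planePoint_mem_realStrip (mem_collarBox.mp hp).2.1
    (mem_collarBox.mp hp).2.2)).continuousAt.continuousWithinAt

theorem collarNorm_sq_le (hψ : IsPlaneEigenfunction Ω U Q lam ψ) (hb : Bornology.IsBounded Ω)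
    (hQ : IsConformalCollar Ω Q ℓ r) :
    collarNorm ℓ (r / 2) (collarPullback Q ψ) ^ 2 ≤ 4 * ∫ x in Ω, ψ x ^ 2 := by
  have hc : ContinuousOn (fun x => ψ x ^ 2) (closure Ω) :=
    (hψ.analytic.continuousOn.mono hψ.closure_subset).pow 2
  have hcp := continuousOn_planePoint_comp hQ hc
  have hcd := continuousOn_norm_sq_deriv hQ
  refine le_trans ?_ (mul_le_mul_of_nonneg_left
    (setIntegral_collarBox_le hb hQ hc fun _ => sq_nonneg _) (by norm_num))
  rw [collarNorm_sq, ← integral_const_mul]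
  refine setIntegral_mono_on (hcp.integrableOn_compact (isCompact_collarBox _ _))
    ((continuousOn_const.mul (hcd.mul hcp)).integrableOn_compact (isCompact_collarBox _ _))
    (measurableSet_collarBox _ _) fun p hp => ?_
  have h1 := hQ.lt_norm_deriv _
    (hQ.planePoint_mem_realStrip (mem_collarBox.mp hp).2.1 (mem_collarBox.mp hp).2.2)
  simp only [collarPullback]
  nlinarith [sq_nonneg (ψ (Q (planePoint p))),
    mul_nonneg (sq_nonneg (ψ (Q (planePoint p))))
      (show 0 ≤ ‖deriv Q (planePoint p)‖ ^ 2 - 1 / 4 by nlinarith)]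

/-- The squared length of the gradient. -/
def _root_.gradSq (ψ : ℂ → ℝ) (x : ℂ) : ℝ := fderiv ℝ ψ x 1 ^ 2 + fderiv ℝ ψ x Complex.I ^ 2

theorem continuousOn_gradSq (hψ : IsPlaneEigenfunction Ω U Q lam ψ) :
    ContinuousOn (gradSq ψ) (closure Ω) :=
  (((hψ.analytic.fderiv_apply_const 1).pow 2).add
    ((hψ.analytic.fderiv_apply_const Complex.I).pow 2)).continuousOn.mono hψ.closure_subset

theorem collarNorm_derivFst_sq_le (hψ : IsPlaneEigenfunction Ω U Q lam ψ)
    (hb : Bornology.IsBounded Ω) (hQ : IsConformalCollar Ω Q ℓ r) :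
    collarNorm ℓ (r / 2) (derivFst (collarPullback Q ψ)) ^ 2 ≤ ∫ x in Ω, gradSq ψ x := by
  have hc := hψ.continuousOn_gradSq
  have hcp := continuousOn_planePoint_comp hQ hc
  have hcd := continuousOn_norm_sq_deriv hQ
  refine le_trans ?_ (setIntegral_collarBox_le hb hQ hc fun _ => by unfold gradSq; positivity)
  rw [collarNorm_sq]
  have hV := hψ.isCollarFunction hQ
  refine setIntegral_mono_on
    (((hV.analytic.derivFst.pow 2).continuousOn.mono hV.box_subset).integrableOn_compact
      (isCompact_collarBox _ _))
    ((hcd.mul hcp).integrableOn_compact (isCompact_collarBox _ _))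
    (measurableSet_collarBox _ _) fun p hp => ?_
  rw [derivFst_collarPullback hQ hψ.analytic (hV.box_subset hp), gradSq,
    ← Complex.normSq_eq_norm_sq, Complex.normSq_apply]
  set a := fderiv ℝ ψ (Q (planePoint p)) 1
  set b := fderiv ℝ ψ (Q (planePoint p)) Complex.I
  set c := (deriv Q (planePoint p)).re
  set d := (deriv Q (planePoint p)).im
  nlinarith [sq_nonneg (a * d - b * c)]

end IsPlaneEigenfunction

theorem fderiv_mul_apply {f g : ℂ → ℝ} {x : ℂ} (hf : DifferentiableAt ℝ f x)
    (hg : DifferentiableAt ℝ g x) (v : ℂ) :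
    fderiv ℝ (fun y => f y * g y) x v = f x * fderiv ℝ g x v + g x * fderiv ℝ f x v := by
  rw [fderiv_fun_mul hf hg]; simp

theorem fderiv_add_apply {f g : ℂ → ℝ} {x : ℂ} (hf : DifferentiableAt ℝ f x)
    (hg : DifferentiableAt ℝ g x) (v : ℂ) :
    fderiv ℝ (fun y => f y + g y) x v = fderiv ℝ f x v + fderiv ℝ g x v := by
  rw [fderiv_fun_add hf hg]; simp

theorem fderiv_sub_apply {f g : ℂ → ℝ} {x : ℂ} (hf : DifferentiableAt ℝ f x)
    (hg : DifferentiableAt ℝ g x) (v : ℂ) :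
    fderiv ℝ (fun y => f y - g y) x v = fderiv ℝ f x v - fderiv ℝ g x v := by
  rw [fderiv_fun_sub hf hg]; simp

theorem fderiv_re_apply (x v : ℂ) : fderiv ℝ (fun y : ℂ => y.re) x v = v.re := by
  have : HasFDerivAt (fun y : ℂ => y.re) Complex.reCLM x := Complex.reCLM.hasFDerivAt
  rw [this.fderiv]; rfl

theorem fderiv_im_apply (x v : ℂ) : fderiv ℝ (fun y : ℂ => y.im) x v = v.im := by
  have : HasFDerivAt (fun y : ℂ => y.im) Complex.imCLM x := Complex.imCLM.hasFDerivAt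
  rw [this.fderiv]; rfl

theorem analyticAt_re (x : ℂ) : AnalyticAt ℝ (fun y : ℂ => y.re) x := Complex.reCLM.analyticAt x

theorem analyticAt_im (x : ℂ) : AnalyticAt ℝ (fun y : ℂ => y.im) x := Complex.imCLM.analyticAt x

/-- The radial derivative of a function on the plane. -/
def radialDeriv (ψ : ℂ → ℝ) (x : ℂ) : ℝ :=
  x.re * fderiv ℝ ψ x 1 + x.im * fderiv ℝ ψ x Complex.I

/-- The divergence of `ψ ∇ψ`. -/
theorem divergence_mul_grad {ψ : ℂ → ℝ} {x : ℂ} (hψ : AnalyticAt ℝ ψ x) :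
    fderiv ℝ (fun y => ψ y * fderiv ℝ ψ y 1) x 1 +
      fderiv ℝ (fun y => ψ y * fderiv ℝ ψ y Complex.I) x Complex.I =
      gradSq ψ x + ψ x * planeLap ψ x := by
  have h : ∀ v, DifferentiableAt ℝ (fun y => fderiv ℝ ψ y v) x := fun v =>
    (((ContinuousLinearMap.apply ℝ ℝ v).analyticAt _).comp hψ.fderiv).differentiableAt
  rw [fderiv_mul_apply hψ.differentiableAt (h _), fderiv_mul_apply hψ.differentiableAt (h _),
    gradSq, planeLap]
  ring

/-- The divergence of `ψ² x`. -/
theorem divergence_sq_mul_id {ψ : ℂ → ℝ} {x : ℂ} (hψ : AnalyticAt ℝ ψ x) :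
    fderiv ℝ (fun y => ψ y * ψ y * y.re) x 1 + fderiv ℝ (fun y => ψ y * ψ y * y.im) x Complex.I =
      2 * ψ x ^ 2 + 2 * (ψ x * radialDeriv ψ x) := by
  have h := hψ.differentiableAt
  have hr := (analyticAt_re x).differentiableAt
  have hi := (analyticAt_im x).differentiableAt
  rw [fderiv_mul_apply (h.fun_mul h) hr, fderiv_mul_apply (h.fun_mul h) hi, fderiv_mul_apply h h,
    fderiv_mul_apply h h, fderiv_re_apply, fderiv_im_apply, radialDeriv, Complex.one_re,
    Complex.I_im]
  ring

/-- The divergence of the Rellich field `2 (x·∇ψ) ∇ψ + (c ψ² - |∇ψ|²) x`. -/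
theorem divergence_rellich {ψ : ℂ → ℝ} {x : ℂ} (hψ : AnalyticAt ℝ ψ x) (c : ℝ) :
    fderiv ℝ (fun y => 2 * radialDeriv ψ y * fderiv ℝ ψ y 1 +
        (c * (ψ y * ψ y) - gradSq ψ y) * y.re) x 1 +
      fderiv ℝ (fun y => 2 * radialDeriv ψ y * fderiv ℝ ψ y Complex.I +
        (c * (ψ y * ψ y) - gradSq ψ y) * y.im) x Complex.I =
      2 * c * ψ x ^ 2 + 2 * radialDeriv ψ x * (planeLap ψ x + c * ψ x) := by
  have h := hψ.differentiableAt
  have hr := (analyticAt_re x).differentiableAt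
  have hi := (analyticAt_im x).differentiableAt
  have hd : ∀ v, DifferentiableAt ℝ (fun y => fderiv ℝ ψ y v) x := fun v =>
    (((ContinuousLinearMap.apply ℝ ℝ v).analyticAt _).comp hψ.fderiv).differentiableAt
  have hE : DifferentiableAt ℝ (radialDeriv ψ) x :=
    (hr.fun_mul (hd 1)).fun_add (hi.fun_mul (hd Complex.I))
  have hG : DifferentiableAt ℝ (gradSq ψ) x :=
    ((hd 1).fun_pow 2).fun_add ((hd Complex.I).fun_pow 2)
  have hE2 : DifferentiableAt ℝ (fun y => 2 * radialDeriv ψ y) x := hE.const_mul 2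
  have hP : DifferentiableAt ℝ (fun y => c * (ψ y * ψ y)) x := (h.fun_mul h).const_mul c
  have hPG := hP.fun_sub hG
  have eE : ∀ v, fderiv ℝ (radialDeriv ψ) x v =
      x.re * fderiv ℝ (fun y => fderiv ℝ ψ y 1) x v + fderiv ℝ ψ x 1 * v.re +
        (x.im * fderiv ℝ (fun y => fderiv ℝ ψ y Complex.I) x v +
          fderiv ℝ ψ x Complex.I * v.im) := fun v => by
    have : radialDeriv ψ = fun y => y.re * fderiv ℝ ψ y 1 + y.im * fderiv ℝ ψ y Complex.I := rfl
    rw [this, fderiv_add_apply (hr.fun_mul (hd 1)) (hi.fun_mul (hd _)), fderiv_mul_apply hr (hd _),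
      fderiv_mul_apply hi (hd _), fderiv_re_apply, fderiv_im_apply]
  have eE2 : ∀ v, fderiv ℝ (fun y => 2 * radialDeriv ψ y) x v = 2 * fderiv ℝ (radialDeriv ψ) x v :=
    fun v => by rw [fderiv_const_mul hE]; simp
  have eG : ∀ v, fderiv ℝ (gradSq ψ) x v =
      2 * fderiv ℝ ψ x 1 * fderiv ℝ (fun y => fderiv ℝ ψ y 1) x v +
        2 * fderiv ℝ ψ x Complex.I * fderiv ℝ (fun y => fderiv ℝ ψ y Complex.I) x v := fun v => by
    have : gradSq ψ = fun y => fderiv ℝ ψ y 1 * fderiv ℝ ψ y 1 +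
        fderiv ℝ ψ y Complex.I * fderiv ℝ ψ y Complex.I := by
      funext y; simp [gradSq, sq]
    rw [this, fderiv_add_apply ((hd _).fun_mul (hd _)) ((hd _).fun_mul (hd _)),
      fderiv_mul_apply (hd _) (hd _), fderiv_mul_apply (hd _) (hd _)]
    ring
  have eP : ∀ v, fderiv ℝ (fun y => c * (ψ y * ψ y)) x v = 2 * c * ψ x * fderiv ℝ ψ x v :=
    fun v => by
      rw [fderiv_const_mul (h.fun_mul h)]
      simp only [FunLike.coe_smul, Pi.smul_apply, smul_eq_mul]
      rw [fderiv_mul_apply h h]; ring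
  have hcomm := hψ.fderiv_fderiv_comm 1 Complex.I
  rw [fderiv_add_apply (hE2.fun_mul (hd _)) (hPG.fun_mul hr),
    fderiv_add_apply (hE2.fun_mul (hd _)) (hPG.fun_mul hi), fderiv_mul_apply hE2 (hd _),
    fderiv_mul_apply hE2 (hd _), fderiv_mul_apply hPG hr, fderiv_mul_apply hPG hi,
    fderiv_sub_apply hP hG, fderiv_sub_apply hP hG, eE2, eE2, eE, eE, eG, eG, eP, eP,
    fderiv_re_apply, fderiv_im_apply, planeLap, hcomm]
  simp only [Complex.one_re, Complex.one_im, Complex.I_re, Complex.I_im, gradSq, radialDeriv]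
  ring

namespace IsPlaneEigenfunction

variable {Ω U : Set ℂ} {Q : ℂ → ℂ} {ℓ r lam : ℝ} {ψ : ℂ → ℝ}

theorem neumann_coord (hψ : IsPlaneEigenfunction Ω U Q lam ψ) (s : ℝ) :
    fderiv ℝ ψ (Q s) Complex.I * (deriv Q s).re - fderiv ℝ ψ (Q s) 1 * (deriv Q s).im = 0 := by
  have h := hψ.neumann s
  rw [fderiv_apply_complex] at h
  simp at h
  linarith

theorem contDiffAt {g : ℂ → ℝ} (hψ : IsPlaneEigenfunction Ω U Q lam ψ)
    (hg : AnalyticOnNhd ℝ g U) : ∀ x ∈ closure Ω, ContDiffAt ℝ 1 g x :=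
  fun x hx => (hg x (hψ.closure_subset hx)).contDiffAt

theorem integral_gradSq (hψ : IsPlaneEigenfunction Ω U Q lam ψ) (hΩ : IsOpen Ω)
    (hb : Bornology.IsBounded Ω) (hQ : IsConformalCollar Ω Q ℓ r) :
    ∫ x in Ω, gradSq ψ x = lam ^ 2 * ∫ x in Ω, ψ x ^ 2 := by
  have hA : AnalyticOnNhd ℝ (fun y => ψ y * fderiv ℝ ψ y 1) U :=
    hψ.analytic.mul (hψ.analytic.fderiv_apply_const 1)
  have hB : AnalyticOnNhd ℝ (fun y => ψ y * fderiv ℝ ψ y Complex.I) U :=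
    hψ.analytic.mul (hψ.analytic.fderiv_apply_const Complex.I)
  have h := hQ.setIntegral_divergence hΩ hb (hψ.contDiffAt hA) (hψ.contDiffAt hB)
  have e1 : ∀ s : ℝ, ψ (Q s) * fderiv ℝ ψ (Q s) Complex.I * (deriv Q s).re -
      ψ (Q s) * fderiv ℝ ψ (Q s) 1 * (deriv Q s).im = 0 := fun s => by
    linear_combination ψ (Q s) * hψ.neumann_coord s
  simp only [e1, intervalIntegral.integral_zero, neg_zero] at h
  have hc : ContinuousOn (fun x => ψ x ^ 2) (closure Ω) :=
    (hψ.analytic.continuousOn.mono hψ.closure_subset).pow 2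
  have e2 : ∫ x in Ω, (gradSq ψ x - lam ^ 2 * ψ x ^ 2) = 0 := by
    rw [← h]
    refine setIntegral_congr_fun hΩ.measurableSet fun x hx => ?_
    refine Eq.trans ?_ (divergence_mul_grad (hψ.analytic x (hψ.closure_subset
      (subset_closure hx)))).symm
    rw [hψ.eigen x hx]; ring
  rw [integral_sub (integrableOn hb hψ.continuousOn_gradSq)
    ((integrableOn hb hc).const_mul _), integral_const_mul] at e2
  linarith

theorem radialDeriv_analytic (hψ : AnalyticOnNhd ℝ ψ U) : AnalyticOnNhd ℝ (radialDeriv ψ) U :=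
  fun x hx => ((analyticAt_re x).mul (hψ.fderiv_apply_const 1 x hx)).add
    ((analyticAt_im x).mul (hψ.fderiv_apply_const Complex.I x hx))

theorem gradSq_analytic (hψ : AnalyticOnNhd ℝ ψ U) : AnalyticOnNhd ℝ (gradSq ψ) U :=
  ((hψ.fderiv_apply_const 1).pow 2).add ((hψ.fderiv_apply_const Complex.I).pow 2)

theorem integral_radial (hψ : IsPlaneEigenfunction Ω U Q lam ψ) (hΩ : IsOpen Ω)
    (hb : Bornology.IsBounded Ω) (hQ : IsConformalCollar Ω Q ℓ r) :
    2 * (∫ x in Ω, ψ x ^ 2) + 2 * ∫ x in Ω, ψ x * radialDeriv ψ x =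
      -∫ s in (0 : ℝ)..ℓ, ψ (Q s) ^ 2 *
        ((Q s).im * (deriv Q s).re - (Q s).re * (deriv Q s).im) := by
  have hA : AnalyticOnNhd ℝ (fun y => ψ y * ψ y * y.re) U := fun x hx =>
    ((hψ.analytic x hx).mul (hψ.analytic x hx)).mul (analyticAt_re x)
  have hB : AnalyticOnNhd ℝ (fun y => ψ y * ψ y * y.im) U := fun x hx =>
    ((hψ.analytic x hx).mul (hψ.analytic x hx)).mul (analyticAt_im x)
  have h := hQ.setIntegral_divergence hΩ hb (hψ.contDiffAt hA) (hψ.contDiffAt hB)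
  have hc := hψ.analytic.continuousOn.mono hψ.closure_subset
  have hE := (radialDeriv_analytic hψ.analytic).continuousOn.mono hψ.closure_subset
  have e : ∀ s : ℝ, ψ (Q s) ^ 2 * ((Q s).im * (deriv Q s).re - (Q s).re * (deriv Q s).im) =
      ψ (Q s) * ψ (Q s) * (Q s).im * (deriv Q s).re -
        ψ (Q s) * ψ (Q s) * (Q s).re * (deriv Q s).im := fun s => by ring
  simp only [e]
  have i1 : IntegrableOn (fun x => 2 * ψ x ^ 2) Ω := (integrableOn hb (hc.pow 2)).const_mul 2
  have i2 : IntegrableOn (fun x => 2 * (ψ x * radialDeriv ψ x)) Ω :=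
    (integrableOn hb (hc.mul hE)).const_mul 2
  rw [← h, ← integral_const_mul, ← integral_const_mul, ← integral_add i1 i2]
  refine setIntegral_congr_fun hΩ.measurableSet fun x hx => ?_
  exact (divergence_sq_mul_id (hψ.analytic x (hψ.closure_subset (subset_closure hx)))).symm

theorem integral_rellich (hψ : IsPlaneEigenfunction Ω U Q lam ψ) (hΩ : IsOpen Ω)
    (hb : Bornology.IsBounded Ω) (hQ : IsConformalCollar Ω Q ℓ r) :
    2 * lam ^ 2 * (∫ x in Ω, ψ x ^ 2) =
      -∫ s in (0 : ℝ)..ℓ, (lam ^ 2 * ψ (Q s) ^ 2 - gradSq ψ (Q s)) *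
        ((Q s).im * (deriv Q s).re - (Q s).re * (deriv Q s).im) := by
  have hA : AnalyticOnNhd ℝ (fun y => 2 * radialDeriv ψ y * fderiv ℝ ψ y 1 +
      (lam ^ 2 * (ψ y * ψ y) - gradSq ψ y) * y.re) U := fun x hx =>
    ((analyticAt_const.mul (radialDeriv_analytic hψ.analytic x hx)).mul
      (hψ.analytic.fderiv_apply_const 1 x hx)).add
      (((analyticAt_const.mul ((hψ.analytic x hx).mul (hψ.analytic x hx))).sub
        (gradSq_analytic hψ.analytic x hx)).mul (analyticAt_re x))
  have hB : AnalyticOnNhd ℝ (fun y => 2 * radialDeriv ψ y * fderiv ℝ ψ y Complex.I +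
      (lam ^ 2 * (ψ y * ψ y) - gradSq ψ y) * y.im) U := fun x hx =>
    ((analyticAt_const.mul (radialDeriv_analytic hψ.analytic x hx)).mul
      (hψ.analytic.fderiv_apply_const Complex.I x hx)).add
      (((analyticAt_const.mul ((hψ.analytic x hx).mul (hψ.analytic x hx))).sub
        (gradSq_analytic hψ.analytic x hx)).mul (analyticAt_im x))
  have h := hQ.setIntegral_divergence hΩ hb (hψ.contDiffAt hA) (hψ.contDiffAt hB)
  have e : ∀ s : ℝ, (lam ^ 2 * ψ (Q s) ^ 2 - gradSq ψ (Q s)) *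
        ((Q s).im * (deriv Q s).re - (Q s).re * (deriv Q s).im) =
      (2 * radialDeriv ψ (Q s) * fderiv ℝ ψ (Q s) Complex.I +
        (lam ^ 2 * (ψ (Q s) * ψ (Q s)) - gradSq ψ (Q s)) * (Q s).im) * (deriv Q s).re -
      (2 * radialDeriv ψ (Q s) * fderiv ℝ ψ (Q s) 1 +
        (lam ^ 2 * (ψ (Q s) * ψ (Q s)) - gradSq ψ (Q s)) * (Q s).re) * (deriv Q s).im :=
    fun s => by linear_combination -2 * radialDeriv ψ (Q s) * hψ.neumann_coord s
  simp only [e]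
  rw [← h, ← integral_const_mul]
  refine setIntegral_congr_fun hΩ.measurableSet fun x hx => ?_
  refine Eq.trans ?_ (divergence_rellich (hψ.analytic x (hψ.closure_subset
    (subset_closure hx))) (lam ^ 2)).symm
  rw [hψ.eigen x hx]; ring

end IsPlaneEigenfunction

namespace IsPlaneEigenfunction

variable {Ω U : Set ℂ} {Q : ℂ → ℂ} {ℓ r lam : ℝ} {ψ : ℂ → ℝ}

theorem mem_collarRegion_zero (hψ : IsPlaneEigenfunction Ω U Q lam ψ)
    (hQ : IsConformalCollar Ω Q ℓ r) (s : ℝ) : (s, (0 : ℝ)) ∈ collarRegion Q r U :=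
  hψ.mem_collarRegion hQ (p := (s, 0)) le_rfl (half_pos hQ.pos).le

theorem hasDerivAt_trace (hψ : IsPlaneEigenfunction Ω U Q lam ψ)
    (hQ : IsConformalCollar Ω Q ℓ r) (s : ℝ) :
    HasDerivAt (fun u : ℝ => ψ (Q u)) (derivFst (collarPullback Q ψ) (s, 0)) s :=
  (analyticOnNhd_collarPullback hQ hψ.analytic (s, 0)
    (hψ.mem_collarRegion_zero hQ s)).hasDerivAt_slice_fst

theorem continuous_trace (hψ : IsPlaneEigenfunction Ω U Q lam ψ)
    (hQ : IsConformalCollar Ω Q ℓ r) : Continuous (fun u : ℝ => ψ (Q u)) :=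
  continuous_iff_continuousAt.mpr fun s => (hψ.hasDerivAt_trace hQ s).continuousAt

theorem continuous_trace_deriv (hψ : IsPlaneEigenfunction Ω U Q lam ψ)
    (hQ : IsConformalCollar Ω Q ℓ r) :
    Continuous (fun s : ℝ => derivFst (collarPullback Q ψ) (s, 0)) := by
  have := ((analyticOnNhd_collarPullback hQ hψ.analytic).derivFst.slice_fst
    (hψ.mem_collarRegion_zero hQ)).continuousOn
  rwa [← continuousOn_univ]

theorem gradSq_boundary (hψ : IsPlaneEigenfunction Ω U Q lam ψ)
    (hQ : IsConformalCollar Ω Q ℓ r) (h1 : ∀ s : ℝ, ‖deriv Q s‖ = 1) (s : ℝ) :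
    gradSq ψ (Q s) = derivFst (collarPullback Q ψ) (s, 0) ^ 2 := by
  rw [derivFst_collarPullback hQ hψ.analytic (hψ.mem_collarRegion_zero hQ s), planePoint_zero_snd,
    gradSq]
  have h2 : (deriv Q s).re ^ 2 + (deriv Q s).im ^ 2 = 1 := by
    have := Complex.normSq_eq_norm_sq (deriv Q s)
    rw [h1, Complex.normSq_apply] at this
    linarith
  have h3 := hψ.neumann_coord s
  set a := fderiv ℝ ψ (Q s) 1
  set b := fderiv ℝ ψ (Q s) Complex.I
  set c := (deriv Q s).re
  set d := (deriv Q s).im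
  linear_combination (-(a ^ 2 + b ^ 2)) * h2 + (b * c - a * d) * h3

theorem _root_.IsConformalCollar.abs_support_le (hQ : IsConformalCollar Ω Q ℓ r) {R : ℝ}
    (hR : ∀ x ∈ closure Ω, ‖x‖ ≤ R) (h1 : ∀ s : ℝ, ‖deriv Q s‖ = 1) (s : ℝ) :
    |(Q s).im * (deriv Q s).re - (Q s).re * (deriv Q s).im| ≤ R := by
  have h2 : (Q s).im * (deriv Q s).re - (Q s).re * (deriv Q s).im =
      (Q s * (starRingEnd ℂ) (deriv Q s)).im := by simp; ring
  rw [h2]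
  refine (Complex.abs_im_le_norm _).trans ?_
  rw [norm_mul, RCLike.norm_conj, h1, mul_one]
  exact hR _ (frontier_subset_closure (hQ.real_mem_frontier s))

theorem _root_.IsConformalCollar.continuous_support (hQ : IsConformalCollar Ω Q ℓ r) :
    Continuous fun s : ℝ => (Q s).im * (deriv Q s).re - (Q s).re * (deriv Q s).im := by
  have hm : ∀ s : ℝ, (s : ℂ) ∈ realStrip r := ofReal_mem_realStrip hQ.pos
  have c1 : Continuous fun s : ℝ => Q s := continuousOn_univ.mp
    (hQ.differentiableOn.continuousOn.comp Complex.continuous_ofReal.continuousOn fun s _ => hm s)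
  have c2 : Continuous fun s : ℝ => deriv Q s := continuousOn_univ.mp
    ((hQ.differentiableOn.deriv (isOpen_realStrip r)).continuousOn.comp
      Complex.continuous_ofReal.continuousOn fun s _ => hm s)
  have c3 := Complex.continuous_re.comp c1
  have c4 := Complex.continuous_im.comp c1
  have c5 := Complex.continuous_re.comp c2
  have c6 := Complex.continuous_im.comp c2
  exact (c4.mul c5).sub (c3.mul c6)

/-- A bound of the interior mass by the boundary mass, useful at low frequency. -/
theorem mass_le_of_radial (hψ : IsPlaneEigenfunction Ω U Q lam ψ) (hΩ : IsOpen Ω)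
    (hb : Bornology.IsBounded Ω) (hQ : IsConformalCollar Ω Q ℓ r) (hlam : 0 < lam) {R : ℝ}
    (hR0 : 0 ≤ R) (hR : ∀ x ∈ closure Ω, ‖x‖ ≤ R) (h1 : ∀ s : ℝ, ‖deriv Q s‖ = 1) :
    (2 - 2 * R * lam) * (∫ x in Ω, ψ x ^ 2) ≤ R * ∫ s in (0 : ℝ)..ℓ, ψ (Q s) ^ 2 := by
  have hI := hψ.integral_radial hΩ hb hQ
  have hG := hψ.integral_gradSq hΩ hb hQ
  have hc := hψ.analytic.continuousOn.mono hψ.closure_subset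
  have hE := (radialDeriv_analytic hψ.analytic).continuousOn.mono hψ.closure_subset
  have i1 : IntegrableOn (fun x => R * lam * ψ x ^ 2) Ω :=
    (integrableOn hb (hc.pow 2)).const_mul _
  have i2 : IntegrableOn (fun x => R / lam * gradSq ψ x) Ω :=
    (integrableOn hb hψ.continuousOn_gradSq).const_mul _
  have i3 : IntegrableOn (fun x => -2 * (ψ x * radialDeriv ψ x)) Ω :=
    (integrableOn hb (hc.mul hE)).const_mul _
  have hintegrable : -2 * ∫ x in Ω, ψ x * radialDeriv ψ x ≤ 2 * R * lam * ∫ x in Ω, ψ x ^ 2 := by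
    have : ∫ x in Ω, (R * lam * ψ x ^ 2 + R / lam * gradSq ψ x) =
        2 * R * lam * ∫ x in Ω, ψ x ^ 2 := by
      rw [integral_add i1 i2, integral_const_mul, integral_const_mul, hG]
      field_simp; ring
    rw [← this, ← integral_const_mul]
    refine setIntegral_mono_on i3 (i1.add i2) hΩ.measurableSet fun x hx => ?_
    have hx2 : x.re ^ 2 + x.im ^ 2 ≤ R ^ 2 := by
      have h2 := Complex.normSq_eq_norm_sq x
      rw [Complex.normSq_apply] at h2
      have h3 := pow_le_pow_left₀ (norm_nonneg x) (hR x (subset_closure hx)) 2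
      nlinarith
    have hE2 : radialDeriv ψ x ^ 2 ≤ R ^ 2 * gradSq ψ x := by
      have h4 : 0 ≤ gradSq ψ x := by unfold gradSq; positivity
      have h5 : radialDeriv ψ x ^ 2 ≤ (x.re ^ 2 + x.im ^ 2) * gradSq ψ x := by
        unfold radialDeriv gradSq
        nlinarith [sq_nonneg (x.re * fderiv ℝ ψ x Complex.I - x.im * fderiv ℝ ψ x 1)]
      exact h5.trans (mul_le_mul_of_nonneg_right hx2 h4)
    have h4 : 0 ≤ gradSq ψ x := by unfold gradSq; positivity
    have h6 : |radialDeriv ψ x| ≤ R * √(gradSq ψ x) := by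
      apply abs_le_of_sq_le_sq _ (by positivity)
      rw [mul_pow, Real.sq_sqrt h4]; exact hE2
    have h7 : -2 * (ψ x * radialDeriv ψ x) ≤ 2 * |ψ x| * (R * √(gradSq ψ x)) := by
      have h8 := neg_abs_le (ψ x * radialDeriv ψ x)
      rw [abs_mul] at h8
      nlinarith [mul_le_mul_of_nonneg_left h6 (abs_nonneg (ψ x))]
    refine h7.trans ?_
    have h9 : √(gradSq ψ x) ^ 2 = gradSq ψ x := Real.sq_sqrt h4
    have h10 : R * lam * ψ x ^ 2 + R / lam * gradSq ψ x - 2 * |ψ x| * (R * √(gradSq ψ x)) =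
        R / lam * (lam * |ψ x| - √(gradSq ψ x)) ^ 2 := by
      rw [← sq_abs (ψ x)]
      field_simp
      linear_combination -R * h9
    have h11 : 0 ≤ R / lam * (lam * |ψ x| - √(gradSq ψ x)) ^ 2 := by positivity
    linarith
  have hct := hψ.continuous_trace hQ
  have hcs := hQ.continuous_support
  have hbd : -∫ s in (0 : ℝ)..ℓ, ψ (Q s) ^ 2 *
        ((Q s).im * (deriv Q s).re - (Q s).re * (deriv Q s).im) ≤
      R * ∫ s in (0 : ℝ)..ℓ, ψ (Q s) ^ 2 := by
    rw [← intervalIntegral.integral_neg, ← intervalIntegral.integral_const_mul]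
    refine intervalIntegral.integral_mono_on hQ.len_pos.le
      (((hct.pow 2).mul hcs).neg.intervalIntegrable _ _)
      ((continuous_const.mul (hct.pow 2)).intervalIntegrable _ _) fun s _ => ?_
    have h3 := neg_le_of_abs_le (hQ.abs_support_le hR h1 s)
    nlinarith [mul_le_mul_of_nonneg_left h3 (sq_nonneg (ψ (Q s)))]
  linarith

/-- The Rellich bound of the interior mass by the boundary Cauchy data. -/
theorem mass_le_of_rellich (hψ : IsPlaneEigenfunction Ω U Q lam ψ) (hΩ : IsOpen Ω)
    (hb : Bornology.IsBounded Ω) (hQ : IsConformalCollar Ω Q ℓ r) {R : ℝ}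
    (hR : ∀ x ∈ closure Ω, ‖x‖ ≤ R) (h1 : ∀ s : ℝ, ‖deriv Q s‖ = 1) :
    2 * lam ^ 2 * (∫ x in Ω, ψ x ^ 2) ≤ R * (lam ^ 2 * (∫ s in (0 : ℝ)..ℓ, ψ (Q s) ^ 2) +
      ∫ s in (0 : ℝ)..ℓ, derivFst (collarPullback Q ψ) (s, 0) ^ 2) := by
  have hct := hψ.continuous_trace hQ
  have hcd := hψ.continuous_trace_deriv hQ
  have hcs := hQ.continuous_support
  have i1 : IntervalIntegrable (fun s : ℝ => lam ^ 2 * ψ (Q s) ^ 2) volume 0 ℓ :=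
    (continuous_const.mul (hct.pow 2)).intervalIntegrable _ _
  have i2 : IntervalIntegrable (fun s : ℝ => derivFst (collarPullback Q ψ) (s, 0) ^ 2)
      volume 0 ℓ := (hcd.pow 2).intervalIntegrable _ _
  rw [hψ.integral_rellich hΩ hb hQ, ← intervalIntegral.integral_const_mul,
    ← intervalIntegral.integral_add i1 i2, ← intervalIntegral.integral_neg,
    ← intervalIntegral.integral_const_mul]
  simp only [hψ.gradSq_boundary hQ h1]
  refine intervalIntegral.integral_mono_on hQ.len_pos.le
    ((((continuous_const.mul (hct.pow 2)).sub (hcd.pow 2)).mul hcs).neg.intervalIntegrable _ _)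
    ((i1.add i2).const_mul R) fun s _ => ?_
  have h3 := hQ.abs_support_le hR h1 s
  set w := (Q s).im * (deriv Q s).re - (Q s).re * (deriv Q s).im
  set A := lam ^ 2 * ψ (Q s) ^ 2 with hA
  set B := derivFst (collarPullback Q ψ) (s, 0) ^ 2 with hB
  have hA0 : 0 ≤ A := by positivity
  have hB0 : 0 ≤ B := sq_nonneg _
  have h4 := neg_le_of_abs_le h3
  have h5 := le_of_abs_le h3
  nlinarith [mul_le_mul_of_nonneg_left h4 hA0, mul_le_mul_of_nonneg_left h5 hB0]

theorem mass_pos (hψ : IsPlaneEigenfunction Ω U Q lam ψ) (hΩ : IsOpen Ω)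
    (hb : Bornology.IsBounded Ω) (h : ∃ x ∈ Ω, ψ x ≠ 0) : 0 < ∫ x in Ω, ψ x ^ 2 := by
  obtain ⟨x, hx, hx0⟩ := h
  have hc := hψ.analytic.continuousOn.mono hψ.closure_subset
  rw [setIntegral_pos_iff_support_of_nonneg_ae (Filter.Eventually.of_forall fun _ => sq_nonneg _)
    (integrableOn hb (hc.pow 2))]
  have ho : IsOpen (Ω ∩ ψ ⁻¹' {0}ᶜ) :=
    (hc.mono subset_closure).isOpen_inter_preimage hΩ isOpen_compl_singleton
  refine (ho.measure_pos volume ⟨x, hx, hx0⟩).trans_le (measure_mono fun y hy => ⟨?_, hy.1⟩)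
  have : ψ y ≠ 0 := hy.2
  simpa using this

end IsPlaneEigenfunction

/-- A continuous function on an interval attains a square not smaller than its mean square. -/
theorem exists_integral_sq_le {ℓ : ℝ} (hℓ : 0 < ℓ) {f : ℝ → ℝ} (hf : Continuous f) :
    ∃ s ∈ Set.Icc 0 ℓ, ∫ s in (0 : ℝ)..ℓ, f s ^ 2 ≤ ℓ * f s ^ 2 := by
  obtain ⟨s, hs, hmax⟩ := isCompact_Icc.exists_isMaxOn (Set.nonempty_Icc.mpr hℓ.le)
    (hf.pow 2).continuousOn
  refine ⟨s, hs, ?_⟩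
  have h := intervalIntegral.integral_mono_on (g := fun _ => f s ^ 2) hℓ.le
    ((hf.pow 2).intervalIntegrable (μ := volume) 0 ℓ)
    (continuous_const.intervalIntegrable _ _) fun x hx => hmax hx
  simpa using h

namespace IsPlaneEigenfunction

variable {Ω : Set ℂ} {Q : ℂ → ℂ} {ℓ r : ℝ}

/-- Under the Schiffer condition the frequencies are bounded below. -/
theorem exists_frequency_lower_bound (hΩ : IsOpen Ω) (hb : Bornology.IsBounded Ω)
    (hQ : IsConformalCollar Ω Q ℓ r) (h1 : ∀ s : ℝ, ‖deriv Q s‖ = 1) {C₀ : ℝ} (hC₀ : 0 < C₀) :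
    ∃ lam₀ > (0 : ℝ), ∀ (U : Set ℂ) (lam : ℝ) (ψ : ℂ → ℝ), 0 < lam →
      IsPlaneEigenfunction Ω U Q lam ψ → (∃ x ∈ Ω, ψ x ≠ 0) →
      ∫ s in (0 : ℝ)..ℓ, ψ (Q s) ^ 2 ≤ exp (2 * C₀ * lam) *
        ∫ s in (0 : ℝ)..ℓ, derivFst (collarPullback Q ψ) (s, 0) ^ 2 → lam₀ ≤ lam := by
  obtain ⟨R, hR0, hR⟩ := hb.closure.exists_pos_norm_le
  have hr := hQ.pos
  obtain ⟨C, hC, hmain⟩ := exists_trace_deriv_sq_le (half_pos hr)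
    (show (0 : ℝ) ≤ 4 + 4 / r by positivity)
  set D : ℝ := R * exp (2 * C₀) * (4 * C) with hD
  have hD0 : 0 < D := by positivity
  refine ⟨min 1 (1 / (2 * R + D)), by positivity, ?_⟩
  intro U lam ψ hlam hψ hne hsch
  by_contra! hlt
  obtain ⟨hlt1, hlt2⟩ := lt_min_iff.mp hlt
  rw [lt_div_iff₀ (by positivity)] at hlt2
  set X := ∫ x in Ω, ψ x ^ 2 with hX
  have hX0 : 0 < X := hψ.mass_pos hΩ hb hne
  set b₁ := ∫ s in (0 : ℝ)..ℓ, derivFst (collarPullback Q ψ) (s, 0) ^ 2 with hb1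
  have hs2 : (2 * √X) ^ 2 = 4 * X := by rw [mul_pow, Real.sq_sqrt hX0.le]; norm_num
  have hN0 : collarNorm ℓ (r / 2) (collarPullback Q ψ) ≤ 2 * √X := by
    refine abs_le_of_sq_le_sq' ?_ (by positivity) |>.2
    rw [hs2]; exact hψ.collarNorm_sq_le hb hQ
  have hN1 : collarNorm ℓ (r / 2) (derivFst (collarPullback Q ψ)) ≤ lam * (2 * √X) := by
    refine abs_le_of_sq_le_sq' ?_ (by positivity) |>.2
    rw [mul_pow, hs2]
    have := hψ.collarNorm_derivFst_sq_le hb hQ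
    rw [hψ.integral_gradSq hΩ hb hQ] at this
    nlinarith [mul_pos (pow_pos hlam 2) hX0]
  have hb1le : b₁ ≤ C * (lam ^ 2 * (2 * √X) ^ 2) :=
    hmain (collarRegion Q r U) ℓ (collarPullback Q ψ) (fun p => ‖deriv Q (planePoint p)‖ ^ 2) lam
      (2 * √X) hlam.le hlt1.le (by positivity) (hψ.isCollarFunction hQ)
      (fun p hp => hQ.analyticAt_norm_sq_deriv hp.1) (hψ.lapProd_eq hQ)
      (hQ.abs_iterate_derivFst_norm_sq_deriv_le) hN0 hN1
  rw [hs2] at hb1le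
  have hrad := hψ.mass_le_of_radial hΩ hb hQ hlam hR0.le hR h1
  have hexp : exp (2 * C₀ * lam) ≤ exp (2 * C₀) := by
    apply exp_le_exp.mpr; nlinarith
  have hb1nn : 0 ≤ b₁ :=
    intervalIntegral.integral_nonneg hQ.len_pos.le fun _ _ => sq_nonneg _
  have h2 : (2 - 2 * R * lam) * X ≤ D * lam ^ 2 * X := by
    calc (2 - 2 * R * lam) * X ≤ R * ∫ s in (0 : ℝ)..ℓ, ψ (Q s) ^ 2 := hrad
      _ ≤ R * (exp (2 * C₀ * lam) * b₁) := by gcongr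
      _ ≤ R * (exp (2 * C₀) * (C * (lam ^ 2 * (4 * X)))) := by gcongr
      _ = D * lam ^ 2 * X := by rw [hD]; ring
  have h3 : 2 - 2 * R * lam ≤ D * lam ^ 2 := le_of_mul_le_mul_right h2 hX0
  have h4 : D * lam ^ 2 ≤ D * lam := by nlinarith
  nlinarith

/-- The interior mass is bounded by the boundary energy under the Schiffer condition. -/
theorem exists_mass_le (hΩ : IsOpen Ω) (hb : Bornology.IsBounded Ω)
    (hQ : IsConformalCollar Ω Q ℓ r) (h1 : ∀ s : ℝ, ‖deriv Q s‖ = 1) {C₀ : ℝ} (hC₀ : 0 < C₀) :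
    ∃ lam₀ > (0 : ℝ), ∃ C > (0 : ℝ), ∀ (U : Set ℂ) (lam : ℝ) (ψ : ℂ → ℝ), 0 < lam →
      IsPlaneEigenfunction Ω U Q lam ψ → (∃ x ∈ Ω, ψ x ≠ 0) →
      ∫ s in (0 : ℝ)..ℓ, ψ (Q s) ^ 2 ≤ exp (2 * C₀ * lam) *
        ∫ s in (0 : ℝ)..ℓ, derivFst (collarPullback Q ψ) (s, 0) ^ 2 → lam₀ ≤ lam ∧
      ∫ x in Ω, ψ x ^ 2 ≤ C * exp (2 * C₀ * lam) *
        ∫ s in (0 : ℝ)..ℓ, derivFst (collarPullback Q ψ) (s, 0) ^ 2 := by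
  obtain ⟨R, hR0, hR⟩ := hb.closure.exists_pos_norm_le
  obtain ⟨lam₀, hlam₀, hlow⟩ := exists_frequency_lower_bound hΩ hb hQ h1 hC₀
  refine ⟨lam₀, hlam₀, R * (1 + 1 / lam₀ ^ 2), by positivity, ?_⟩
  intro U lam ψ hlam hψ hne hsch
  have hle := hlow U lam ψ hlam hψ hne hsch
  refine ⟨hle, ?_⟩
  have hrel := hψ.mass_le_of_rellich hΩ hb hQ hR h1
  have hX0 := hψ.mass_pos hΩ hb hne
  set X := ∫ x in Ω, ψ x ^ 2 with hX
  set b₁ := ∫ s in (0 : ℝ)..ℓ, derivFst (collarPullback Q ψ) (s, 0) ^ 2 with hb1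
  set E := exp (2 * C₀ * lam) with hE
  have hb1nn : 0 ≤ b₁ :=
    intervalIntegral.integral_nonneg hQ.len_pos.le fun _ _ => sq_nonneg _
  have hE1 : 1 ≤ E := one_le_exp (by positivity)
  have h2 : lam ^ 2 * X ≤ lam ^ 2 * (R * (1 + 1 / lam₀ ^ 2) * E * b₁) := by
    have h3 : 1 ≤ lam ^ 2 * (1 / lam₀ ^ 2) := by
      rw [mul_one_div, one_le_div (by positivity)]
      exact pow_le_pow_left₀ hlam₀.le hle 2
    calc lam ^ 2 * X ≤ 2 * lam ^ 2 * X := by nlinarith [mul_pos (pow_pos hlam 2) hX0]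
      _ ≤ R * (lam ^ 2 * (E * b₁) + 1 * (1 * b₁)) := by
        rw [one_mul, one_mul]
        refine hrel.trans ?_
        gcongr
      _ ≤ R * (lam ^ 2 * (E * b₁) + lam ^ 2 * (1 / lam₀ ^ 2) * (E * b₁)) := by gcongr
      _ = lam ^ 2 * (R * (1 + 1 / lam₀ ^ 2) * E * b₁) := by ring
  exact le_of_mul_le_mul_left h2 (by positivity)

/-- The critical points of the holomorphic extension of the boundary trace. -/
def _root_.complexCriticalSet (ℓ ε : ℝ) (F : ℂ → ℂ) : Set ℂ :=
  {t : ℂ | 0 ≤ t.re ∧ t.re < ℓ ∧ |t.im| ≤ ε / 2 ∧ deriv F t = 0}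

theorem exists_critical_point_bound (hΩ : IsOpen Ω) (hb : Bornology.IsBounded Ω)
    (hQ : IsConformalCollar Ω Q ℓ r) (h1 : ∀ s : ℝ, ‖deriv Q s‖ = 1) {C₀ : ℝ} (hC₀ : 0 < C₀) :
    ∃ ε > (0 : ℝ), ∃ C > (0 : ℝ), ∀ (U : Set ℂ) (lam : ℝ) (ψ : ℂ → ℝ), 0 < lam →
      IsPlaneEigenfunction Ω U Q lam ψ → (∃ x ∈ Ω, ψ x ≠ 0) →
      ∫ s in (0 : ℝ)..ℓ, ψ (Q s) ^ 2 ≤ exp (2 * C₀ * lam) *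
        ∫ s in (0 : ℝ)..ℓ, derivFst (collarPullback Q ψ) (s, 0) ^ 2 →
      ∃ F : ℂ → ℂ, DifferentiableOn ℂ F (realStrip ε) ∧
        (∀ t ∈ realStrip ε, F (t + ℓ) = F t) ∧ (∀ s : ℝ, F s = ψ (Q s)) ∧
        (complexCriticalSet ℓ ε F).Finite ∧
        ((complexCriticalSet ℓ ε F).ncard : ℝ) ≤ C * lam := by
  have hr := hQ.pos
  have hℓ := hQ.len_pos
  obtain ⟨lam₀, hlam₀, C₁, hC₁, hmass⟩ := exists_mass_le hΩ hb hQ h1 hC₀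
  obtain ⟨r₁, hr₁, Cs, hCs, hext⟩ := exists_strip_extension_of_collar hℓ (half_pos hr)
    (show (0 : ℝ) ≤ 4 + 4 / r by positivity)
  set ε := r₁ / 2 with hε
  have hε0 : 0 < ε := half_pos hr₁
  obtain ⟨ρ, hρ0, hρ1, hcount⟩ := exists_zero_count_strip hε0 ℓ
  set P : ℝ := ℓ * (2 * Cs / ε) ^ 2 * C₁ with hP
  have hP0 : 0 < P := by positivity
  have hlogρ : log ρ < 0 := log_neg hρ0 hρ1
  set A : ℝ := |log P| / lam₀ + (2 + 2 * C₀) with hA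
  have hA0 : 0 < A := by positivity
  refine ⟨ε, hε0, A / (-2 * log ρ), div_pos hA0 (by linarith), ?_⟩
  intro U lam ψ hlam hψ hne hsch
  obtain ⟨hle, hX⟩ := hmass U lam ψ hlam hψ hne hsch
  have hX0 := hψ.mass_pos hΩ hb hne
  obtain ⟨F, hFd, hFr, hFb⟩ := hext (collarRegion Q r U) (collarPullback Q ψ)
    (fun p => ‖deriv Q (planePoint p)‖ ^ 2) lam hlam.le (hψ.isCollarFunction hQ)
    (fun p hp => hQ.analyticAt_norm_sq_deriv hp.1) (hψ.lapProd_eq hQ)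
    (hQ.abs_iterate_derivFst_norm_sq_deriv_le)
  have hN0sq := hψ.collarNorm_sq_le hb hQ
  set X := ∫ x in Ω, ψ x ^ 2 with hXdef
  have hFr' : ∀ s : ℝ, F s = ψ (Q s) := fun s => by rw [hFr s, collarPullback, planePoint_zero_snd]
  have hmono : realStrip ε ⊆ realStrip r₁ := realStrip_mono (by linarith)
  have hN0 : collarNorm ℓ (r / 2) (collarPullback Q ψ) ≤ 2 * √X := by
    refine abs_le_of_sq_le_sq' ?_ (by positivity) |>.2
    rw [mul_pow, Real.sq_sqrt hX0.le]
    linarith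
  set M : ℝ := Cs * exp lam * (2 * √X) / ε with hM
  have hF'b : ∀ z ∈ realStrip ε, ‖deriv F z‖ ≤ M := by
    intro z hz
    have hz' : |z.im| < ε := hz
    have hsub : Metric.closedBall z ε ⊆ realStrip r₁ := by
      intro w hw
      have h2 : ‖w - z‖ ≤ ε := by simpa [dist_eq_norm] using hw
      have h3 := (Complex.abs_im_le_norm (w - z)).trans h2
      rw [Complex.sub_im] at h3
      change |w.im| < r₁
      have h4 : |w.im| ≤ |w.im - z.im| + |z.im| := by
        simpa using abs_add_le (w.im - z.im) z.im
      linarith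
    refine Complex.norm_deriv_le_of_forall_mem_sphere_norm_le hε0
      (hFd.mono ((closure_minimal Metric.ball_subset_closedBall
        Metric.isClosed_closedBall).trans hsub)).diffContOnCl fun w hw => ?_
    refine (hFb w (hsub (Metric.sphere_subset_closedBall hw))).trans ?_
    gcongr
  have hperiod : ∀ t ∈ realStrip ε, F (t + ℓ) = F t := by
    refine fun t ht => periodic_of_periodic_real hFd (fun s => ?_) t (hmono ht)
    have hs := hQ.periodic s (ofReal_mem_realStrip hr s)
    have := hFr' (s + ℓ)
    rw [Complex.ofReal_add] at this
    rw [this, hFr' s, hs]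
  have hF'r : ∀ s : ℝ, ‖deriv F s‖ = |derivFst (collarPullback Q ψ) (s, 0)| := by
    intro s
    have h2 : HasDerivAt F (deriv F s) s := (hFd.differentiableAt
      ((isOpen_realStrip r₁).mem_nhds (ofReal_mem_realStrip hr₁ s))).hasDerivAt
    have h3 := h2.comp_ofReal
    have h4 : (fun u : ℝ => F u) = fun u : ℝ => ((ψ (Q u) : ℝ) : ℂ) := funext hFr'
    rw [h4] at h3
    rw [h3.unique (hψ.hasDerivAt_trace hQ s).ofReal_comp, Complex.norm_real, Real.norm_eq_abs]
  obtain ⟨s₀, hs₀, hb₁⟩ := exists_integral_sq_le hℓ (hψ.continuous_trace_deriv hQ)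
  set b₁ := ∫ s in (0 : ℝ)..ℓ, derivFst (collarPullback Q ψ) (s, 0) ^ 2 with hb1
  have hb1pos : 0 < b₁ := by
    by_contra! hneg
    have : C₁ * exp (2 * C₀ * lam) * b₁ ≤ 0 :=
      mul_nonpos_of_nonneg_of_nonpos (by positivity) hneg
    linarith
  refine ⟨F, hFd.mono hmono, hperiod, hFr', finite_and_ncard_le_of_forall_finset fun Z hZ => ?_⟩
  have hcnt := hcount (deriv F) M s₀ Z ((hFd.deriv (isOpen_realStrip r₁)).mono hmono) hF'b
    fun z hz => by
      obtain ⟨z1, z2, z3, z4⟩ := hZ hz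
      exact ⟨abs_le.mpr ⟨by linarith [hs₀.2], by linarith [hs₀.1]⟩, z3, z4⟩
  rw [hF'r] at hcnt
  have hsq := pow_le_pow_left₀ (abs_nonneg _) hcnt 2
  rw [sq_abs] at hsq
  have hM2 : (M * ρ ^ Z.card) ^ 2 =
      (2 * Cs / ε) ^ 2 * (exp (2 * lam) * (ρ ^ 2) ^ Z.card) * X := by
    rw [hM]
    have h2 : exp (2 * lam) = exp lam ^ 2 := by rw [two_mul, exp_add, sq]
    have h3 : √X ^ 2 = X := Real.sq_sqrt hX0.le
    rw [h2]
    calc (Cs * exp lam * (2 * √X) / ε * ρ ^ Z.card) ^ 2 =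
        (2 * Cs / ε) ^ 2 * (exp lam ^ 2 * (ρ ^ 2) ^ Z.card) * √X ^ 2 := by ring
      _ = _ := by rw [h3]
  rw [hM2] at hsq
  have hfin : 1 * b₁ ≤ P * exp ((2 + 2 * C₀) * lam) * (ρ ^ 2) ^ Z.card * b₁ := by
    have h2 : exp ((2 + 2 * C₀) * lam) = exp (2 * lam) * exp (2 * C₀ * lam) := by
      rw [← exp_add]; ring_nf
    calc 1 * b₁ ≤ ℓ * ((2 * Cs / ε) ^ 2 * (exp (2 * lam) * (ρ ^ 2) ^ Z.card) * X) := by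
          rw [one_mul]; exact hb₁.trans (mul_le_mul_of_nonneg_left hsq hℓ.le)
      _ ≤ ℓ * ((2 * Cs / ε) ^ 2 * (exp (2 * lam) * (ρ ^ 2) ^ Z.card) *
          (C₁ * exp (2 * C₀ * lam) * b₁)) := by gcongr
      _ = _ := by rw [h2, hP]; ring
  have hone := le_of_mul_le_mul_right hfin hb1pos
  have hlog := log_le_log one_pos hone
  rw [log_one, log_mul (by positivity) (by positivity), log_mul hP0.ne' (exp_pos _).ne', log_exp,
    log_pow, log_pow] at hlog
  rw [div_mul_eq_mul_div, le_div_iff₀ (by linarith)]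
  have h5 : |log P| ≤ |log P| / lam₀ * lam := by
    rw [div_mul_eq_mul_div, le_div_iff₀ hlam₀]
    exact mul_le_mul_of_nonneg_left hle (abs_nonneg _)
  have h6 := le_abs_self (log P)
  push_cast at hlog
  rw [hA]
  nlinarith

end IsPlaneEigenfunction

/-- A unit vector orthogonal to a unit complex number is obtained by a quarter turn. -/
theorem eq_I_mul_or_eq_neg_I_mul {w v : ℂ} (hw : ‖w‖ = 1) (hv : ‖v‖ = 1) (h : ⟪w, v⟫ = 0) :
    w = Complex.I * v ∨ w = -(Complex.I * v) := by
  rw [Complex.inner] at h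
  have hw2 := Complex.normSq_eq_norm_sq w
  have hv2 := Complex.normSq_eq_norm_sq v
  rw [hw, Complex.normSq_apply] at hw2
  rw [hv, Complex.normSq_apply] at hv2
  obtain ⟨a, b⟩ := w
  obtain ⟨c, d⟩ := v
  simp only [Complex.mul_re, Complex.conj_re, Complex.conj_im] at h
  simp only at hw2 hv2
  have hk : (b * c - a * d - 1) * (b * c - a * d + 1) = 0 := by nlinarith
  have e1 : a = -(b * c - a * d) * d := by linear_combination (-a) * hv2 + c * h
  have e2 : b = (b * c - a * d) * c := by linear_combination (-b) * hv2 + d * h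
  rcases mul_eq_zero.mp hk with hk | hk
  · left
    have hk' : b * c - a * d = 1 := by linarith
    rw [hk'] at e1 e2
    apply Complex.ext <;> simp <;> linarith
  · right
    have hk' : b * c - a * d = -1 := by linarith
    rw [hk'] at e1 e2
    apply Complex.ext <;> simp <;> linarith

/-- An isometric identification of the Euclidean plane with the complex plane, preserving the
coordinate axes. -/
structure IsPlaneIsometry (L : E2 ≃ₗᵢ[ℝ] ℂ) : Prop where
  symm_one : L.symm 1 = EuclideanSpace.single 0 1
  symm_I : L.symm Complex.I = EuclideanSpace.single 1 1 ∨
    L.symm Complex.I = -EuclideanSpace.single 1 1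

theorem exists_isPlaneIsometry {v w : E2} (hv : ‖v‖ = 1) (hw : ‖w‖ = 1) (h : ⟪w, v⟫ = 0) :
    ∃ L : E2 ≃ₗᵢ[ℝ] ℂ, IsPlaneIsometry L ∧ L w = Complex.I * L v := by
  set L₀ : E2 ≃ₗᵢ[ℝ] ℂ := Complex.orthonormalBasisOneI.repr.symm with hL₀
  have h1 : L₀.symm 1 = EuclideanSpace.single 0 1 := by
    rw [LinearIsometryEquiv.symm_apply_eq, hL₀, Complex.orthonormalBasisOneI_repr_symm_apply]
    simp
  have h2 : L₀.symm Complex.I = EuclideanSpace.single 1 1 := by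
    rw [LinearIsometryEquiv.symm_apply_eq, hL₀, Complex.orthonormalBasisOneI_repr_symm_apply]
    simp
  rcases eq_I_mul_or_eq_neg_I_mul (w := L₀ w) (v := L₀ v) (by rw [L₀.norm_map, hw])
    (by rw [L₀.norm_map, hv]) (by rw [L₀.inner_map_map, h]) with he | he
  · exact ⟨L₀, ⟨h1, Or.inl h2⟩, he⟩
  · refine ⟨L₀.trans Complex.conjLIE, ⟨?_, Or.inr ?_⟩, ?_⟩
    · simpa using h1
    · rw [LinearIsometryEquiv.symm_apply_eq, map_neg, ← h2]
      simp
    · simp [he]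

variable {L : E2 ≃ₗᵢ[ℝ] ℂ}

theorem fderiv_comp_planeIsometry (φ : E2 → ℝ) (x v : ℂ) :
    fderiv ℝ (fun y => φ (L.symm y)) x v = fderiv ℝ φ (L.symm x) (L.symm v) := by
  have := (L.symm.toContinuousLinearEquiv).comp_right_fderiv (f := φ) (x := x)
  exact DFunLike.congr_fun this v

theorem IsPlaneIsometry.planeLap_eq (hL : IsPlaneIsometry L) (φ : E2 → ℝ) (x : ℂ) :
    planeLap (fun y => φ (L.symm y)) x = lap φ (L.symm x) := by
  simp only [planeLap, lap, Fin.sum_univ_two, fderiv_comp_planeIsometry]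
  rw [fderiv_comp_planeIsometry (fun z => fderiv ℝ φ z (L.symm 1)),
    fderiv_comp_planeIsometry (fun z => fderiv ℝ φ z (L.symm Complex.I)), hL.symm_one]
  rcases hL.symm_I with h | h
  · rw [h]
  · rw [h]
    simp only [map_neg, fderiv_fun_neg, neg_apply, neg_neg]

theorem BoundaryParam.isBoundaryCurve {Ω : Set E2} (hΩ : IsPlaneDomain Ω) (B : BoundaryParam Ω)
    (hB : B.IsAnalytic) (hL0 : L (B.ν 0) = Complex.I * L (B.qd 0)) :
    IsBoundaryCurve (L '' Ω) (fun s => L (B.q s)) B.len := by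
  have hd : ∀ s, HasDerivAt (fun s => L (B.q s)) (L (B.qd s)) s := fun s =>
    L.toContinuousLinearEquiv.hasFDerivAt.comp_hasDerivAt s (B.hasDerivAt s)
  exact
  { isOpen := L.toHomeomorph.isOpenMap _ hΩ.isOpen
    isBounded := L.lipschitz.isBounded_image hΩ.isBounded
    len_pos := B.len_pos
    analytic := fun s hs => AnalyticAt.fun_comp (g := L)
      ((L.toContinuousLinearEquiv : E2 →L[ℝ] ℂ).analyticAt _) (hB s hs)
    periodic := fun s => by simp only [B.periodic s]
    injOn := fun s hs s' hs' h => B.injOn hs hs' (L.injective h)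
    norm_deriv := fun s => by rw [(hd s).deriv, L.norm_map, B.unitSpeed]
    range_eq := by
      have h1 : (fun s => L (B.q s)) = L ∘ B.q := rfl
      rw [h1, Set.range_comp, B.range_eq]
      exact L.toHomeomorph.image_frontier Ω
    inward := by
      obtain ⟨δ, hδ, h⟩ := B.ν_inward 0
      refine ⟨δ, hδ, fun t ht => ⟨_, h t ht, ?_⟩⟩
      rw [(hd 0).deriv, map_add, map_smul, hL0, Complex.real_smul] }

theorem IsNeumannEigenfunction.isPlaneEigenfunction {Ω : Set E2} {B : BoundaryParam Ω} {lam : ℝ}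
    {φ : E2 → ℝ} (hφ : IsNeumannEigenfunction B lam φ) (hL : IsPlaneIsometry L) {Q : ℂ → ℂ}
    (hQ : ∀ s : ℝ, Q s = L (B.q s)) (hQ1 : ∀ s : ℝ, deriv Q s = L (B.qd s)) :
    ∃ U, IsPlaneEigenfunction (L '' Ω) U Q lam (fun x => φ (L.symm x)) := by
  obtain ⟨U, hU, hΩU, hφU⟩ := hφ.analytic
  refine ⟨L.symm ⁻¹' U, hU.preimage L.symm.continuous, ?_, ?_, ?_, ?_⟩
  · have h1 : closure (L '' Ω) = L '' closure Ω := (L.toHomeomorph.image_closure Ω).symm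
    rw [h1]
    rintro _ ⟨x, hx, rfl⟩
    simpa using hΩU hx
  · exact fun x hx => AnalyticAt.fun_comp (f := L.symm) (hφU _ hx)
      ((L.symm.toContinuousLinearEquiv : ℂ →L[ℝ] E2).analyticAt _)
  · rintro _ ⟨x, hx, rfl⟩
    rw [hL.planeLap_eq, L.symm_apply_apply, hφ.eigen x hx]
  · intro s
    rw [fderiv_comp_planeIsometry, hQ, hQ1, L.symm_apply_apply]
    have h0 : fderiv ℝ φ (B.q s) (B.ν s) = 0 := by
      rw [← inner_gradient_left]; exact hφ.neumann s
    rcases eq_I_mul_or_eq_neg_I_mul (w := L (B.ν s)) (v := L (B.qd s))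
      (by rw [L.norm_map, B.ν_unit]) (by rw [L.norm_map, B.unitSpeed])
      (by rw [L.inner_map_map]; exact B.ν_orth s) with he | he
    · rw [← he, L.symm_apply_apply, h0]
    · have he' : Complex.I * L (B.qd s) = -L (B.ν s) := by rw [he, neg_neg]
      rw [he', map_neg, L.symm_apply_apply, map_neg, h0, neg_zero]

/-- Under the asymptotic Schiffer condition, the boundary values of a Neumann eigenfunction
extend holomorphically to a uniform strip, and the number of complex boundary critical
points (zeros of the derivative of the extension) is at most `C·λ`. -/
theorem neumann_complex_boundary_critical_points
    (Ω : Set E2) (hΩ : IsPlaneDomain Ω) (B : BoundaryParam Ω) (hB : B.IsAnalytic) :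
    ∀ C₀ > (0 : ℝ), ∃ ε > (0 : ℝ), ∃ C > (0 : ℝ), ∀ lam : ℝ, 0 < lam → ∀ φ : E2 → ℝ,
      IsNeumannEigenfunction B lam φ →
      (∫ s in (0 : ℝ)..B.len, (deriv (fun u => φ (B.q u)) s) ^ 2) ≥
        Real.exp (-2 * C₀ * lam) * ∫ s in (0 : ℝ)..B.len, (φ (B.q s)) ^ 2 →
      ∃ F : ℂ → ℂ,
        DifferentiableOn ℂ F {t : ℂ | |t.im| < ε} ∧
        (∀ t : ℂ, |t.im| < ε → F (t + B.len) = F t) ∧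
        (∀ s : ℝ, F s = (φ (B.q s) : ℂ)) ∧
        ({t : ℂ | 0 ≤ t.re ∧ t.re < B.len ∧ |t.im| ≤ ε / 2 ∧ deriv F t = 0}).Finite ∧
        (({t : ℂ | 0 ≤ t.re ∧ t.re < B.len ∧ |t.im| ≤ ε / 2 ∧
            deriv F t = 0}).ncard : ℝ) ≤ C * lam := by
  intro C₀ hC₀
  obtain ⟨L, hL, hL0⟩ := exists_isPlaneIsometry (B.unitSpeed 0) (B.ν_unit 0) (B.ν_orth 0)
  have hcurve := B.isBoundaryCurve hΩ hB hL0
  obtain ⟨r, -, Q, hQ, hQq⟩ := hcurve.exists_isConformalCollar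
  have hQd : ∀ s : ℝ, deriv Q s = L (B.qd s) := by
    intro s
    have h1 := (hQ.analyticAt
      (ofReal_mem_realStrip hQ.pos s)).differentiableAt.hasDerivAt.comp_ofReal
    rw [show (fun s : ℝ => Q s) = fun s => L (B.q s) from funext hQq] at h1
    exact h1.unique (L.toContinuousLinearEquiv.hasFDerivAt.comp_hasDerivAt s (B.hasDerivAt s))
  have hQn : ∀ s : ℝ, ‖deriv Q s‖ = 1 := fun s => by rw [hQd, L.norm_map, B.unitSpeed]
  obtain ⟨ε, hε, C, hC, hmain⟩ := IsPlaneEigenfunction.exists_critical_point_bound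
    hcurve.isOpen hcurve.isBounded hQ hQn hC₀
  refine ⟨ε, hε, C, hC, fun lam hlam φ hφ hsch => ?_⟩
  obtain ⟨U, hψ⟩ := hφ.isPlaneEigenfunction hL hQq hQd
  have htr : ∀ s : ℝ, φ (L.symm (Q s)) = φ (B.q s) := fun s => by
    rw [hQq, L.symm_apply_apply]
  obtain ⟨x, hx, hx0⟩ := hφ.nontrivial
  obtain ⟨F, hFd, hFp, hFr, hfin, hcard⟩ := hmain U lam _ hlam hψ
    ⟨L x, ⟨x, hx, rfl⟩, by simpa using hx0⟩ (by
      simp only [htr]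
      have hd : ∀ s, deriv (fun u => φ (B.q u)) s =
          derivFst (collarPullback Q fun x => φ (L.symm x)) (s, 0) := fun s => by
        rw [← (hψ.hasDerivAt_trace hQ s).deriv]
        simp only [htr]
      simp only [hd] at hsch
      have h1 : exp (-2 * C₀ * lam) = (exp (2 * C₀ * lam))⁻¹ := by
        rw [← exp_neg]; ring_nf
      rw [h1, ge_iff_le, inv_mul_le_iff₀ (exp_pos _)] at hsch
      exact hsch)
  exact ⟨F, hFd, hFp, fun s => by rw [hFr, htr], hfin, hcard⟩
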